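/- (Brown–Zhang) Let k be a field and let H be a noetherian Hopf algebra over k which is Auslander-Gorenstein and Cohen-Macaulay with respect to Gelfand–Kirillov dimension. Then H is AS-Gorenstein: H has finite (and equal) left and right injective dimension d, and Ext^i_H(k, H) = 0 for i ≠ d while Ext^d_H(k, H) is one-dimensional over k, where k denotes the trivial H-module given by the counit ε. -/

import Mathlib

open CategoryTheory

universe w v u u' u2

/-!
STATEMENT 14 (Brown–Zhang):
A noetherian Hopf algebra over a field `k` which is Auslander-Gorenstein and
Cohen-Macaulay (with respect to Gelfand-Kirillov dimension) is AS-Gorenstein: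
it has finite (and equal) left and right injective dimension `d`,
`Ext^i_H (k, H) = 0` for `i ≠ d`, and `Ext^d_H (k, H)` is one-dimensional over `k`,
where `k` is the trivial `H`-module given by the counit `ε`.
-/

/-! ### Ext groups over an arbitrary ring -/

instance hasExtModuleCat (R : Type u) [Ring R] :
    HasExt.{max u (v + 1)} (ModuleCat.{v} R) :=
  letI := HasDerivedCategory.standard (ModuleCat.{v} R)
  hasExt_of_hasDerivedCategory _

/-- The canonical map `(X ⟶ Y) → Ext X Y 0` is additive. -/
lemma Ext_mk₀_add {C : Type*} [Category C] [Abelian C] [HasExt.{w} C] {X Y : C}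
    (f g : X ⟶ Y) :
    Abelian.Ext.mk₀ (f + g) = Abelian.Ext.mk₀ f + Abelian.Ext.mk₀ g := by
  letI := HasDerivedCategory.standard C
  ext
  rw [Abelian.Ext.add_hom, Abelian.Ext.mk₀_hom, Abelian.Ext.mk₀_hom, Abelian.Ext.mk₀_hom,
    Functor.map_add]
  dsimp [ShiftedHom.mk₀]
  rw [Preadditive.add_comp]

/-- The Ext-group `Ext_A^i (M, N)` for two left `A`-modules `M` and `N`. -/
noncomputable abbrev ExtGroup (A : Type u) [Ring A]
    (M : Type v) [AddCommGroup M] [Module A M]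
    (N : Type w) [AddCommGroup N] [Module A N] (i : ℕ) :=
  Abelian.Ext (C := ModuleCat.{max v w u} A)
    (ModuleCat.of A (ULift.{max w u} M)) (ModuleCat.of A (ULift.{max v u} N)) i

/-! ### The right `A`-module structure on `Ext_A^i (M, A)` -/

/-- Right multiplication by `a : A` on `A`, as an endomorphism of the left module `A`. -/
def rmulLinear (A : Type u) [Ring A] (a : A) :
    ULift.{w} A →ₗ[A] ULift.{w} A where
  toFun x := ⟨x.down * a⟩
  map_add' x y := by ext; exact add_mul _ _ _
  map_smul' r x := by ext; exact mul_assoc r x.down a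

/-- The right action of `A` on `Ext_A^i (M, A)` induced by right multiplication of `A`
on itself (which is an endomorphism of `A` as a left `A`-module). -/
noncomputable def extSmulOp (A : Type u) [Ring A]
    (M : Type v) [AddCommGroup M] [Module A M] (i : ℕ)
    (a : Aᵐᵒᵖ) (e : ExtGroup A M A i) : ExtGroup A M A i :=
  e.comp (Abelian.Ext.mk₀ (ModuleCat.ofHom (rmulLinear A a.unop))) (add_zero i)

/-- `Ext_A^i (M, A)` is a right `A`-module, i.e. a module over `Aᵐᵒᵖ`, via the right
multiplication action of `A` on itself. -/
noncomputable instance extGroupModuleOp (A : Type u) [Ring A]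
    (M : Type v) [AddCommGroup M] [Module A M] (i : ℕ) :
    Module Aᵐᵒᵖ (ExtGroup A M A i) where
  smul a e := extSmulOp A M i a e
  one_smul e := by
    show extSmulOp A M i 1 e = e
    unfold extSmulOp
    have h1 : ModuleCat.ofHom (rmulLinear A ((1 : Aᵐᵒᵖ).unop)) =
        𝟙 (ModuleCat.of A (ULift.{max v u} A)) := by
      ext x
      exact mul_one x.down
    rw [h1, Abelian.Ext.comp_mk₀_id]
  mul_smul a b e := by
    show extSmulOp A M i (a * b) e = extSmulOp A M i a (extSmulOp A M i b e)
    unfold extSmulOp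
    have h1 : ModuleCat.ofHom (rmulLinear A ((a * b).unop)) =
        ModuleCat.ofHom (rmulLinear A b.unop) ≫ ModuleCat.ofHom (rmulLinear A a.unop) := by
      ext x
      exact (mul_assoc x.down b.unop a.unop).symm
    rw [h1, ← Abelian.Ext.mk₀_comp_mk₀,
      ← Abelian.Ext.comp_assoc_of_second_deg_zero]
  smul_zero a := by
    show extSmulOp A M i a 0 = 0
    unfold extSmulOp
    exact Abelian.Ext.zero_comp _ i
      (Abelian.Ext.mk₀ (ModuleCat.ofHom (rmulLinear A a.unop))) i (add_zero i)
  smul_add a e f := by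
    show extSmulOp A M i a (e + f) = extSmulOp A M i a e + extSmulOp A M i a f
    unfold extSmulOp
    exact Abelian.Ext.add_comp _ _ _ _
  add_smul a b e := by
    show extSmulOp A M i (a + b) e = extSmulOp A M i a e + extSmulOp A M i b e
    unfold extSmulOp
    have h1 : ModuleCat.ofHom (rmulLinear A ((a + b).unop)) =
        ModuleCat.ofHom (rmulLinear A a.unop) + ModuleCat.ofHom (rmulLinear A b.unop) := by
      ext x
      exact mul_add x.down a.unop b.unop
    rw [h1, Ext_mk₀_add, Abelian.Ext.comp_add]
  zero_smul e := by
    show extSmulOp A M i 0 e = 0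
    unfold extSmulOp
    have h1 : ModuleCat.ofHom (rmulLinear A ((0 : Aᵐᵒᵖ).unop)) =
        (0 : ModuleCat.of A (ULift.{max v u} A) ⟶ ModuleCat.of A (ULift.{max v u} A)) := by
      ext x
      exact mul_zero x.down
    rw [h1, Abelian.Ext.mk₀_zero, Abelian.Ext.comp_zero]

/-! ### Grade and injective dimension -/

/-- The grade `j(M) = inf { j | Ext_A^j (M, A) ≠ 0 }` of an `A`-module `M`,
an element of `ℕ∞` (with `inf ∅ = ∞`). -/
noncomputable def moduleGrade (A : Type u) [Ring A]
    (M : Type v) [AddCommGroup M] [Module A M] : ℕ∞ :=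
  sInf {j : ℕ∞ | ∃ i : ℕ, j = (i : ℕ∞) ∧ Nontrivial (ExtGroup A M A i)}

/-- The injective dimension of `A` as a left module over itself, an element of `ℕ∞`:
the least `n` such that `Ext_A^i (M, A) = 0` for all modules `M` and all `i > n`. -/
noncomputable def selfInjectiveDimension (A : Type u) [Ring A] : ℕ∞ :=
  sInf {d : ℕ∞ | ∃ n : ℕ, d = (n : ℕ∞) ∧
    ∀ (M : Type u) [AddCommGroup M] [Module A M],
      ∀ i : ℕ, n < i → Subsingleton (ExtGroup A M A i)}

/-- A ring has finite global dimension if there is a uniform bound above which all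
Ext-groups vanish. -/
def HasFiniteGlobalDimension (A : Type u) [Ring A] : Prop :=
  ∃ n : ℕ, ∀ (M N : Type u) [AddCommGroup M] [Module A M] [AddCommGroup N] [Module A N],
    ∀ i : ℕ, n < i → Subsingleton (ExtGroup A M N i)

/-- The Auslander condition: for every noetherian left `A`-module `M`, every `i ≥ 0` and
every (right-) submodule `N` of `Ext_A^i (M, A)`, one has `j(N) ≥ i`. -/
def AuslanderCondition (A : Type u) [Ring A] : Prop :=
  ∀ (M : Type u) [AddCommGroup M] [Module A M], IsNoetherian A M →
    ∀ (i : ℕ) (N : Submodule Aᵐᵒᵖ (ExtGroup A M A i)), (i : ℕ∞) ≤ moduleGrade Aᵐᵒᵖ ↥N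

/-! ### The `k`-module structure on `Ext_A^i (M, N)` for a `k`-algebra `A` -/

/-- Scalar multiplication by `c : k` on an `A`-module `N`, as an `A`-linear
endomorphism, where `A` is a `k`-algebra. -/
def scalarLinear (k : Type u') (A : Type u) [CommRing k] [Ring A] [Algebra k A]
    (N : Type v) [AddCommGroup N] [Module A N] (c : k) :
    ULift.{u2} N →ₗ[A] ULift.{u2} N where
  toFun x := ⟨algebraMap k A c • x.down⟩
  map_add' x y := by ext; exact smul_add _ _ _
  map_smul' a x := by
    ext
    show algebraMap k A c • a • x.down = a • algebraMap k A c • x.down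
    rw [smul_smul, smul_smul, Algebra.commutes]

/-- The action of `k` on `Ext_A^i (M, N)`, for a `k`-algebra `A`. -/
noncomputable def extSmulBase {k : Type u'} (A : Type u) [CommRing k] [Ring A] [Algebra k A]
    (M : Type v) [AddCommGroup M] [Module A M]
    (N : Type w) [AddCommGroup N] [Module A N] (i : ℕ)
    (c : k) (e : ExtGroup A M N i) : ExtGroup A M N i :=
  e.comp (Abelian.Ext.mk₀ (ModuleCat.ofHom (scalarLinear k A N c))) (add_zero i)

/-- `Ext_A^i (M, N)` is a `k`-module when `A` is a `k`-algebra. -/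
noncomputable instance extGroupModuleBase (k : Type u') (A : Type u)
    [CommRing k] [Ring A] [Algebra k A]
    (M : Type v) [AddCommGroup M] [Module A M]
    (N : Type w) [AddCommGroup N] [Module A N] (i : ℕ) :
    Module k (ExtGroup A M N i) where
  smul c e := extSmulBase A M N i c e
  one_smul e := by
    show extSmulBase A M N i 1 e = e
    unfold extSmulBase
    have h1 : ModuleCat.ofHom (scalarLinear k A N (1 : k)) =
        𝟙 (ModuleCat.of A (ULift.{max v u} N)) := by
      ext x
      exact
        (show algebraMap k A (1 : k) • x.down = x.down by rw [map_one, one_smul])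
    rw [h1, Abelian.Ext.comp_mk₀_id]
  mul_smul c d e := by
    show extSmulBase A M N i (c * d) e = extSmulBase A M N i c (extSmulBase A M N i d e)
    unfold extSmulBase
    have h1 : ModuleCat.ofHom (scalarLinear k A N (c * d)) =
        ModuleCat.ofHom (scalarLinear k A N d) ≫ ModuleCat.ofHom (scalarLinear k A N c) := by
      ext x
      exact
        (show algebraMap k A (c * d) • x.down = algebraMap k A c • algebraMap k A d • x.down
          by rw [map_mul, mul_smul])
    rw [h1, ← Abelian.Ext.mk₀_comp_mk₀,
      ← Abelian.Ext.comp_assoc_of_second_deg_zero]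
  smul_zero c := by
    show extSmulBase A M N i c 0 = 0
    unfold extSmulBase
    exact Abelian.Ext.zero_comp _ i
      (Abelian.Ext.mk₀ (ModuleCat.ofHom (scalarLinear k A N c))) i (add_zero i)
  smul_add c e f := by
    show extSmulBase A M N i c (e + f) = extSmulBase A M N i c e + extSmulBase A M N i c f
    unfold extSmulBase
    exact Abelian.Ext.add_comp _ _ _ _
  add_smul c d e := by
    show extSmulBase A M N i (c + d) e = extSmulBase A M N i c e + extSmulBase A M N i d e
    unfold extSmulBase
    have h1 : ModuleCat.ofHom (scalarLinear k A N (c + d)) =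
        ModuleCat.ofHom (scalarLinear k A N c) + ModuleCat.ofHom (scalarLinear k A N d) := by
      ext x
      exact
        (show algebraMap k A (c + d) • x.down =
            algebraMap k A c • x.down + algebraMap k A d • x.down
          by rw [map_add, add_smul])
    rw [h1, Ext_mk₀_add, Abelian.Ext.comp_add]
  zero_smul e := by
    show extSmulBase A M N i (0 : k) e = 0
    unfold extSmulBase
    have h1 : ModuleCat.ofHom (scalarLinear k A N (0 : k)) =
        (0 : ModuleCat.of A (ULift.{max v u} N) ⟶ ModuleCat.of A (ULift.{max v u} N)) := by
      ext x
      exact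
        (show algebraMap k A (0 : k) • x.down = 0 by rw [map_zero, zero_smul])
    rw [h1, Abelian.Ext.mk₀_zero, Abelian.Ext.comp_zero]

/-! ### Gelfand–Kirillov dimension -/

open ENNReal in
/-- The Gelfand–Kirillov dimension of a `k`-algebra `A`:
`GKdim A = sup_V limsup_n log_n dim_k ((k + V)^n)`, the supremum being taken over all
finite-dimensional subspaces `V` of `A`. -/
noncomputable def gkDim (k : Type u') (A : Type u) [Field k] [Ring A] [Algebra k A] : ℝ≥0∞ :=
  ⨆ (V : Submodule k A) (_ : FiniteDimensional k V),
    Filter.limsup (fun n : ℕ =>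
      ENNReal.ofReal (Real.logb n (Module.finrank k (((1 ⊔ V) ^ n : Submodule k A)))))
      Filter.atTop

/-- The product `W • F` of a subspace `W` of an algebra `A` and a subspace `F` of an
`A`-module `M`. -/
def subspaceSMul (k : Type u') {A : Type u} {M : Type v} [Field k] [Ring A] [Algebra k A]
    [AddCommGroup M] [Module k M] [Module A M] [IsScalarTower k A M]
    (W : Submodule k A) (F : Submodule k M) : Submodule k M :=
  Submodule.span k {z : M | ∃ a ∈ W, ∃ m ∈ F, z = a • m}

open ENNReal in
/-- The Gelfand–Kirillov dimension of a module `M` over a `k`-algebra `A`: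
`GKdim M = sup_{V, F} limsup_n log_n dim_k ((k + V)^n • F)`, the supremum being taken
over all finite-dimensional subspaces `V` of `A` and `F` of `M`. -/
noncomputable def gkDimModule (k : Type u') (A : Type u) (M : Type v) [Field k] [Ring A]
    [Algebra k A] [AddCommGroup M] [Module k M] [Module A M] [IsScalarTower k A M] : ℝ≥0∞ :=
  ⨆ (V : Submodule k A) (_ : FiniteDimensional k V)
    (F : Submodule k M) (_ : FiniteDimensional k F),
    Filter.limsup (fun n : ℕ =>
      ENNReal.ofReal (Real.logb n
        (Module.finrank k (subspaceSMul k ((1 ⊔ V) ^ n : Submodule k A) F))))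
      Filter.atTop

/-! ### The trivial module of a Hopf algebra -/

/-- The trivial left `H`-module `k`: the field `k`, with `H` acting through the
counit `ε : H → k`. -/
@[nolint unusedArguments]
def TrivialCounitModule (k : Type u') (H : Type u) [CommSemiring k] [Semiring H]
    [HopfAlgebra k H] : Type u' := k

instance (k : Type u') (H : Type u) [Field k] [Ring H] [HopfAlgebra k H] :
    AddCommGroup (TrivialCounitModule k H) :=
  inferInstanceAs (AddCommGroup k)

noncomputable instance (k : Type u') (H : Type u) [Field k] [Ring H] [HopfAlgebra k H] :
    Module H (TrivialCounitModule k H) :=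
  Module.compHom k (Bialgebra.counitAlgHom k H).toRingHom

/-! ### Finite free resolutions given by matrices -/

/-- A resolution of an `A`-module by finite free left modules, the differentials being right
multiplication of row vectors by matrices. -/
structure FreeRes (A : Type u) [Ring A] (M : Type v) [AddCommGroup M] [Module A M] where
  n : ℕ → ℕ
  X : ∀ i, Matrix (Fin (n (i + 1))) (Fin (n i)) A
  ε : (Fin (n 0) → A) →ₗ[A] M
  surj : Function.Surjective ε
  exact₀ : Function.Exact (X 0).vecMulLinear ε
  exact : ∀ i, Function.Exact (X (i + 1)).vecMulLinear (X i).vecMulLinear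

/-- Matrices over `A` act on column vectors with entries in any `W` on which `A` acts. -/
def colMap {A : Type*} [Ring A] {S W : Type*} [Semiring S] [AddCommGroup W] [Module S W]
    (ρ : A →+* Module.End S W) {m n : ℕ} (X : Matrix (Fin m) (Fin n) A) :
    (Fin n → W) →ₗ[S] (Fin m → W) :=
  LinearMap.pi fun l => ∑ j, ρ (X l j) ∘ₗ LinearMap.proj j

section colMap

variable {A : Type*} [Ring A] {S W : Type*} [Semiring S] [AddCommGroup W] [Module S W]
  (ρ : A →+* Module.End S W) {m n p : ℕ}

lemma colMap_apply (X : Matrix (Fin m) (Fin n) A) (c : Fin n → W) (l : Fin m) :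
    colMap ρ X c l = ∑ j, ρ (X l j) (c j) := by
  simp [colMap]

lemma colMap_colMap (X : Matrix (Fin m) (Fin n) A) (Y : Matrix (Fin n) (Fin p) A)
    (c : Fin p → W) : colMap ρ X (colMap ρ Y c) = colMap ρ (X * Y) c := by
  ext l
  simp only [colMap_apply, Matrix.mul_apply, map_sum, map_mul, LinearMap.sum_apply,
    Module.End.mul_apply]
  exact Finset.sum_comm

lemma colMap_zero (c : Fin n → W) : colMap ρ (0 : Matrix (Fin m) (Fin n) A) c = 0 := by
  ext l
  simp [colMap_apply]

end colMap

namespace FreeRes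

variable {A : Type u} [Ring A] {M : Type v} [AddCommGroup M] [Module A M]

lemma X_mul_X (R : FreeRes A M) (i : ℕ) : R.X (i + 1) * R.X i = 0 := by
  classical
  ext l j
  have h := (R.exact i).apply_apply_eq_zero (Pi.single l 1)
  have h2 := congrFun h j
  simp only [Matrix.vecMulLinear_apply, Matrix.single_one_vecMul] at h2
  exact h2

lemma exists_matrix_range {n : ℕ} [IsNoetherianRing A] (K : Submodule A (Fin n → A)) :
    ∃ (m : ℕ) (X : Matrix (Fin m) (Fin n) A), LinearMap.range X.vecMulLinear = K := by
  obtain ⟨m, f, hf⟩ := Module.Finite.exists_fin' A K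
  classical
  refine ⟨m, LinearMap.toMatrixRight' (K.subtype ∘ₗ f), ?_⟩
  have h : (LinearMap.toMatrixRight' (K.subtype ∘ₗ f)).vecMulLinear = K.subtype ∘ₗ f :=
    LinearMap.toMatrixRight'.symm_apply_apply _
  rw [h, LinearMap.range_comp, LinearMap.range_eq_top.2 hf, Submodule.map_top,
    Submodule.range_subtype]

/-- The successive syzygies used to build a free resolution. -/
noncomputable def syzygyState [IsNoetherianRing A] {n₀ : ℕ} (K : Submodule A (Fin n₀ → A)) :
    ℕ → Σ n : ℕ, Submodule A (Fin n → A)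
  | 0 => ⟨n₀, K⟩
  | i + 1 => ⟨(exists_matrix_range (syzygyState K i).2).choose,
      LinearMap.ker (exists_matrix_range (syzygyState K i).2).choose_spec.choose.vecMulLinear⟩

theorem exists_of_finite [IsNoetherianRing A] [Module.Finite A M] : Nonempty (FreeRes A M) := by
  obtain ⟨n₀, f, hf⟩ := Module.Finite.exists_fin' A M
  let st := syzygyState (LinearMap.ker f)
  exact ⟨{
    n := fun i => (st i).1
    X := fun i => (exists_matrix_range (st i).2).choose_spec.choose
    ε := f
    surj := hf
    exact₀ := LinearMap.exact_iff.2 (exists_matrix_range (st 0).2).choose_spec.choose_spec.symm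
    exact := fun i =>
      LinearMap.exact_iff.2 (exists_matrix_range (st (i + 1)).2).choose_spec.choose_spec.symm }⟩

lemma exact_map {B : Type*} [Ring B] (φ : A ≃+* B) {m n : ℕ} (X : Matrix (Fin m) (Fin n) A)
    {P Q : Type*} [Zero P] [Zero Q] {g : (Fin n → A) → P} {g' : (Fin n → B) → Q}
    (h : Function.Exact X.vecMulLinear g) (hg : ∀ x, g x = 0 ↔ g' (φ ∘ x) = 0) :
    Function.Exact (X.map φ).vecMulLinear g' := by
  intro y
  obtain ⟨x, rfl⟩ : ∃ x, y = φ ∘ x := ⟨φ.symm ∘ y, by ext; simp⟩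
  rw [← hg, h x]
  constructor
  · rintro ⟨z, rfl⟩
    exact ⟨φ ∘ z, funext fun i => ((φ : A →+* B).map_vecMul X z i).symm⟩
  · rintro ⟨z, hz⟩
    refine ⟨φ.symm ∘ z, funext fun i => φ.injective ?_⟩
    have h1 := (φ : A →+* B).map_vecMul X (φ.symm ∘ z) i
    have h2 : (⇑(φ : A →+* B) ∘ ⇑φ.symm ∘ z) = z := by ext; simp
    rw [h2] at h1
    exact h1.trans (congrFun hz i)

/-- Transport of a free resolution along an isomorphism of rings and modules. -/
def transport {B : Type*} [Ring B] {N : Type*} [AddCommGroup N] [Module B N]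
    (R : FreeRes A M) (φ : A ≃+* B) (e : M ≃+ N) (he : ∀ a m, e (a • m) = φ a • e m) :
    FreeRes B N where
  n := R.n
  X i := (R.X i).map φ
  ε :=
    { toFun x := e (R.ε (φ.symm ∘ x))
      map_add' x y := by
        rw [← map_add, ← map_add]; congr 2; ext; simp
      map_smul' b x := by
        obtain ⟨a, rfl⟩ := φ.surjective b
        rw [RingHom.id_apply, ← he, ← map_smul]; congr 2; ext; simp }
  surj y := by
    obtain ⟨x, hx⟩ := R.surj (e.symm y)
    refine ⟨φ ∘ x, ?_⟩
    have : φ.symm ∘ φ ∘ x = x := by ext; simp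
    simp [this, hx]
  exact₀ := exact_map φ _ R.exact₀ fun x => by
    have : φ.symm ∘ φ ∘ x = x := by ext; simp
    simp [this]
  exact i := exact_map φ _ (R.exact i) fun x => by
    have h : Matrix.vecMul (φ ∘ x) ((R.X i).map φ) = φ ∘ Matrix.vecMul x (R.X i) :=
      funext fun j => ((φ : A →+* B).map_vecMul (R.X i) x j).symm
    rw [Matrix.vecMulLinear_apply, Matrix.vecMulLinear_apply, h]
    constructor
    · intro h; rw [h]; ext; simp
    · intro h; ext j; exact φ.injective (by simpa using congrFun h j)

/-- The shifted resolution of the first syzygy. -/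
def shift (R : FreeRes A M) : FreeRes A (LinearMap.ker R.ε) where
  n i := R.n (i + 1)
  X i := R.X (i + 1)
  ε := (R.X 0).vecMulLinear.codRestrict _ fun x => R.exact₀.apply_apply_eq_zero x
  surj y := by
    obtain ⟨x, hx⟩ := (R.exact₀ y.1).1 y.2
    exact ⟨x, Subtype.ext hx⟩
  exact₀ x := by
    rw [← R.exact 0 x, ← Subtype.coe_inj]
    rfl
  exact i := R.exact (i + 1)

/-- The differential of the dual complex, a map of right modules. -/
def δ (R : FreeRes A M) (i : ℕ) : (Fin (R.n i) → A) →ₗ[Aᵐᵒᵖ] (Fin (R.n (i + 1)) → A) :=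
  colMap (Module.toModuleEnd Aᵐᵒᵖ A) (R.X i)

lemma δ_apply (R : FreeRes A M) (i : ℕ) (c : Fin (R.n i) → A) (l) :
    R.δ i c l = ∑ j, R.X i l j * c j := by
  simp [δ, colMap_apply]

lemma δ_δ (R : FreeRes A M) (i : ℕ) (c : Fin (R.n i) → A) : R.δ (i + 1) (R.δ i c) = 0 := by
  rw [δ, δ, colMap_colMap, X_mul_X, colMap_zero]

/-- The boundaries of the dual complex. -/
def bdry (R : FreeRes A M) : ∀ i, Submodule Aᵐᵒᵖ (Fin (R.n i) → A)
  | 0 => ⊥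
  | i + 1 => LinearMap.range (R.δ i)

lemma bdry_le (R : FreeRes A M) (i : ℕ) : R.bdry i ≤ LinearMap.ker (R.δ i) := by
  cases i with
  | zero => exact bot_le
  | succ i => rintro _ ⟨c, rfl⟩; exact R.δ_δ i c

/-- The boundaries, inside the cocycles. -/
abbrev bdryZ (R : FreeRes A M) (i : ℕ) : Submodule Aᵐᵒᵖ (LinearMap.ker (R.δ i)) :=
  (R.bdry i).comap (LinearMap.ker (R.δ i)).subtype

/-- The cohomology of the dual complex, a right module. -/
abbrev coh (R : FreeRes A M) (i : ℕ) := LinearMap.ker (R.δ i) ⧸ R.bdryZ i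

end FreeRes

/-! ### Computing `Ext` by a free resolution -/

/-- The regular module in a larger universe. -/
abbrev regularModuleCat (A : Type u) [Ring A] : ModuleCat.{max w u} A :=
  ModuleCat.of A (ULift.{max w u} A)

/-- The group `Ext^i (Q, A)` for an object `Q` of the category of modules. -/
abbrev SelfExt {A : Type u} [Ring A] (Q : ModuleCat.{max w u} A) (i : ℕ) :
    Type (max (u + 1) (w + 1)) :=
  Abelian.Ext Q (regularModuleCat.{w} A) i

/-- Right multiplication as an endomorphism of the regular module. -/
abbrev rmulHom (A : Type u) [Ring A] (a : A) :
    regularModuleCat.{w} A ⟶ regularModuleCat.{w} A :=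
  ModuleCat.ofHom (rmulLinear A a)

/-- The `A`-linear functional `x ↦ ∑ x_j z_j`. -/
def dotRight {A : Type*} [Ring A] {n : ℕ} (z : Fin n → A) : (Fin n → A) →ₗ[A] A where
  toFun x := x ⬝ᵥ z
  map_add' x y := add_dotProduct x y z
  map_smul' a x := smul_dotProduct a x z

lemma exists_eq_dotRight {A : Type*} [Ring A] {n : ℕ} (g : (Fin n → A) →ₗ[A] A) :
    ∃ z, g = dotRight z := by
  classical
  refine ⟨fun j => g (Pi.single j 1), ?_⟩
  refine (Pi.basisFun A (Fin n)).ext fun j => ?_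
  simp [dotRight]

namespace FreeRes

variable {A : Type u} [Ring A] {M : Type v} [AddCommGroup M] [Module A M]

lemma dotRight_vecMul (R : FreeRes A M) (i : ℕ) (z : Fin (R.n i) → A) (x) :
    dotRight z ((R.X i).vecMulLinear x) = dotRight (R.δ i z) x := by
  have h : R.δ i z = (R.X i).mulVec z := by
    ext l; rw [δ_apply]; rfl
  rw [h]
  exact (Matrix.dotProduct_mulVec x (R.X i) z).symm

lemma dotRight_injective {n : ℕ} {z z' : Fin n → A} (h : ∀ x, dotRight z x = dotRight z' x) :
    z = z' := by
  classical
  ext j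
  simpa [dotRight] using h (Pi.single j 1)

/-- Transport of a resolution along a linear equivalence. -/
def ofEquiv {N : Type*} [AddCommGroup N] [Module A N] (R : FreeRes A M) (e : M ≃ₗ[A] N) :
    FreeRes A N where
  n := R.n
  X := R.X
  ε := e.toLinearMap ∘ₗ R.ε
  surj := e.surjective.comp R.surj
  exact₀ x := by simpa using R.exact₀ x
  exact := R.exact

/-- A cocycle of degree zero descends to a functional on `M`. -/
lemma exists_descent (R : FreeRes A M) (z : Fin (R.n 0) → A) (hz : R.δ 0 z = 0) :
    ∃ g : M →ₗ[A] A, ∀ x, g (R.ε x) = dotRight z x := by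
  have hle : LinearMap.ker R.ε ≤ LinearMap.ker (dotRight z) := by
    intro x hx
    obtain ⟨y, rfl⟩ := (R.exact₀ x).1 hx
    rw [LinearMap.mem_ker, dotRight_vecMul, hz]
    simp [dotRight]
  refine ⟨(LinearMap.ker R.ε).liftQ _ hle ∘ₗ
    (R.ε.quotKerEquivOfSurjective R.surj).symm.toLinearMap, fun x => ?_⟩
  have : (R.ε.quotKerEquivOfSurjective R.surj).symm (R.ε x) = Submodule.Quotient.mk x := by
    rw [LinearEquiv.symm_apply_eq]; rfl
  simp [this]

section Bridge

variable {Q : ModuleCat.{max w u} A} (R : FreeRes A Q)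

/-- The first step of a resolution, in the universe of `Q`. -/
def liftε : ULift.{max w u} (Fin (R.n 0) → A) →ₗ[A] Q :=
  R.ε ∘ₗ ULift.moduleEquiv.toLinearMap

lemma liftε_surjective : Function.Surjective R.liftε := fun y => by
  obtain ⟨x, hx⟩ := R.surj y
  exact ⟨⟨x⟩, hx⟩

/-- The resolution of the first syzygy in the universe of `Q`. -/
def liftShift : FreeRes A (LinearMap.ker R.liftε) :=
  R.shift.ofEquiv
    { toFun x := ⟨⟨x.1⟩, x.2⟩
      invFun x := ⟨x.1.down, x.2⟩
      map_add' _ _ := rfl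
      map_smul' _ _ := rfl }

instance projective_liftε : Projective R.liftε.shortComplexKer.X₂ := by
  have : Module.Projective A (ULift.{max w u} (Fin (R.n 0) → A)) :=
    Module.Projective.of_equiv ULift.moduleEquiv.symm
  exact (IsProjective.iff_projective (R := A) (ULift.{max w u} (Fin (R.n 0) → A))).1 this

/-- The property of a map from cocycles to `Ext` of identifying cohomology with `Ext`. -/
structure Computes (i : ℕ)
    (Ψ : LinearMap.ker (R.δ i) →+ SelfExt.{w} Q i) : Prop where
  surj : Function.Surjective Ψ
  eq_zero : ∀ z, Ψ z = 0 ↔ z.1 ∈ R.bdry i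
  smul : ∀ (a : Aᵐᵒᵖ) z,
    Ψ (a • z) = (Ψ z).comp (Abelian.Ext.mk₀ (rmulHom.{w} A a.unop)) (add_zero i)

lemma exists_computes_zero : ∃ Ψ, R.Computes 0 Ψ ∧
    ∀ z, ∃ f : Q ⟶ regularModuleCat.{w} A, Ψ z = Abelian.Ext.mk₀ f ∧
      ∀ x, (f (R.ε x)).down = dotRight z.1 x := by
  choose g hg using fun z : LinearMap.ker (R.δ 0) => R.exists_descent z.1 z.2
  have hadd : ∀ z z', g (z + z') = g z + g z' := fun z z' => by
    ext y
    obtain ⟨x, rfl⟩ := R.surj y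
    simp [hg, dotRight]
  let T : LinearMap.ker (R.δ 0) →+ (Q ⟶ regularModuleCat.{w} A) := AddMonoidHom.mk'
    (fun z => ModuleCat.ofHom (ULift.moduleEquiv.symm.toLinearMap ∘ₗ g z)) fun z z' => by
      rw [hadd]; rfl
  have hT : ∀ z x, (T z (R.ε x)).down = dotRight z.1 x := hg
  refine ⟨(Abelian.Ext.addEquiv₀ (X := Q)).symm.toAddMonoidHom.comp T,
    ⟨?_, ?_, ?_⟩, fun z => ⟨T z, rfl, hT z⟩⟩
  · refine (Abelian.Ext.addEquiv₀ (X := Q)).symm.surjective.comp fun f => ?_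
    obtain ⟨z, hz⟩ := exists_eq_dotRight (ULift.moduleEquiv.toLinearMap ∘ₗ f.hom ∘ₗ R.ε)
    have hzx : ∀ x, (f (R.ε x)).down = dotRight z x := fun x => LinearMap.congr_fun hz x
    have h0 : R.δ 0 z = 0 := dotRight_injective fun x => by
      rw [← dotRight_vecMul, ← hzx, R.exact₀.apply_apply_eq_zero]
      simp [dotRight]
    refine ⟨⟨z, h0⟩, ?_⟩
    ext y
    obtain ⟨x, rfl⟩ := R.surj y
    exact (hT _ x).trans (hzx x).symm
  · intro z
    change Abelian.Ext.addEquiv₀.symm (T z) = 0 ↔ _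
    rw [EmbeddingLike.map_eq_zero_iff]
    change _ ↔ z.1 = 0
    constructor
    · intro h
      refine dotRight_injective fun x => ?_
      rw [← hT, h]
      simp [dotRight]
    · intro h
      ext y
      obtain ⟨x, rfl⟩ := R.surj y
      refine (hT _ x).trans ?_
      rw [h]
      simp [dotRight]
  · intro a z
    change Abelian.Ext.mk₀ (T (a • z)) =
      (Abelian.Ext.mk₀ (T z)).comp (Abelian.Ext.mk₀ (rmulHom.{w} A a.unop)) (add_zero 0)
    rw [Abelian.Ext.mk₀_comp_mk₀]
    congr 1
    ext y
    obtain ⟨x, rfl⟩ := R.surj y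
    refine (hT _ x).trans ?_
    change _ = (T z (R.ε x)).down * a.unop
    rw [hT]
    simp [dotRight, dotProduct, Finset.sum_mul, mul_assoc]

/-- The connecting homomorphism of the first syzygy sequence. -/
noncomputable def connecting (i : ℕ) :
    SelfExt.{w} (ModuleCat.of A (LinearMap.ker R.liftε)) i →+ SelfExt.{w} Q (i + 1) :=
  (LinearMap.shortExact_shortComplexKer R.liftε_surjective).extClass.precomp
    (regularModuleCat.{w} A) (add_comm 1 i)

lemma connecting_surjective (i : ℕ) : Function.Surjective (R.connecting i) := fun x =>
  Abelian.Ext.contravariant_sequence_exact₃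
    (LinearMap.shortExact_shortComplexKer R.liftε_surjective) _ x
    (Abelian.Ext.eq_zero_of_projective _) (add_comm 1 i)

lemma connecting_smul (i : ℕ) (a : A)
    (x : SelfExt.{w} (ModuleCat.of A (LinearMap.ker R.liftε)) i) :
    R.connecting i (x.comp (Abelian.Ext.mk₀ (rmulHom.{w} A a)) (add_zero i)) =
      (R.connecting i x).comp (Abelian.Ext.mk₀ (rmulHom.{w} A a)) (add_zero (i + 1)) :=
  (Abelian.Ext.comp_assoc_of_third_deg_zero _ x _ (add_comm 1 i)).symm

lemma Computes.succ {i : ℕ} {K : ModuleCat.{max w u} A} {R' : FreeRes A K}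
    {Ψ : LinearMap.ker (R'.δ i) →+ SelfExt.{w} K i} (h : R'.Computes i Ψ)
    (e : LinearMap.ker (R.δ (i + 1)) ≃ₗ[Aᵐᵒᵖ] LinearMap.ker (R'.δ i))
    (c : SelfExt.{w} K i →+ SelfExt.{w} Q (i + 1)) (hc : Function.Surjective c)
    (hsmul : ∀ (a : A) x, c (x.comp (Abelian.Ext.mk₀ (rmulHom.{w} A a)) (add_zero i)) =
      (c x).comp (Abelian.Ext.mk₀ (rmulHom.{w} A a)) (add_zero (i + 1)))
    (hker : ∀ z, c (Ψ (e z)) = 0 ↔ z.1 ∈ R.bdry (i + 1)) :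
    R.Computes (i + 1) (c.comp (Ψ.comp e.toLinearMap.toAddMonoidHom)) where
  surj := hc.comp (h.surj.comp e.surjective)
  eq_zero := hker
  smul a z := by
    change c (Ψ (e (a • z))) = (c (Ψ (e z))).comp _ _
    rw [map_smul, h.smul, hsmul]

/-- Cocycles of degree `i + 1` are cocycles of degree `i` for the shifted resolution. -/
def kerShift (i : ℕ) : LinearMap.ker (R.δ (i + 1)) ≃ₗ[Aᵐᵒᵖ] LinearMap.ker (R.liftShift.δ i) :=
  LinearEquiv.refl _ _

lemma kerShift_mem (i : ℕ) (z) :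
    (R.kerShift (i + 1) z).1 ∈ R.liftShift.bdry (i + 1) ↔ z.1 ∈ R.bdry (i + 2) := Iff.rfl

lemma connecting_injective (i : ℕ) : Function.Injective (R.connecting (i + 1)) := by
  rw [injective_iff_map_eq_zero]
  intro x hx
  obtain ⟨y, rfl⟩ := Abelian.Ext.contravariant_sequence_exact₁
    (LinearMap.shortExact_shortComplexKer R.liftε_surjective) _ x (add_comm 1 (i + 1)) hx
  rw [Abelian.Ext.eq_zero_of_projective y, Abelian.Ext.comp_zero]

lemma connecting_zero_eq_zero_iff (z : LinearMap.ker (R.δ 1))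
    (f : ModuleCat.of A (LinearMap.ker R.liftε) ⟶ regularModuleCat.{w} A)
    (hf : ∀ x, (f (R.liftShift.ε x)).down = dotRight z.1 x) :
    R.connecting 0 (Abelian.Ext.mk₀ f) = 0 ↔ z.1 ∈ R.bdry 1 := by
  constructor
  · intro h
    obtain ⟨y, hy⟩ := Abelian.Ext.contravariant_sequence_exact₁
      (LinearMap.shortExact_shortComplexKer R.liftε_surjective) _ (Abelian.Ext.mk₀ f)
      (add_comm 1 0) h
    obtain ⟨g, rfl⟩ := (Abelian.Ext.mk₀_bijective _ _).2 y
    rw [Abelian.Ext.mk₀_comp_mk₀] at hy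
    have hy := (Abelian.Ext.mk₀_bijective _ _).1 hy
    obtain ⟨c, hc⟩ := exists_eq_dotRight
      (ULift.moduleEquiv.toLinearMap ∘ₗ g.hom ∘ₗ ULift.moduleEquiv.symm.toLinearMap)
    have hcx : ∀ x, (g.hom (ULift.up x)).down = dotRight c x := fun x => LinearMap.congr_fun hc x
    refine ⟨c, dotRight_injective fun x => ?_⟩
    rw [← dotRight_vecMul, ← hcx]
    exact (congrArg (fun t => (t.hom (R.liftShift.ε x)).down) hy).trans (hf x)
  · rintro ⟨c, hc⟩
    have hfg : f = R.liftε.shortComplexKer.f ≫ ModuleCat.ofHom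
        (ULift.moduleEquiv.symm.toLinearMap ∘ₗ dotRight c ∘ₗ ULift.moduleEquiv.toLinearMap) := by
      ext y
      obtain ⟨x, rfl⟩ := R.liftShift.surj y
      exact (hf x).trans ((congrArg (fun t => dotRight t x) hc.symm).trans
        (R.dotRight_vecMul 0 c x).symm)
    rw [hfg, ← Abelian.Ext.mk₀_comp_mk₀]
    exact (LinearMap.shortExact_shortComplexKer R.liftε_surjective).extClass_comp_assoc _
      (h := add_comm 1 0)

end Bridge

theorem exists_computes (i : ℕ) : ∀ {Q : ModuleCat.{max w u} A} (R : FreeRes A Q),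
    ∃ Ψ, R.Computes i Ψ := by
  induction i with
  | zero => exact fun R => ⟨_, R.exists_computes_zero.choose_spec.1⟩
  | succ i ih =>
    intro Q R
    cases i with
    | zero =>
      obtain ⟨Ψ, hΨ, hf⟩ :=
        exists_computes_zero (Q := ModuleCat.of A (LinearMap.ker R.liftε)) R.liftShift
      refine ⟨_, hΨ.succ R (R.kerShift 0) (R.connecting 0) (R.connecting_surjective 0)
        (R.connecting_smul 0) fun z => ?_⟩
      obtain ⟨f, h1, h2⟩ := hf (R.kerShift 0 z)
      rw [h1]
      exact R.connecting_zero_eq_zero_iff z f h2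
    | succ i =>
      obtain ⟨Ψ, hΨ⟩ := ih (Q := ModuleCat.of A (LinearMap.ker R.liftε)) R.liftShift
      refine ⟨_, hΨ.succ R (R.kerShift (i + 1)) (R.connecting (i + 1))
        (R.connecting_surjective (i + 1)) (R.connecting_smul (i + 1)) fun z => ?_⟩
      rw [map_eq_zero_iff _ (R.connecting_injective i), hΨ.eq_zero]
      exact R.kerShift_mem i z

/-- `Ext^i (M, A)` is the cohomology of the dual of a free resolution, as a right module. -/
theorem nonempty_coh_equiv_extGroup (R : FreeRes A M) (i : ℕ) :
    Nonempty (R.coh i ≃ₗ[Aᵐᵒᵖ] ExtGroup A M A i) := by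
  obtain ⟨Ψ, hΨ⟩ := exists_computes.{v} i (Q := ModuleCat.of A (ULift.{u} M))
    (R.ofEquiv ULift.moduleEquiv.symm)
  let Ψ' : LinearMap.ker (R.δ i) →ₗ[Aᵐᵒᵖ] ExtGroup A M A i :=
    { Ψ with map_smul' := hΨ.smul }
  have hker : LinearMap.ker Ψ' = R.bdryZ i := by
    ext z
    exact hΨ.eq_zero z
  exact ⟨(Submodule.quotEquivOfEq _ _ hker.symm).trans
    (Ψ'.quotKerEquivOfSurjective hΨ.surj)⟩

end FreeRes

/-! ### Grade via free resolutions -/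

namespace FreeRes

variable {A : Type u} [Ring A] {M : Type v} [AddCommGroup M] [Module A M]

/-- Exactness of the dual complex in degree `i`. -/
def ExactAt (R : FreeRes A M) (i : ℕ) : Prop := ∀ z, R.δ i z = 0 → z ∈ R.bdry i

lemma exactAt_iff_subsingleton (R : FreeRes A M) (i : ℕ) :
    R.ExactAt i ↔ Subsingleton (ExtGroup A M A i) := by
  obtain ⟨e⟩ := R.nonempty_coh_equiv_extGroup i
  rw [← e.toEquiv.subsingleton_congr]
  rw [Submodule.Quotient.subsingleton_iff, Submodule.eq_top_iff']
  exact ⟨fun h z => h z.1 z.2, fun h z hz => h ⟨z, hz⟩⟩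

lemma coe_le_moduleGrade_iff (i : ℕ) :
    (i : ℕ∞) ≤ moduleGrade A M ↔ ∀ j < i, Subsingleton (ExtGroup A M A j) := by
  rw [moduleGrade, le_sInf_iff]
  constructor
  · intro h j hj
    by_contra hn
    rw [not_subsingleton_iff_nontrivial] at hn
    exact absurd (h j ⟨j, rfl, hn⟩) (by simpa using hj)
  · rintro h _ ⟨j, rfl, hn⟩
    by_contra hlt
    have := h j (by simpa using hlt)
    exact not_subsingleton _ this

lemma transport_δ {B : Type*} [Ring B] {N : Type*} [AddCommGroup N] [Module B N]
    (R : FreeRes A M) (φ : A ≃+* B) (e : M ≃+ N) (he : ∀ a m, e (a • m) = φ a • e m) (i : ℕ)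
    (c : Fin (R.n i) → A) : (R.transport φ e he).δ i (φ ∘ c) = φ ∘ R.δ i c := by
  ext l
  refine ((R.transport φ e he).δ_apply i (φ ∘ c) l).trans ?_
  refine Eq.trans ?_ (congrArg φ (R.δ_apply i c l)).symm
  rw [map_sum]
  exact Finset.sum_congr rfl fun j _ => (map_mul φ _ _).symm

lemma transport_exactAt {B : Type*} [Ring B] {N : Type*} [AddCommGroup N] [Module B N]
    (R : FreeRes A M) (φ : A ≃+* B) (e : M ≃+ N) (he : ∀ a m, e (a • m) = φ a • e m) (i : ℕ) :
    (R.transport φ e he).ExactAt i ↔ R.ExactAt i := by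
  have hsurj : ∀ {m : ℕ} (z : Fin m → B), ∃ c : Fin m → A, z = φ ∘ c :=
    fun z => ⟨φ.symm ∘ z, by ext; simp⟩
  have hinj : ∀ {m : ℕ} (c c' : Fin m → A), φ ∘ c = φ ∘ c' → c = c' :=
    fun c c' h => funext fun i => φ.injective (congrFun h i)
  have hzero : ∀ {m : ℕ}, (0 : Fin m → B) = φ ∘ (0 : Fin m → A) := by
    intro m; ext; simp
  have hb : ∀ z, φ ∘ z ∈ (R.transport φ e he).bdry i ↔ z ∈ R.bdry i := by
    intro z
    cases i with
    | zero =>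
      change φ ∘ z = 0 ↔ z = 0
      exact ⟨fun h => hinj _ _ (h.trans hzero), fun h => by rw [h, ← hzero]⟩
    | succ i =>
      constructor
      · rintro ⟨c, hc⟩
        obtain ⟨c, rfl⟩ := hsurj c
        exact ⟨c, hinj _ _ ((R.transport_δ φ e he i c).symm.trans hc)⟩
      · rintro ⟨c, rfl⟩
        exact ⟨φ ∘ c, R.transport_δ φ e he i c⟩
  constructor
  · intro h z hz
    exact (hb z).1 (h _ ((R.transport_δ φ e he i z).trans (by rw [hz, ← hzero]; rfl)))
  · intro h z hz
    obtain ⟨c, rfl⟩ := hsurj z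
    exact (hb c).2 (h c (hinj _ _ ((R.transport_δ φ e he i c).symm.trans (hz.trans hzero))))

lemma subsingleton_ext_congr {B : Type*} [Ring B] {N : Type*} [AddCommGroup N] [Module B N]
    (R : FreeRes A M) (φ : A ≃+* B) (e : M ≃+ N) (he : ∀ a m, e (a • m) = φ a • e m) (i : ℕ) :
    Subsingleton (ExtGroup B N B i) ↔ Subsingleton (ExtGroup A M A i) := by
  rw [← exactAt_iff_subsingleton (R.transport φ e he), ← exactAt_iff_subsingleton R,
    transport_exactAt]

lemma moduleGrade_congr {B : Type*} [Ring B] {N : Type*} [AddCommGroup N] [Module B N]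
    (R : FreeRes A M) (φ : A ≃+* B) (e : M ≃+ N) (he : ∀ a m, e (a • m) = φ a • e m) :
    moduleGrade B N = moduleGrade A M := by
  refine ENat.eq_of_forall_natCast_le_iff fun i => ?_
  simp only [coe_le_moduleGrade_iff, R.subsingleton_ext_congr φ e he]

end FreeRes

lemma nontrivial_of_moduleGrade_eq {A : Type u} [Ring A] {M : Type v} [AddCommGroup M]
    [Module A M] {i : ℕ} (h : moduleGrade A M = i) : Nontrivial (ExtGroup A M A i) := by
  by_contra hn
  rw [not_nontrivial_iff_subsingleton] at hn
  have : ((i + 1 : ℕ) : ℕ∞) ≤ moduleGrade A M := by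
    rw [FreeRes.coe_le_moduleGrade_iff]
    intro j hj
    rcases Nat.lt_succ_iff_lt_or_eq.1 hj with hj | rfl
    · exact (FreeRes.coe_le_moduleGrade_iff i).1 h.ge j hj
    · exact hn
  rw [h] at this
  norm_cast at this
  omega

/-! ### Modules of Gelfand–Kirillov dimension zero -/

section GK

variable (k : Type u') (A : Type u) (M : Type v) [Field k] [Ring A] [Algebra k A]
  [AddCommGroup M] [Module k M] [Module A M] [IsScalarTower k A M]

/-- Every element lies in a finite-dimensional subspace stable under a given finite-dimensional
space of operators. -/
def IsLocallyFinite : Prop :=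
  ∀ (V : Submodule k A), FiniteDimensional k V → ∀ x : M, ∃ G : Submodule k M,
    FiniteDimensional k G ∧ x ∈ G ∧ ∀ a ∈ V, ∀ g ∈ G, a • g ∈ G

variable {k A M}

lemma smul_mem_subspaceSMul {W : Submodule k A} {F : Submodule k M} {a : A} {m : M}
    (ha : a ∈ W) (hm : m ∈ F) : a • m ∈ subspaceSMul k W F :=
  Submodule.subset_span ⟨a, ha, m, hm, rfl⟩

lemma subspaceSMul_le {W : Submodule k A} {F G : Submodule k M}
    (h : ∀ a ∈ W, ∀ m ∈ F, a • m ∈ G) : subspaceSMul k W F ≤ G :=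
  Submodule.span_le.2 (by rintro _ ⟨a, ha, m, hm, rfl⟩; exact h a ha m hm)

lemma subspaceSMul_finite (W : Submodule k A) (F : Submodule k M) [FiniteDimensional k W]
    [FiniteDimensional k F] : FiniteDimensional k (subspaceSMul k W F) := by
  have h : subspaceSMul k W F = Submodule.map₂ (Algebra.lsmul k k M).toLinearMap W F := by
    rw [Submodule.map₂_eq_span_image2]
    refine congrArg (Submodule.span k) (Set.ext fun z => ?_)
    exact ⟨fun ⟨a, ha, m, hm, e⟩ => ⟨a, ha, m, hm, e.symm⟩,
      fun ⟨a, ha, m, hm, e⟩ => ⟨a, ha, m, hm, e.symm⟩⟩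
  rw [h]
  exact Module.Finite.iff_fg.2 (Submodule.FG.map₂ _ (Module.Finite.iff_fg.1 inferInstance)
    (Module.Finite.iff_fg.1 inferInstance))

lemma subspaceSMul_pow_le {V : Submodule k A} {F G : Submodule k M} (hF : F ≤ G)
    (hV : ∀ a ∈ V, ∀ g ∈ G, a • g ∈ G) (n : ℕ) : subspaceSMul k ((1 ⊔ V) ^ n) F ≤ G := by
  have h1 : ∀ a ∈ 1 ⊔ V, ∀ g ∈ G, a • g ∈ G := by
    intro a ha g hg
    obtain ⟨b, hb, c, hc, rfl⟩ := Submodule.mem_sup.1 ha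
    obtain ⟨r, rfl⟩ := Submodule.mem_one.1 hb
    rw [add_smul, algebraMap_smul]
    exact G.add_mem (G.smul_mem r hg) (hV c hc g hg)
  refine subspaceSMul_le fun a ha m hm => ?_
  have : ∀ n, ∀ a ∈ (1 ⊔ V) ^ n, ∀ g ∈ G, a • g ∈ G := by
    intro n
    induction n with
    | zero =>
      intro a ha g hg
      rw [pow_zero] at ha
      obtain ⟨r, rfl⟩ := Submodule.mem_one.1 ha
      rw [algebraMap_smul]
      exact G.smul_mem r hg
    | succ n ih =>
      intro a ha g hg
      rw [pow_succ] at ha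
      induction ha using Submodule.mul_induction_on' with
      | mem_mul_mem b hb c hc => rw [mul_smul]; exact ih b hb _ (h1 c hc g hg)
      | add x _ y _ hx hy => rw [add_smul]; exact G.add_mem hx hy
  exact this n a ha m (hF hm)

omit [IsScalarTower k A M] in
lemma IsLocallyFinite.exists_stable (h : IsLocallyFinite k A M) (V : Submodule k A)
    [FiniteDimensional k V] (F : Submodule k M) [FiniteDimensional k F] :
    ∃ G : Submodule k M, FiniteDimensional k G ∧ F ≤ G ∧ ∀ a ∈ V, ∀ g ∈ G, a • g ∈ G := by
  have hF : F.FG := Module.Finite.iff_fg.1 inferInstance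
  induction F, hF using Submodule.fg_induction with
  | singleton x =>
    obtain ⟨G, h1, h2, h3⟩ := h V inferInstance x
    exact ⟨G, h1, by simpa using h2, h3⟩
  | sup F₁ F₂ hF₁ hF₂ ih₁ ih₂ =>
    have := Module.Finite.iff_fg.2 hF₁
    have := Module.Finite.iff_fg.2 hF₂
    obtain ⟨G₁, h1, h2, h3⟩ := ih₁
    obtain ⟨G₂, h1', h2', h3'⟩ := ih₂
    refine ⟨G₁ ⊔ G₂, inferInstance, sup_le_sup h2 h2', fun a ha g hg => ?_⟩
    obtain ⟨x, hx, y, hy, rfl⟩ := Submodule.mem_sup.1 hg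
    rw [smul_add]
    exact Submodule.add_mem_sup (h3 a ha x hx) (h3' a ha y hy)

lemma IsLocallyFinite.gkDimModule_eq_zero (h : IsLocallyFinite k A M) :
    gkDimModule k A M = 0 := by
  simp only [gkDimModule, ← bot_eq_zero, iSup_eq_bot]
  intro V hV F hF
  obtain ⟨G, hG, hFG, hst⟩ := h.exists_stable V F
  set c := Module.finrank k G
  have ht : Filter.Tendsto (fun n : ℕ => ENNReal.ofReal (Real.logb n (c + 1 : ℕ)))
      Filter.atTop (nhds 0) := by
    rw [← ENNReal.ofReal_zero]
    refine ENNReal.tendsto_ofReal ?_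
    exact Filter.Tendsto.div_atTop tendsto_const_nhds
      (Real.tendsto_log_atTop.comp tendsto_natCast_atTop_atTop)
  rw [bot_eq_zero, ← le_zero_iff, ← ht.limsup_eq]
  refine Filter.limsup_le_limsup ?_
  filter_upwards [Filter.eventually_ge_atTop 2] with n hn
  refine ENNReal.ofReal_le_ofReal ?_
  have hle : Module.finrank k (subspaceSMul k ((1 ⊔ V) ^ n : Submodule k A) F) ≤ c :=
    Submodule.finrank_mono (subspaceSMul_pow_le hFG hst n)
  rcases Nat.eq_zero_or_pos (Module.finrank k (subspaceSMul k ((1 ⊔ V) ^ n : Submodule k A) F))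
    with h0 | h0
  · rw [h0]
    simp only [Nat.cast_zero, Real.logb_zero]
    exact Real.logb_nonneg (by exact_mod_cast hn) (by push_cast; linarith [c.cast_nonneg (α := ℝ)])
  · exact Real.logb_le_logb_of_le (by exact_mod_cast hn) (by exact_mod_cast h0)
      (by exact_mod_cast hle.trans (Nat.le_succ c))

lemma isLocallyFinite_of_gkDimModule_eq_zero (h : gkDimModule k A M = 0) :
    IsLocallyFinite k A M := by
  intro V hV x
  set W : Submodule k A := 1 ⊔ V
  have hW : FiniteDimensional k W := by
    have : FiniteDimensional k (1 : Submodule k A) := by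
      rw [Submodule.one_eq_span]; infer_instance
    infer_instance
  have hWn : ∀ n, FiniteDimensional k (W ^ n : Submodule k A) := fun n =>
    Module.Finite.iff_fg.2 (Submodule.FG.pow (Module.Finite.iff_fg.1 hW) n)
  set F : Submodule k M := Submodule.span k {x}
  let G : ℕ → Submodule k M := fun n => subspaceSMul k (W ^ n) F
  have hG : ∀ n, FiniteDimensional k (G n) := fun n => by
    have := hWn n
    exact subspaceSMul_finite _ _
  have hstep : ∀ n, ∀ a ∈ W, ∀ g ∈ G n, a • g ∈ G (n + 1) := by
    intro n a ha g hg
    induction hg using Submodule.span_induction with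
    | mem y hy =>
      obtain ⟨b, hb, m, hm, rfl⟩ := hy
      rw [← mul_smul]
      refine smul_mem_subspaceSMul ?_ hm
      rw [pow_succ']
      exact Submodule.mul_mem_mul ha hb
    | zero => simp
    | add y z _ _ hy hz => rw [smul_add]; exact add_mem hy hz
    | smul r y _ hy => rw [smul_algebra_smul_comm]; exact Submodule.smul_mem _ _ hy
  have h1W : (1 : A) ∈ W := Submodule.mem_sup_left (Submodule.one_le.1 le_rfl)
  have hmono : ∀ n, G n ≤ G (n + 1) := fun n g hg => by
    simpa using hstep n 1 h1W g hg
  have hx : ∀ n, x ∈ G n := by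
    intro n
    induction n with
    | zero =>
      have h0 : (1 : A) ∈ W ^ 0 := by rw [pow_zero]; exact Submodule.one_le.1 le_rfl
      have := smul_mem_subspaceSMul h0 (Submodule.mem_span_singleton_self (R := k) x)
      rwa [one_smul] at this
    | succ n ih => exact hmono n ih
  by_cases hst : ∃ n, G (n + 1) ≤ G n
  · obtain ⟨n, hn⟩ := hst
    exact ⟨G n, hG n, hx n, fun a ha g hg =>
      hn (hstep n a (Submodule.mem_sup_right ha) g hg)⟩
  · exfalso
    push Not at hst
    have hrank : ∀ n, n ≤ Module.finrank k (G n) := by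
      intro n
      induction n with
      | zero => exact Nat.zero_le _
      | succ n ih =>
        have := hG (n + 1)
        exact lt_of_le_of_lt ih
          (Submodule.finrank_lt_finrank_of_lt (lt_of_le_not_ge (hmono n) (hst n)))
    have h1 : (1 : ENNReal) ≤ gkDimModule k A M := by
      refine le_trans ?_ (le_iSup_of_le V (le_iSup_of_le hV (le_iSup_of_le F
        (le_iSup_of_le inferInstance le_rfl))))
      refine Filter.le_limsup_of_frequently_le' ?_
      refine Filter.Eventually.frequently ?_
      filter_upwards [Filter.eventually_ge_atTop 2] with n hn
      rw [ENNReal.one_le_ofReal]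
      rw [Real.le_logb_iff_rpow_le (by exact_mod_cast hn) (by
        have := hrank n
        have : 0 < Module.finrank k (G n) := by omega
        exact_mod_cast this), Real.rpow_one]
      exact_mod_cast hrank n
    rw [h] at h1
    simp at h1

theorem gkDimModule_eq_zero_iff : gkDimModule k A M = 0 ↔ IsLocallyFinite k A M :=
  ⟨isLocallyFinite_of_gkDimModule_eq_zero, fun h => h.gkDimModule_eq_zero⟩

end GK

/-! ### Injective dimension is detected by cyclic modules -/

section InjectiveDimension

variable {A : Type u} [Ring A]

/-- The cyclic module attached to a left ideal. -/
abbrev cyclicModuleCat (I : Ideal A) : ModuleCat.{u} A := ModuleCat.of A (ULift.{u} (A ⧸ I))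

/-- The projection onto a cyclic module. -/
def cyclicProj (I : Ideal A) : A →ₗ[A] ULift.{u} (A ⧸ I) :=
  ULift.moduleEquiv.symm.toLinearMap ∘ₗ I.mkQ

lemma injective_of_ext_cyclic (Y : ModuleCat.{u} A)
    (h : ∀ I : Ideal A, Subsingleton (Abelian.Ext (cyclicModuleCat I) Y 1)) : Injective Y := by
  suffices hB : Module.Baer A Y from
    haveI := hB.injective
    Module.injective_object_of_injective_module A Y
  intro I g
  have hsurj : Function.Surjective (cyclicProj I) :=
    ULift.moduleEquiv.symm.surjective.comp I.mkQ_surjective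
  have hker : ∀ x, x ∈ LinearMap.ker (cyclicProj I) ↔ x ∈ I := by
    intro x
    simp [cyclicProj]
  have hS := LinearMap.shortExact_shortComplexKer hsurj
  let g' : ModuleCat.of A (LinearMap.ker (cyclicProj I)) ⟶ Y :=
    ModuleCat.ofHom (g ∘ₗ Submodule.inclusion fun x hx => (hker x).1 hx)
  have : Subsingleton (Abelian.Ext (cyclicProj I).shortComplexKer.X₃ Y 1) := h I
  obtain ⟨x₂, hx₂⟩ := Abelian.Ext.contravariant_sequence_exact₁ hS Y (Abelian.Ext.mk₀ g')
    (add_comm 1 0) (Subsingleton.elim _ _)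
  obtain ⟨t, rfl⟩ := Abelian.Ext.homEquiv₀.symm.surjective x₂
  have h2 : (cyclicProj I).shortComplexKer.f ≫ t = g' := by
    apply Abelian.Ext.homEquiv₀.symm.injective
    exact (Abelian.Ext.mk₀_comp_mk₀ _ _).symm.trans hx₂
  exact ⟨t.hom, fun x hx => congrArg (fun f => f.hom ⟨x, (hker x).2 hx⟩) h2⟩

lemma hasInjectiveDimensionLT_of_ext_cyclic (d : ℕ) (Y : ModuleCat.{u} A)
    (h : ∀ I : Ideal A, ∀ i, d < i → Subsingleton (Abelian.Ext (cyclicModuleCat I) Y i)) :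
    HasInjectiveDimensionLT Y (d + 1) := by
  induction d generalizing Y with
  | zero =>
    rw [← injective_iff_hasInjectiveDimensionLT_one]
    exact injective_of_ext_cyclic Y fun I => h I 1 one_pos
  | succ d ih =>
    let S := ShortComplex.mk (Injective.ι Y) (Limits.cokernel.π (Injective.ι Y)) (by simp)
    have hS : S.ShortExact :=
      { exact := ShortComplex.exact_cokernel _
        mono_f := inferInstanceAs (Mono (Injective.ι Y))
        epi_g := inferInstanceAs (Epi (Limits.cokernel.π (Injective.ι Y))) }
    have hJ : Injective S.X₂ := inferInstanceAs (Injective (Injective.under Y))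
    have h3 : HasInjectiveDimensionLT S.X₃ (d + 1) := by
      refine ih _ fun I i hi => ⟨fun a b => ?_⟩
      rw [← sub_eq_zero]
      have : Subsingleton (Abelian.Ext (cyclicModuleCat I) S.X₁ (i + 1)) :=
        h I (i + 1) (by lia)
      obtain ⟨y, hy⟩ := Abelian.Ext.covariant_sequence_exact₃ _ hS (a - b) rfl
        (Subsingleton.elim _ _)
      rw [← hy, Abelian.Ext.eq_zero_of_hasInjectiveDimensionLT y 1 (by lia),
        Abelian.Ext.zero_comp]
    have h2 : HasInjectiveDimensionLT S.X₂ (d + 1 + 1) :=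
      hasInjectiveDimensionLT_of_ge _ 1 _ (by lia)
    exact hS.hasInjectiveDimensionLT_X₁ (d + 1) h3 h2

/-- The injective dimension of a ring is detected by `Ext` groups of finite modules. -/
lemma subsingleton_ext_of_finite (d : ℕ)
    (h : ∀ (M : Type u) [AddCommGroup M] [Module A M], Module.Finite A M →
      ∀ i, d < i → Subsingleton (ExtGroup A M A i))
    (M : Type u) [AddCommGroup M] [Module A M] (i : ℕ) (hi : d < i) :
    Subsingleton (ExtGroup A M A i) := by
  have := hasInjectiveDimensionLT_of_ext_cyclic d (ModuleCat.of A (ULift.{u} A))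
    fun I i hi => h (A ⧸ I) inferInstance i hi
  exact ⟨fun a b => (a.eq_zero_of_hasInjectiveDimensionLT (d + 1) hi).trans
    (b.eq_zero_of_hasInjectiveDimensionLT (d + 1) hi).symm⟩

end InjectiveDimension

/-! ### The dual complex of a resolution -/

section ConnectingMap

variable {C : Type u} [Category.{v} C] [Abelian C] [HasExt.{w} C] {S : ShortComplex C}

lemma CategoryTheory.ShortComplex.ShortExact.exists_extClass_comp (hS : S.ShortExact) [Projective S.X₂] {Y : C}
    {j : ℕ} (y : Abelian.Ext S.X₃ Y (j + 1)) :
    ∃ x : Abelian.Ext S.X₁ Y j, hS.extClass.comp x (add_comm 1 j) = y :=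
  Abelian.Ext.contravariant_sequence_exact₃ hS Y y (Abelian.Ext.eq_zero_of_projective _)
    (add_comm 1 j)

lemma CategoryTheory.ShortComplex.ShortExact.eq_zero_of_extClass_comp (hS : S.ShortExact) [Projective S.X₂]
    {Y : C} {j : ℕ} (x : Abelian.Ext S.X₁ Y (j + 1))
    (hx : hS.extClass.comp x (add_comm 1 (j + 1)) = 0) : x = 0 := by
  obtain ⟨y, rfl⟩ := Abelian.Ext.contravariant_sequence_exact₁ hS Y x (add_comm 1 (j + 1)) hx
  rw [Abelian.Ext.eq_zero_of_projective y, Abelian.Ext.comp_zero]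

end ConnectingMap

instance projective_mulOpposite (A : Type u) [Ring A] : Module.Projective Aᵐᵒᵖ A :=
  Module.Projective.of_equiv
    ({ MulOpposite.opAddEquiv.symm with
      map_smul' := fun _ _ => rfl } : Aᵐᵒᵖ ≃ₗ[Aᵐᵒᵖ] A)

namespace FreeRes

variable {A : Type u} [Ring A] {M : Type v} [AddCommGroup M] [Module A M] (R : FreeRes A M)

/-- The cokernels of the dual complex. -/
abbrev coker (p : ℕ) := (Fin (R.n p) → A) ⧸ R.bdry p

/-- The differential of the dual complex, on cokernels. -/
def cokerMap (p : ℕ) : R.coker p →ₗ[Aᵐᵒᵖ] (Fin (R.n (p + 1)) → A) :=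
  (R.bdry p).liftQ (R.δ p) (R.bdry_le p)

/-- The short complex `coker p → C (p + 1) → coker (p + 1)`. -/
abbrev cokerComplex (p : ℕ) : ShortComplex (ModuleCat.{u} Aᵐᵒᵖ) :=
  ShortComplex.mk (ModuleCat.ofHom (R.cokerMap p)) (ModuleCat.ofHom (R.bdry (p + 1)).mkQ) (by
    refine ModuleCat.hom_ext (LinearMap.ext fun x => ?_)
    obtain ⟨x, rfl⟩ := Submodule.mkQ_surjective _ x
    exact (Submodule.Quotient.mk_eq_zero _).2 ⟨x, rfl⟩)

lemma cokerComplex_shortExact {p : ℕ} (h : R.ExactAt p) : (R.cokerComplex p).ShortExact where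
  exact := by
    refine (ShortComplex.ShortExact.moduleCat_exact_iff_function_exact _).2 fun y => ?_
    refine (Submodule.Quotient.mk_eq_zero (R.bdry (p + 1))).trans ?_
    constructor
    · rintro ⟨x, rfl⟩
      exact ⟨Submodule.Quotient.mk x, rfl⟩
    · rintro ⟨x, rfl⟩
      induction x using Submodule.Quotient.induction_on with
      | H x => exact ⟨x, rfl⟩
  mono_f := by
    rw [ModuleCat.mono_iff_injective, injective_iff_map_eq_zero]
    intro x hx
    induction x using Submodule.Quotient.induction_on with
    | H x => exact (Submodule.Quotient.mk_eq_zero _).2 (h x hx)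
  epi_g := by
    rw [ModuleCat.epi_iff_surjective]
    exact Submodule.mkQ_surjective _

instance projective_fin_fun (n : ℕ) : Module.Projective Aᵐᵒᵖ (Fin n → A) :=
  Module.Projective.of_equiv (DFinsupp.linearEquivFunOnFintype (R := Aᵐᵒᵖ) (M := fun _ : Fin n => A))

instance (p : ℕ) : Projective (ModuleCat.of Aᵐᵒᵖ (Fin (R.n p) → A)) :=
  (IsProjective.iff_projective _).1 inferInstance

instance (p : ℕ) : Projective (R.cokerComplex p).X₂ :=
  inferInstanceAs (Projective (ModuleCat.of Aᵐᵒᵖ (Fin (R.n (p + 1)) → A)))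

/-- The functional on column vectors given by a row vector. -/
def rowFunctional {n : ℕ} (x : Fin n → A) : (Fin n → A) →ₗ[Aᵐᵒᵖ] ULift.{u} Aᵐᵒᵖ where
  toFun c := ⟨MulOpposite.op (x ⬝ᵥ c)⟩
  map_add' c c' := by rw [dotProduct_add]; rfl
  map_smul' a c := by
    rw [dotProduct_smul]; rfl

lemma rowFunctional_add {n : ℕ} (x y : Fin n → A) :
    rowFunctional (x + y) = rowFunctional x + rowFunctional y := by
  refine LinearMap.ext fun c => ?_
  exact congrArg (fun t => ULift.up (MulOpposite.op t)) (add_dotProduct x y c)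

lemma exists_eq_rowFunctional {n : ℕ} (g : (Fin n → A) →ₗ[Aᵐᵒᵖ] ULift.{u} Aᵐᵒᵖ) :
    ∃ x, g = rowFunctional x := by
  classical
  refine ⟨fun j => (g (Pi.single j 1)).down.unop, ?_⟩
  ext j
  simp [rowFunctional]

lemma rowFunctional_δ (p : ℕ) (y : Fin (R.n (p + 1)) → A) (c) :
    rowFunctional y (R.δ p c) = rowFunctional ((R.X p).vecMulLinear y) c := by
  have h : R.δ p c = (R.X p).mulVec c := by
    ext l; rw [δ_apply]; rfl
  rw [h]
  exact congrArg (fun t => ULift.up (MulOpposite.op t)) (Matrix.dotProduct_mulVec y (R.X p) c)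


/-- Row functionals as morphisms into the regular module. -/
abbrev rowHom {n : ℕ} (x : Fin n → A) :
    ModuleCat.of Aᵐᵒᵖ (Fin n → A) ⟶ regularModuleCat.{u} Aᵐᵒᵖ :=
  ModuleCat.ofHom (rowFunctional x)

lemma exists_eq_rowHom {n : ℕ}
    (e : Abelian.Ext (ModuleCat.of Aᵐᵒᵖ (Fin n → A)) (regularModuleCat.{u} Aᵐᵒᵖ) 0) :
    ∃ x, e = Abelian.Ext.mk₀ (rowHom x) := by
  obtain ⟨t, rfl⟩ := Abelian.Ext.homEquiv₀.symm.surjective e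
  obtain ⟨x, hx⟩ := exists_eq_rowFunctional t.hom
  exact ⟨x, congrArg Abelian.Ext.mk₀ (ModuleCat.hom_ext hx)⟩

lemma ext_coker_eq_zero (R : FreeRes A M) {N : ℕ}
    (hN : ∀ (L : Type u) [AddCommGroup L] [Module Aᵐᵒᵖ L], ∀ i, N < i →
      Subsingleton (SelfExt.{u} (ModuleCat.of Aᵐᵒᵖ L) i))
    (hex : ∀ p, R.ExactAt p) (m : ℕ) : ∀ (p j : ℕ), N < j + 1 + m →
      ∀ x : SelfExt.{u} (ModuleCat.of Aᵐᵒᵖ (R.coker p)) (j + 1), x = 0 := by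
  induction m with
  | zero =>
    intro p j h x
    have := hN (R.coker p) (j + 1) h
    exact Subsingleton.elim _ _
  | succ m ih =>
    intro p j h x
    exact (R.cokerComplex_shortExact (hex p)).eq_zero_of_extClass_comp x
      (ih (p + 1) (j + 1) (by lia) _)

/-- If the dual complex is exact and the right injective dimension is finite, the module
vanishes. -/
lemma subsingleton_of_exact (R : FreeRes A M) {N : ℕ}
    (hN : ∀ (L : Type u) [AddCommGroup L] [Module Aᵐᵒᵖ L], ∀ i, N < i →
      Subsingleton (SelfExt.{u} (ModuleCat.of Aᵐᵒᵖ L) i))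
    (hex : ∀ p, R.ExactAt p) : Subsingleton M := by
  have hS := R.cokerComplex_shortExact (hex 0)
  have key : ∀ x, R.ε x = 0 := by
    intro x
    let g : R.coker 0 →ₗ[Aᵐᵒᵖ] ULift.{u} Aᵐᵒᵖ :=
      (R.bdry 0).liftQ (rowFunctional x) bot_le
    obtain ⟨y, hy⟩ := Abelian.Ext.contravariant_sequence_exact₁ hS (regularModuleCat.{u} Aᵐᵒᵖ)
      (Abelian.Ext.mk₀ (ModuleCat.ofHom g)) (add_comm 1 0)
      (R.ext_coker_eq_zero hN hex N 1 0 (by lia) _)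
    obtain ⟨y, rfl⟩ := exists_eq_rowHom y
    rw [Abelian.Ext.mk₀_comp_mk₀] at hy
    have h2 := Abelian.Ext.homEquiv₀.symm.injective hy
    have h3 : x = (R.X 0).vecMulLinear y := by
      classical
      ext j
      have h4 := congrArg (fun f => (f.hom (Submodule.Quotient.mk (Pi.single j 1))).down.unop) h2
      have h5 := congrArg (fun t => t.down.unop) (R.rowFunctional_δ 0 y (Pi.single j 1))
      have h6 := h5.symm.trans h4
      simpa [rowFunctional, g] using h6.symm
    rw [h3]
    exact R.exact₀.apply_apply_eq_zero y
  refine ⟨fun a b => ?_⟩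
  obtain ⟨x, rfl⟩ := R.surj a
  obtain ⟨y, rfl⟩ := R.surj b
  rw [key, key]

/-- A surjection from the rows onto `Ext^j`, compatible with left multiplication. -/
structure IsRowPresentation {n : ℕ} (Q : ModuleCat.{u} Aᵐᵒᵖ) (j : ℕ)
    (P : (Fin n → A) →+ SelfExt.{u} Q j) : Prop where
  surj : Function.Surjective P
  smul : ∀ a x, P (a • x) =
    (P x).comp (Abelian.Ext.mk₀ (rmulHom.{u} Aᵐᵒᵖ (MulOpposite.op a))) (add_zero j)

lemma IsRowPresentation.succ {n j : ℕ} {S : ShortComplex (ModuleCat.{u} Aᵐᵒᵖ)}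
    (hS : S.ShortExact) [Projective S.X₂] {P : (Fin n → A) →+ SelfExt.{u} S.X₁ j}
    (hP : IsRowPresentation S.X₁ j P) :
    IsRowPresentation S.X₃ (j + 1) ((AddMonoidHom.mk' (fun x => hS.extClass.comp x (add_comm 1 j))
      fun _ _ => Abelian.Ext.comp_add _ _ _ _).comp P) where
  surj y := by
    obtain ⟨x, rfl⟩ := hS.exists_extClass_comp y
    obtain ⟨z, rfl⟩ := hP.surj x
    exact ⟨z, rfl⟩
  smul a x := by
    change hS.extClass.comp (P (a • x)) (add_comm 1 j) =
      (hS.extClass.comp (P x) (add_comm 1 j)).comp _ (add_zero (j + 1))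
    rw [hP.smul]
    exact (Abelian.Ext.comp_assoc_of_third_deg_zero _ _ _ _).symm

/-- `Hom` of the dual of the first term. -/
noncomputable def rowPresentationZero (R : FreeRes A M) :
    (Fin (R.n 0) → A) →+ SelfExt.{u} (ModuleCat.of Aᵐᵒᵖ (R.coker 0)) 0 :=
  AddMonoidHom.mk' (fun x => Abelian.Ext.mk₀ (ModuleCat.ofHom
    ((R.bdry 0).liftQ (rowFunctional x) bot_le))) fun x y => by
      rw [← Ext_mk₀_add]
      refine congrArg Abelian.Ext.mk₀ (ModuleCat.hom_ext (LinearMap.ext fun z => ?_))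
      obtain ⟨z, rfl⟩ := Submodule.mkQ_surjective _ z
      exact congrArg (fun f => f z) (rowFunctional_add x y)

lemma isRowPresentation_zero (R : FreeRes A M) :
    IsRowPresentation _ 0 R.rowPresentationZero where
  surj e := by
    obtain ⟨t, rfl⟩ := Abelian.Ext.homEquiv₀.symm.surjective e
    obtain ⟨x, hx⟩ := exists_eq_rowFunctional (t.hom.comp (R.bdry 0).mkQ)
    refine ⟨x, congrArg Abelian.Ext.mk₀ (ModuleCat.hom_ext (LinearMap.ext fun z => ?_))⟩
    obtain ⟨z, rfl⟩ := Submodule.mkQ_surjective _ z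
    exact (congrArg (fun f => f z) hx).symm
  smul a x := by
    refine Eq.trans ?_ (Abelian.Ext.mk₀_comp_mk₀ _ _).symm
    refine congrArg Abelian.Ext.mk₀ (ModuleCat.hom_ext (LinearMap.ext fun z => ?_))
    obtain ⟨z, rfl⟩ := Submodule.mkQ_surjective _ z
    exact congrArg (fun t => ULift.up (MulOpposite.op t)) (smul_dotProduct a x z)

lemma rowPresentationZero_succ (R : FreeRes A M) (hS : (R.cokerComplex 0).ShortExact)
    {x} (hx : R.ε x = 0) : hS.extClass.comp (R.rowPresentationZero x) (add_comm 1 0) = 0 := by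
  obtain ⟨y, rfl⟩ := (R.exact₀ x).1 hx
  have h : R.rowPresentationZero ((R.X 0).vecMulLinear y) =
      (Abelian.Ext.mk₀ (R.cokerComplex 0).f).comp (Abelian.Ext.mk₀ (rowHom y)) (add_zero 0) := by
    refine Eq.trans ?_ (Abelian.Ext.mk₀_comp_mk₀ _ _).symm
    refine congrArg Abelian.Ext.mk₀ (ModuleCat.hom_ext (LinearMap.ext fun z => ?_))
    obtain ⟨z, rfl⟩ := Submodule.mkQ_surjective _ z
    exact (R.rowFunctional_δ 0 y z).symm
  rw [h, hS.extClass_comp_assoc]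

lemma exists_coker_presentation (R : FreeRes A M) (p : ℕ) (hex : ∀ q ≤ p, R.ExactAt q) :
    ∃ P : (Fin (R.n 0) → A) →+ SelfExt.{u} (ModuleCat.of Aᵐᵒᵖ (R.coker (p + 1))) (p + 1),
      IsRowPresentation _ (p + 1) P ∧ ∀ x, R.ε x = 0 → P x = 0 := by
  induction p with
  | zero =>
    have hS := R.cokerComplex_shortExact (hex 0 le_rfl)
    exact ⟨_, IsRowPresentation.succ hS R.isRowPresentation_zero,
      fun x hx => R.rowPresentationZero_succ hS hx⟩
  | succ p ih =>
    obtain ⟨P, hP, hx⟩ := ih fun q hq => hex q (by lia)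
    have hS := R.cokerComplex_shortExact (hex (p + 1) le_rfl)
    refine ⟨_, IsRowPresentation.succ hS hP, fun x h => ?_⟩
    exact (congrArg (fun t => hS.extClass.comp t (add_comm 1 (p + 1))) (hx x h)).trans
      (Abelian.Ext.comp_zero _ _ _ _ _)

/-- The inclusion of cohomology in the cokernel. -/
def cohToCoker (R : FreeRes A M) (d : ℕ) : R.coh d →ₗ[Aᵐᵒᵖ] R.coker d :=
  (R.bdryZ d).mapQ (R.bdry d) (LinearMap.ker (R.δ d)).subtype le_rfl

lemma cohToCoker_injective (R : FreeRes A M) (d : ℕ) : Function.Injective (R.cohToCoker d) := by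
  rw [injective_iff_map_eq_zero]
  intro x hx
  obtain ⟨x, rfl⟩ := Submodule.mkQ_surjective _ x
  exact (Submodule.Quotient.mk_eq_zero _).2 ((Submodule.Quotient.mk_eq_zero (R.bdry d)).1 hx)

/-- The short complex with first map the inclusion of cohomology in the cokernel. -/
abbrev cohComplex (R : FreeRes A M) (d : ℕ) : ShortComplex (ModuleCat.{u} Aᵐᵒᵖ) :=
  ShortComplex.mk (ModuleCat.ofHom (R.cohToCoker d))
    (ModuleCat.ofHom (LinearMap.range (R.cohToCoker d)).mkQ)
    (ModuleCat.hom_ext (LinearMap.ext fun x => (Submodule.Quotient.mk_eq_zero _).2 ⟨x, rfl⟩))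

lemma cohComplex_shortExact (R : FreeRes A M) (d : ℕ) : (R.cohComplex d).ShortExact where
  exact := (ShortComplex.ShortExact.moduleCat_exact_iff_function_exact _).2 fun _ =>
    Submodule.Quotient.mk_eq_zero _
  mono_f := (ModuleCat.mono_iff_injective _).2 (R.cohToCoker_injective d)
  epi_g := (ModuleCat.epi_iff_surjective _).2 (Submodule.mkQ_surjective _)

lemma IsRowPresentation.restrict {n j : ℕ} {S : ShortComplex (ModuleCat.{u} Aᵐᵒᵖ)}
    (hS : S.ShortExact) (h : Subsingleton (SelfExt.{u} S.X₃ (j + 1)))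
    {P : (Fin n → A) →+ SelfExt.{u} S.X₂ j} (hP : IsRowPresentation S.X₂ j P) :
    IsRowPresentation S.X₁ j ((AddMonoidHom.mk' (fun x => (Abelian.Ext.mk₀ S.f).comp x (zero_add j))
      fun _ _ => Abelian.Ext.comp_add _ _ _ _).comp P) where
  surj y := by
    obtain ⟨x, rfl⟩ := Abelian.Ext.contravariant_sequence_exact₁ hS _ y (add_comm 1 j)
      (Subsingleton.elim _ _)
    obtain ⟨z, rfl⟩ := hP.surj x
    exact ⟨z, rfl⟩
  smul a x := by
    change (Abelian.Ext.mk₀ S.f).comp (P (a • x)) (zero_add j) =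
      ((Abelian.Ext.mk₀ S.f).comp (P x) (zero_add j)).comp _ (add_zero j)
    rw [hP.smul]
    exact (Abelian.Ext.comp_assoc_of_third_deg_zero _ _ _ _).symm

/-- The double dual of the first nonvanishing cohomology of the dual complex is a quotient of
the module one started with. -/
theorem exists_coh_presentation (R : FreeRes A M) (d : ℕ) (hex : ∀ q < d, R.ExactAt q)
    (hN : ∀ (L : Type u) [AddCommGroup L] [Module Aᵐᵒᵖ L],
      Subsingleton (SelfExt.{u} (ModuleCat.of Aᵐᵒᵖ L) (d + 1))) :
    ∃ P : (Fin (R.n 0) → A) →+ SelfExt.{u} (ModuleCat.of Aᵐᵒᵖ (R.coh d)) d,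
      IsRowPresentation _ d P ∧ ∀ x, R.ε x = 0 → P x = 0 := by
  have hS := R.cohComplex_shortExact d
  cases d with
  | zero =>
    refine ⟨_, IsRowPresentation.restrict hS (hN _) R.isRowPresentation_zero, fun x hx => ?_⟩
    obtain ⟨y, rfl⟩ := (R.exact₀ x).1 hx
    refine (Abelian.Ext.mk₀_comp_mk₀ _ _).trans ?_
    refine (congrArg Abelian.Ext.mk₀ (ModuleCat.hom_ext (LinearMap.ext fun z => ?_))).trans
      (Abelian.Ext.mk₀_zero _ _)
    obtain ⟨z, rfl⟩ := Submodule.mkQ_surjective _ z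
    refine (R.rowFunctional_δ 0 y z.1).symm.trans ?_
    rw [z.2, map_zero]
    rfl
  | succ d =>
    obtain ⟨P, hP, hx⟩ := R.exists_coker_presentation d fun q hq => hex q (by lia)
    refine ⟨_, IsRowPresentation.restrict hS (hN _) hP, fun x h => ?_⟩
    exact (congrArg (fun t => (Abelian.Ext.mk₀ (R.cohComplex (d + 1)).f).comp t
      (zero_add (d + 1))) (hx x h)).trans (Abelian.Ext.comp_zero _ _ _ _ _)

end FreeRes

section SelfInjective

variable {A : Type u} [Ring A]

lemma subsingleton_selfExt (M : Type u) [AddCommGroup M] [Module A M] (i : ℕ)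
    (h : Subsingleton (ExtGroup A M A i)) :
    Subsingleton (SelfExt.{u} (ModuleCat.of A M) i) := by
  let e : ModuleCat.of A M ≅ ModuleCat.of A (ULift.{u} M) :=
    (ULift.moduleEquiv (R := A) (M := M)).symm.toModuleIso
  refine ⟨fun x y => ?_⟩
  have key : ∀ x : SelfExt.{u} (ModuleCat.of A M) i, x =
      (Abelian.Ext.mk₀ e.hom).comp ((Abelian.Ext.mk₀ e.inv).comp x (zero_add i)) (zero_add i) := by
    intro x
    rw [Abelian.Ext.mk₀_comp_mk₀_assoc, e.hom_inv_id, Abelian.Ext.mk₀_id_comp]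
  rw [key x, key y]
  congr 1
  exact h.elim _ _

lemma exists_bound_of_selfInjectiveDimension_ne_top (h : selfInjectiveDimension A ≠ ⊤) :
    ∃ n : ℕ, ∀ (M : Type u) [AddCommGroup M] [Module A M],
      ∀ i : ℕ, n < i → Subsingleton (ExtGroup A M A i) := by
  by_contra hn
  refine h (sInf_eq_top.2 ?_)
  rintro _ ⟨n, -, h⟩
  exact (hn ⟨n, h⟩).elim

lemma selfInjectiveDimension_eq (d : ℕ)
    (h : ∀ (M : Type u) [AddCommGroup M] [Module A M], Module.Finite A M →
      ∀ i, d < i → Subsingleton (ExtGroup A M A i))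
    (M : Type u) [AddCommGroup M] [Module A M] (hM : Nontrivial (ExtGroup A M A d)) :
    selfInjectiveDimension A = d := by
  refine le_antisymm (sInf_le ⟨d, rfl, subsingleton_ext_of_finite d h⟩) (le_sInf ?_)
  rintro _ ⟨n, rfl, hn⟩
  by_contra hlt
  exact not_subsingleton _ (hn M d (by simpa using hlt))

lemma moduleGrade_eq_top {M : Type v} [AddCommGroup M] [Module A M]
    (h : moduleGrade A M = ⊤) (i : ℕ) : Subsingleton (ExtGroup A M A i) :=
  (FreeRes.coe_le_moduleGrade_iff (i + 1)).1 (h ▸ le_top) i (Nat.lt_succ_self i)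

end SelfInjective

lemma IsLocallyFinite.of_algEquiv {k A B M : Type*} [Field k] [Ring A] [Algebra k A] [Ring B]
    [Algebra k B] [AddCommGroup M] [Module k M] [Module A M] [IsScalarTower k A M]
    [Module B M] [IsScalarTower k B M] (φ : A ≃ₐ[k] B) (hφ : ∀ a (m : M), φ a • m = a • m)
    (h : IsLocallyFinite k A M) : IsLocallyFinite k B M := by
  intro V hV x
  obtain ⟨G, h1, h2, h3⟩ := h (V.map φ.symm.toLinearMap) inferInstance x
  refine ⟨G, h1, h2, fun b hb g hg => ?_⟩
  have := h3 _ (Submodule.mem_map_of_mem hb) g hg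
  rwa [← hφ, AlgEquiv.toLinearMap_apply, φ.apply_symm_apply] at this

section Hopf

variable (k : Type u) [Field k] (H : Type u) [Ring H] [HopfAlgebra k H]

noncomputable instance : Module k (TrivialCounitModule k H) := inferInstanceAs (Module k k)

lemma TrivialCounitModule.smul_def (h : H) (t : TrivialCounitModule k H) :
    h • t = (Coalgebra.counit (R := k) h) • t := rfl

instance : IsScalarTower k H (TrivialCounitModule k H) where
  smul_assoc c h t := by
    rw [TrivialCounitModule.smul_def, TrivialCounitModule.smul_def, map_smul, smul_assoc]

instance : Module.Finite k (TrivialCounitModule k H) := inferInstanceAs (Module.Finite k k)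

instance : Nontrivial (TrivialCounitModule k H) := inferInstanceAs (Nontrivial k)

instance : Module.Finite H (TrivialCounitModule k H) := Module.Finite.of_restrictScalars_finite k H _

lemma isLocallyFinite_of_finite {A M : Type*} [Ring A] [Algebra k A] [AddCommGroup M] [Module k M]
    [Module A M] [IsScalarTower k A M] [Module.Finite k M] : IsLocallyFinite k A M :=
  fun _ _ _ => ⟨⊤, inferInstance, trivial, fun _ _ _ _ => trivial⟩

/-- The antipode as an isomorphism onto the opposite algebra. -/
noncomputable def antipodeEquiv (hS : Function.Bijective (HopfAlgebra.antipode k : H →ₗ[k] H)) :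
    H ≃ₐ[k] Hᵐᵒᵖ :=
  AlgEquiv.ofBijective (HopfAlgebra.antipodeAlgHomOp k H)
    ((MulOpposite.op_bijective).comp hS)

end Hopf

/-- A module over `B` as a module over an isomorphic ring `A`. -/
lemma exists_module_of_ringEquiv {A B : Type*} [Ring A] [Ring B] (φ : A ≃+* B) (N : Type*)
    [AddCommGroup N] [Module B N] [Module.Finite B N] :
    ∃ _ : Module A N, (∀ (a : A) (n : N), φ a • n = a • n) ∧ Module.Finite A N := by
  let _ : Module A N := Module.compHom N (φ : A →+* B)
  refine ⟨inferInstance, fun _ _ => rfl, ?_⟩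
  let f : N →ₛₗ[(φ.symm : B →+* A)] N :=
    { AddMonoidHom.id N with
      map_smul' b n := by
        change b • n = φ (φ.symm b) • n
        rw [φ.apply_symm_apply] }
  exact Module.Finite.of_surjective f Function.surjective_id

/-- A presentation of `Ext` by rows is a presentation of the cohomology of a dual complex. -/
lemma FreeRes.IsRowPresentation.exists_coh {A : Type u} [Ring A] {n d : ℕ} {Q : ModuleCat.{u} Aᵐᵒᵖ}
    {P : (Fin n → A) →+ SelfExt.{u} Q d} (hP : FreeRes.IsRowPresentation Q d P)
    (R : FreeRes Aᵐᵒᵖ Q) : ∃ π : (Fin n → A) →+ R.coh d, Function.Surjective π ∧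
      (∀ (a : A) x, π (a • x) = MulOpposite.op (MulOpposite.op a) • π x) ∧
        ∀ x, P x = 0 → π x = 0 := by
  obtain ⟨Ψ, hΨ⟩ := FreeRes.exists_computes.{u} d R
  choose z hz using fun x => hΨ.surj (P x)
  have key : ∀ z z', Ψ z = Ψ z' → (R.bdryZ d).mkQ z = (R.bdryZ d).mkQ z' := by
    intro z z' h
    have h0 : Ψ (z - z') = 0 := by rw [map_sub, h, sub_self]
    exact (Submodule.Quotient.eq _).2 ((hΨ.eq_zero _).1 h0)
  refine ⟨AddMonoidHom.mk' (fun x => (R.bdryZ d).mkQ (z x)) fun x y => ?_, fun y => ?_,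
    fun a x => ?_, fun x hx => ?_⟩
  · rw [← map_add]
    exact key _ _ (by rw [map_add, hz, hz, hz, map_add])
  · obtain ⟨w, rfl⟩ := Submodule.mkQ_surjective _ y
    obtain ⟨x, hx⟩ := hP.surj (Ψ w)
    exact ⟨x, key _ _ ((hz x).trans hx)⟩
  · refine Eq.trans ?_ (map_smul (R.bdryZ d).mkQ _ _)
    refine key _ _ ?_
    rw [hz, hP.smul, hΨ.smul, hz]
  · refine Eq.trans (key _ 0 ?_) (map_zero (R.bdryZ d).mkQ)
    rw [hz, hx, map_zero]

section Core

variable {k : Type u} [Field k] {H : Type u} [Ring H] [HopfAlgebra k H]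

variable (k H) in
/-- The Cohen–Macaulay property with respect to the Gelfand–Kirillov dimension. -/
def IsGKCohenMacaulay : Prop :=
  ∀ (M : Type u) [AddCommGroup M] [Module H M] [Module k M]
      [IsScalarTower k H M], Nontrivial M → IsNoetherian H M →
        (moduleGrade H M : ENNReal) + gkDimModule k H M = gkDim k H

namespace IsGKCohenMacaulay

lemma moduleGrade_trivial_ne_top [IsNoetherianRing H]
    (hinj' : selfInjectiveDimension Hᵐᵒᵖ ≠ ⊤) : moduleGrade H (TrivialCounitModule k H) ≠ ⊤ := by
  intro h
  obtain ⟨F⟩ := FreeRes.exists_of_finite (A := H) (M := TrivialCounitModule k H)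
  obtain ⟨N, hN⟩ := exists_bound_of_selfInjectiveDimension_ne_top hinj'
  exact not_subsingleton (TrivialCounitModule k H) (F.subsingleton_of_exact
    (fun L _ _ i hi => subsingleton_selfExt L i (hN L i hi))
    fun p => (F.exactAt_iff_subsingleton p).2 (moduleGrade_eq_top h p))

variable (hCM : IsGKCohenMacaulay k H) {d : ℕ}
  (hd : moduleGrade H (TrivialCounitModule k H) = d) [IsNoetherianRing H]

include hCM hd

lemma gkDim_eq : gkDim k H = d := by
  have h := hCM (TrivialCounitModule k H) inferInstance inferInstance
  rw [hd, gkDimModule_eq_zero_iff.2 (isLocallyFinite_of_finite k), add_zero] at h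
  exact h.symm

lemma moduleGrade_le (M : Type u) [AddCommGroup M] [Module H M] [Module.Finite H M]
    [Nontrivial M] : moduleGrade H M ≤ d := by
  let _ : Module k M := Module.compHom M (algebraMap k H)
  have : IsScalarTower k H M := .of_algebraMap_smul fun _ _ => rfl
  have h := hCM M inferInstance inferInstance
  rw [hCM.gkDim_eq hd] at h
  exact ENat.toENNReal_le.1 (le_self_add.trans h.le)

lemma moduleGrade_eq_iff (M : Type u) [AddCommGroup M] [Module H M] [Module.Finite H M]
    [Nontrivial M] [Module k M] [IsScalarTower k H M] :
    moduleGrade H M = d ↔ IsLocallyFinite k H M := by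
  have h := hCM M inferInstance inferInstance
  rw [hCM.gkDim_eq hd] at h
  rw [← gkDimModule_eq_zero_iff]
  constructor
  · intro h1
    rw [h1] at h
    exact (ENNReal.add_right_inj (ENNReal.natCast_ne_top d)).1 (h.trans (add_zero _).symm)
  · intro h1
    rw [h1, add_zero] at h
    exact ENat.toENNReal_inj.1 h

variable (hS : Function.Bijective (HopfAlgebra.antipode k : H →ₗ[k] H))

include hS

lemma moduleGrade_op_le (N : Type u) [AddCommGroup N] [Module Hᵐᵒᵖ N] [Module.Finite Hᵐᵒᵖ N]
    [Nontrivial N] : moduleGrade Hᵐᵒᵖ N ≤ d := by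
  obtain ⟨_, hφ, _⟩ := exists_module_of_ringEquiv (antipodeEquiv k H hS).toRingEquiv N
  obtain ⟨R⟩ := FreeRes.exists_of_finite (A := H) (M := N)
  rw [R.moduleGrade_congr (antipodeEquiv k H hS).toRingEquiv (AddEquiv.refl N)
    fun a n => (hφ a n).symm]
  exact hCM.moduleGrade_le hd N

lemma moduleGrade_op_eq_iff (N : Type u) [AddCommGroup N] [Module Hᵐᵒᵖ N]
    [Module.Finite Hᵐᵒᵖ N] [Nontrivial N] [Module k N] [IsScalarTower k Hᵐᵒᵖ N] :
    moduleGrade Hᵐᵒᵖ N = d ↔ IsLocallyFinite k Hᵐᵒᵖ N := by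
  obtain ⟨_, hφ, _⟩ := exists_module_of_ringEquiv (antipodeEquiv k H hS).toRingEquiv N
  obtain ⟨R⟩ := FreeRes.exists_of_finite (A := H) (M := N)
  have : IsScalarTower k H N := ⟨fun c a n => by
    rw [← hφ, ← hφ, ← smul_assoc]
    exact congrArg (· • n) (map_smul (antipodeEquiv k H hS) c a)⟩
  rw [R.moduleGrade_congr (antipodeEquiv k H hS).toRingEquiv (AddEquiv.refl N)
    fun a n => (hφ a n).symm, hCM.moduleGrade_eq_iff hd N]
  refine ⟨.of_algEquiv (antipodeEquiv k H hS) hφ, .of_algEquiv (antipodeEquiv k H hS).symm ?_⟩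
  intro b n
  obtain ⟨a, rfl⟩ := (antipodeEquiv k H hS).surjective b
  rw [AlgEquiv.symm_apply_apply]
  exact (hφ a n).symm

variable [IsNoetherianRing Hᵐᵒᵖ] (haus : AuslanderCondition H)

include haus

lemma subsingleton_ext (M : Type u) [AddCommGroup M] [Module H M] [Module.Finite H M] (i : ℕ)
    (hi : d < i) : Subsingleton (ExtGroup H M H i) := by
  by_contra hn
  obtain ⟨R⟩ := FreeRes.exists_of_finite (A := H) (M := M)
  obtain ⟨e⟩ := R.nonempty_coh_equiv_extGroup i
  rw [← e.toEquiv.subsingleton_congr, not_subsingleton_iff_nontrivial] at hn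
  have : IsNoetherian Hᵐᵒᵖ (Fin (R.n i) → H) := by
    have : IsNoetherian Hᵐᵒᵖ H := isNoetherian_of_linearEquiv (MulOpposite.opLinearEquiv Hᵐᵒᵖ).symm
    infer_instance
  have h1 := hCM.moduleGrade_op_le hd hS (R.coh i)
  obtain ⟨R'⟩ := FreeRes.exists_of_finite (A := Hᵐᵒᵖ) (M := R.coh i)
  have h2 := haus M inferInstance i ⊤
  rw [R'.moduleGrade_congr (RingEquiv.refl _) (e.trans Submodule.topEquiv.symm).toAddEquiv
    fun a n => map_smul (e.trans Submodule.topEquiv.symm) a n] at h2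
  have := h2.trans h1
  norm_cast at this
  omega

lemma subsingleton_ext_op (N : Type u) [AddCommGroup N] [Module Hᵐᵒᵖ N] [Module.Finite Hᵐᵒᵖ N]
    (i : ℕ) (hi : d < i) : Subsingleton (ExtGroup Hᵐᵒᵖ N Hᵐᵒᵖ i) := by
  obtain ⟨_, hφ, _⟩ := exists_module_of_ringEquiv (antipodeEquiv k H hS).toRingEquiv N
  obtain ⟨R⟩ := FreeRes.exists_of_finite (A := H) (M := N)
  rw [R.subsingleton_ext_congr (antipodeEquiv k H hS).toRingEquiv (AddEquiv.refl N)
    fun a n => (hφ a n).symm]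
  exact hCM.subsingleton_ext hd hS haus N i hi

lemma selfInjectiveDimension_eq : selfInjectiveDimension H = d :=
  _root_.selfInjectiveDimension_eq d (fun M _ _ _ i hi => hCM.subsingleton_ext hd hS haus M i hi)
    (TrivialCounitModule k H) (nontrivial_of_moduleGrade_eq hd)

lemma selfInjectiveDimension_op_eq : selfInjectiveDimension Hᵐᵒᵖ = d := by
  obtain ⟨_, hφ, _⟩ := exists_module_of_ringEquiv (antipodeEquiv k H hS).toRingEquiv.symm
    (TrivialCounitModule k H)
  obtain ⟨F⟩ := FreeRes.exists_of_finite (A := H) (M := TrivialCounitModule k H)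
  refine _root_.selfInjectiveDimension_eq d
    (fun M _ _ _ i hi => hCM.subsingleton_ext_op hd hS haus M i hi) (TrivialCounitModule k H) ?_
  rw [← not_subsingleton_iff_nontrivial, F.subsingleton_ext_congr
    (antipodeEquiv k H hS).toRingEquiv (AddEquiv.refl _), not_subsingleton_iff_nontrivial]
  · exact nontrivial_of_moduleGrade_eq hd
  · intro a t
    rw [← hφ, RingEquiv.symm_apply_apply]
    rfl

omit haus in
omit [IsNoetherianRing Hᵐᵒᵖ] in
/-- Local finiteness forces the dual of a free resolution to be exact below the top degree. -/
lemma exactAt_of_isLocallyFinite {N : Type u} [AddCommGroup N] [Module Hᵐᵒᵖ N] [Nontrivial N]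
    [Module k N] [IsScalarTower k Hᵐᵒᵖ N] (hN : IsLocallyFinite k Hᵐᵒᵖ N) (R : FreeRes Hᵐᵒᵖ N)
    {q : ℕ} (hq : q < d) : R.ExactAt q := by
  have : Module.Finite Hᵐᵒᵖ N := .of_surjective R.ε R.surj
  have h := (hCM.moduleGrade_op_eq_iff hd hS N).2 hN
  exact (R.exactAt_iff_subsingleton q).2 ((FreeRes.coe_le_moduleGrade_iff d).1 h.ge q hq)

variable (F : FreeRes H (TrivialCounitModule k H))

omit haus hCM hS in
omit [IsNoetherianRing Hᵐᵒᵖ] [IsNoetherianRing H] in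
lemma exactAt_trivial {p : ℕ} (hp : p < d) : F.ExactAt p :=
  (F.exactAt_iff_subsingleton p).2 ((FreeRes.coe_le_moduleGrade_iff d).1 hd.ge p hp)

omit haus hCM hS in
omit [IsNoetherianRing Hᵐᵒᵖ] [IsNoetherianRing H] in
lemma nontrivial_coh : Nontrivial (F.coh d) := by
  obtain ⟨e⟩ := F.nonempty_coh_equiv_extGroup d
  have := nontrivial_of_moduleGrade_eq hd
  exact e.toEquiv.nontrivial

omit hCM hd hS haus [IsNoetherianRing H] in
lemma _root_.FreeRes.finite_coh {M : Type*} [AddCommGroup M] [Module H M] (F : FreeRes H M)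
    (i : ℕ) : Module.Finite Hᵐᵒᵖ (F.coh i) := by
  have : IsNoetherian Hᵐᵒᵖ (Fin (F.n i) → H) := by
    have : IsNoetherian Hᵐᵒᵖ H := isNoetherian_of_linearEquiv (MulOpposite.opLinearEquiv Hᵐᵒᵖ).symm
    infer_instance
  infer_instance

lemma isLocallyFinite_coh : IsLocallyFinite k Hᵐᵒᵖ (F.coh d) := by
  have := nontrivial_coh hd F
  have := F.finite_coh d
  rw [← hCM.moduleGrade_op_eq_iff hd hS]
  refine le_antisymm (hCM.moduleGrade_op_le hd hS _) ?_
  obtain ⟨e⟩ := F.nonempty_coh_equiv_extGroup d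
  obtain ⟨R'⟩ := FreeRes.exists_of_finite (A := Hᵐᵒᵖ) (M := F.coh d)
  have h2 := haus (TrivialCounitModule k H) inferInstance d ⊤
  rwa [R'.moduleGrade_congr (RingEquiv.refl _) (e.trans Submodule.topEquiv.symm).toAddEquiv
    fun a n => map_smul (e.trans Submodule.topEquiv.symm) a n] at h2

/-- The double dual of the trivial module is a quotient of the trivial module. -/
lemma coh_coh_trivial (R : FreeRes Hᵐᵒᵖ (F.coh d)) :
    (∀ (h : H) (y : R.coh d), MulOpposite.op (MulOpposite.op h) • y =
      Coalgebra.counit (R := k) h • y) ∧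
    ∃ v : R.coh d, ∀ y : R.coh d, ∃ c : k, y = c • v := by
  obtain ⟨P, hP, hP0⟩ := F.exists_coh_presentation d (fun q hq => exactAt_trivial hd F hq)
    fun L _ _ => subsingleton_selfExt L _ (subsingleton_ext_of_finite d
      (fun M _ _ _ i hi => hCM.subsingleton_ext_op hd hS haus M i hi) L _ (Nat.lt_succ_self d))
  obtain ⟨π, h1, h2, h3⟩ : ∃ π : (Fin (F.n 0) → H) →+ R.coh d, Function.Surjective π ∧
      (∀ a x, π (a • x) = MulOpposite.op (MulOpposite.op a) • π x) ∧ ∀ x, P x = 0 → π x = 0 :=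
    hP.exists_coh (Q := ModuleCat.of Hᵐᵒᵖ (F.coh d)) R
  have hπ : ∀ x x', F.ε x = F.ε x' → π x = π x' := by
    intro x x' h
    rw [← sub_eq_zero, ← map_sub]
    exact h3 _ (hP0 _ (by rw [map_sub, h, sub_self]))
  have hk : ∀ (c : k) (x), c • π x = π (algebraMap k H c • x) := by
    intro c x
    rw [h2]
    exact (algebraMap_smul Hᵐᵒᵖᵐᵒᵖ c (π x)).symm
  refine ⟨fun h y => ?_, ?_⟩
  · obtain ⟨x, rfl⟩ := h1 y
    rw [hk, ← h2]
    refine hπ _ _ ?_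
    rw [map_smul, map_smul, algebraMap_smul]
    rfl
  · obtain ⟨e, he⟩ := F.surj (1 : k)
    refine ⟨π e, fun y => ?_⟩
    obtain ⟨x, rfl⟩ := h1 y
    refine ⟨F.ε x, Eq.trans ?_ (hk _ e).symm⟩
    refine hπ _ _ ?_
    have key : ∀ c : k, algebraMap k H c • F.ε e = c := fun c => by
      rw [algebraMap_smul, he]
      exact mul_one (M := k) c
    exact ((map_smul F.ε _ e).trans (key _)).symm

end IsGKCohenMacaulay

end Core

/-! ### Staircases in a double complex -/

section Staircase

variable {A : ℕ → ℕ → Type*} [∀ p q, AddCommGroup (A p q)]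

/-- Commuting differentials on a family of abelian groups indexed by a quadrant. -/
structure IsDoubleComplex (dp : ∀ p q, A p q →+ A (p + 1) q) (dq : ∀ p q, A p q →+ A p (q + 1)) :
    Prop where
  comm : ∀ p q a, dq (p + 1) q (dp p q a) = dp p (q + 1) (dq p q a)
  dp_dp : ∀ p q a, dp (p + 1) q (dp p q a) = 0
  dq_dq : ∀ p q a, dq p (q + 1) (dq p q a) = 0

/-- Boundaries in the first direction. -/
def pBdry (dp : ∀ p q, A p q →+ A (p + 1) q) : ∀ p q, AddSubgroup (A p q)
  | 0, _ => ⊥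
  | p + 1, q => (dp p q).range

/-- Boundaries in the second direction. -/
def qBdry (dq : ∀ p q, A p q →+ A p (q + 1)) : ∀ p q, AddSubgroup (A p q)
  | _, 0 => ⊥
  | p, q + 1 => (dq p q).range

/-- A family of elements of total degree `d` whose successive differentials match. -/
def IsStaircase (dp : ∀ p q, A p q →+ A (p + 1) q) (dq : ∀ p q, A p q →+ A p (q + 1)) (d : ℕ)
    (a : ∀ p q, A p q) : Prop :=
  ∀ p q, p + q + 1 = d → dq (p + 1) q (a (p + 1) q) = dp p (q + 1) (a p (q + 1))

variable {dp : ∀ p q, A p q →+ A (p + 1) q} {dq : ∀ p q, A p q →+ A p (q + 1)} {d : ℕ}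

namespace IsDoubleComplex

variable (hD : IsDoubleComplex dp dq)

include hD

lemma dp_eq_zero {p q : ℕ} {a : A p q} (h : a ∈ pBdry dp p q) : dp p q a = 0 := by
  cases p with
  | zero => rw [(AddSubgroup.mem_bot.1 h), map_zero]
  | succ p =>
    obtain ⟨c, rfl⟩ := h
    exact hD.dp_dp p q c

lemma exists_staircase_aux (hp : ∀ p q, p < d → ∀ a, dp p q a = 0 → a ∈ pBdry dp p q) (p : ℕ) :
    ∀ q, p + q = d → ∀ b : A p q, dq p q b ∈ pBdry dp p (q + 1) →
      ∃ a : ∀ p q, A p q, a p q = b ∧ dq 0 d (a 0 d) = 0 ∧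
        ∀ p' q', p' + q' + 1 = d → q ≤ q' →
          dq (p' + 1) q' (a (p' + 1) q') = dp p' (q' + 1) (a p' (q' + 1)) := by
  classical
  induction p with
  | zero =>
    intro q hq b hb
    obtain rfl : q = d := by lia
    refine ⟨Function.update 0 0 (Function.update 0 q b), by simp, ?_, fun p' q' h h' => by lia⟩
    simpa using AddSubgroup.mem_bot.1 hb
  | succ p ih =>
    intro q hq b hb
    obtain ⟨c, hc⟩ := hb
    obtain ⟨a, h1, h2, h3⟩ := ih (q + 1) (by lia) c <| hp _ _ (by lia) _ <| by
      rw [← hD.comm, hc, hD.dq_dq]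
    refine ⟨Function.update a (p + 1) (Function.update (a (p + 1)) q b), by simp, ?_, ?_⟩
    · rwa [Function.update_of_ne (by lia)]
    · intro p' q' h h'
      rcases h'.eq_or_lt with rfl | h'
      · obtain rfl : p' = p := by lia
        rw [Function.update_self, Function.update_self, Function.update_of_ne (by lia), h1, hc]
      · have e1 : Function.update a (p + 1) (Function.update (a (p + 1)) q b) (p' + 1) q' =
            a (p' + 1) q' := by
          by_cases hpp : p' + 1 = p + 1
          · lia
          · rw [Function.update_of_ne hpp]
        have e2 : Function.update a (p + 1) (Function.update (a (p + 1)) q b) p' (q' + 1) =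
            a p' (q' + 1) := by
          rw [Function.update_of_ne (by lia)]
        rw [e1, e2, h3 p' q' h h']

/-- A cocycle at the end of the first axis extends to a staircase. -/
lemma exists_staircase (hp : ∀ p q, p < d → ∀ a, dp p q a = 0 → a ∈ pBdry dp p q) (s : A d 0)
    (hs : dp d 0 s = 0) (hs' : dq d 0 s ∈ pBdry dp d 1) :
    ∃ a : ∀ p q, A p q, IsStaircase dp dq d a ∧ a d 0 = s ∧ dq 0 d (a 0 d) = 0 ∧
      dp 0 d (a 0 d) ∈ qBdry dq 1 d := by
  obtain ⟨a, h1, h2, h3⟩ := hD.exists_staircase_aux hp d 0 (add_zero d) s hs'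
  refine ⟨a, fun p q h => h3 p q h (Nat.zero_le q), h1, h2, ?_⟩
  cases d with
  | zero => exact AddSubgroup.mem_bot.2 (by rw [h1, hs])
  | succ d => exact ⟨a 1 d, h3 0 d (by lia) (Nat.zero_le d)⟩

/-- A staircase ending in a boundary begins with a boundary. -/
lemma mem_pBdry_of_staircase (hq : ∀ p q, q < d → ∀ a, dq p q a = 0 → a ∈ qBdry dq p q)
    {a : ∀ p q, A p q} (ha : IsStaircase dp dq d a) (h0 : a 0 d ∈ qBdry dq 0 d) :
    a d 0 ∈ pBdry dp d 0 := by
  have key : ∀ p q, p + q = d → a p q ∈ qBdry dq p q ⊔ pBdry dp p q := by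
    intro p
    induction p with
    | zero =>
      intro q h
      obtain rfl : q = d := by lia
      exact AddSubgroup.mem_sup_left h0
    | succ p ih =>
      intro q h
      obtain ⟨_, ⟨c, rfl⟩, v, hv, huv⟩ := AddSubgroup.mem_sup.1 (ih (q + 1) (by lia))
      have h1 := ha p q (by lia)
      rw [← huv, map_add, hD.dp_eq_zero hv, add_zero, ← hD.comm, ← sub_eq_zero, ← map_sub] at h1
      rw [← sub_add_cancel (a (p + 1) q) (dp p q c)]
      exact AddSubgroup.add_mem_sup (hq _ _ (by lia) _ h1) ⟨c, rfl⟩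
  simpa [qBdry] using key d 0 (add_zero d)

end IsDoubleComplex

end Staircase

/-! ### Tensoring the dual complex with a vector space -/

section TensorCoefficients

open TensorProduct

variable {k : Type*} [Field k] {A : Type u} [Ring A] [Algebra k A]
  {N W : Type*} [AddCommGroup N] [Module k N] [AddCommGroup W] [Module k W]

/-- Tuples with entries in `W ≃ N ⊗ A` are tensors with tuples with entries in `A`. -/
noncomputable def tensorPiEquiv (ψ : N ⊗[k] A ≃ₗ[k] W) (n : ℕ) :
    N ⊗[k] (Fin n → A) ≃ₗ[k] (Fin n → W) :=
  TensorProduct.piRight k k N (fun _ => A) ≪≫ₗ LinearEquiv.piCongrRight fun _ => ψ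

lemma tensorPiEquiv_tmul (ψ : N ⊗[k] A ≃ₗ[k] W) {n : ℕ} (x : N) (c : Fin n → A) (i : Fin n) :
    tensorPiEquiv ψ n (x ⊗ₜ c) i = ψ (x ⊗ₜ c i) := rfl

namespace FreeRes

variable {M : Type v} [AddCommGroup M] [Module A M] (R : FreeRes A M)
  (ρ : A →ₐ[k] Module.End k W) (ψ : N ⊗[k] A ≃ₗ[k] W)

/-- Boundaries of the dual complex with coefficients in `W`. -/
noncomputable def coeffBdry : ∀ i, Submodule k (Fin (R.n i) → W)
  | 0 => ⊥
  | i + 1 => LinearMap.range (colMap (ρ : A →+* Module.End k W) (R.X i))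

/-- The inclusion of the cocycles, as a map of vector spaces. -/
def kerInc (k : Type*) [Field k] [Algebra k A] (i : ℕ) :
    LinearMap.ker (R.δ i) →ₗ[k] (Fin (R.n i) → A) :=
  (LinearMap.ker (R.δ i)).subtype.restrictScalars k

lemma kerInc_injective (i : ℕ) : Function.Injective (R.kerInc k i) := Subtype.val_injective

/-- The projection from cocycles to cohomology, as a map of vector spaces. -/
def kerMk (k : Type*) [Field k] [Algebra k A] (i : ℕ) :
    LinearMap.ker (R.δ i) →ₗ[k] R.coh i :=
  (R.bdryZ i).mkQ.restrictScalars k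

lemma kerMk_surjective (i : ℕ) : Function.Surjective (R.kerMk k i) :=
  Submodule.mkQ_surjective (R.bdryZ i)

lemma kerMk_eq_zero_iff {i : ℕ} (z : LinearMap.ker (R.δ i)) :
    R.kerMk k i z = 0 ↔ z.1 ∈ R.bdry i :=
  Submodule.Quotient.mk_eq_zero (R.bdryZ i)

/-- Tensors with cocycles, as tuples. -/
noncomputable def tensorKer (i : ℕ) :
    N ⊗[k] LinearMap.ker (R.δ i) →ₗ[k] (Fin (R.n i) → W) :=
  (tensorPiEquiv ψ (R.n i)).toLinearMap ∘ₗ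
    LinearMap.lTensor N (R.kerInc k i)

/-- Tensors with cocycles map to tensors with cohomology. -/
noncomputable def tensorCoh (k : Type*) [Field k] [Algebra k A] (N : Type*) [AddCommGroup N]
    [Module k N] (i : ℕ) :
    N ⊗[k] LinearMap.ker (R.δ i) →ₗ[k] N ⊗[k] R.coh i :=
  LinearMap.lTensor N (R.kerMk k i)

lemma tensorCoh_tmul (i : ℕ) (x : N) (z : LinearMap.ker (R.δ i)) :
    R.tensorCoh k N i (x ⊗ₜ z) = x ⊗ₜ R.kerMk k i z :=
  LinearMap.lTensor_tmul N (R.kerMk k i) x z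

lemma tensorCoh_surjective (i : ℕ) : Function.Surjective (R.tensorCoh k N i) :=
  LinearMap.lTensor_surjective N (R.kerMk_surjective i)

lemma tensorKer_rTensor {N' W' : Type*} [AddCommGroup N'] [Module k N'] [AddCommGroup W']
    [Module k W'] (ψ' : N' ⊗[k] A ≃ₗ[k] W') (g : N →ₗ[k] N') (g' : W →ₗ[k] W')
    (hg : ∀ w, ψ' (LinearMap.rTensor A g w) = g' (ψ w)) (i : ℕ)
    (ζ : N ⊗[k] LinearMap.ker (R.δ i)) (j) :
    R.tensorKer ψ' i (LinearMap.rTensor _ g ζ) j = g' (R.tensorKer ψ i ζ j) := by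
  induction ζ with
  | zero => simp only [map_zero, Pi.zero_apply]
  | add x y hx hy => simp only [map_add, Pi.add_apply, hx, hy]
  | tmul n z => exact hg (n ⊗ₜ z.1 j)

lemma tensorCoh_rTensor {N' : Type*} [AddCommGroup N'] [Module k N'] (g : N →ₗ[k] N') (i : ℕ)
    (ζ : N ⊗[k] LinearMap.ker (R.δ i)) :
    R.tensorCoh k N' i (LinearMap.rTensor _ g ζ) =
      LinearMap.rTensor _ g (R.tensorCoh k N i ζ) := by
  rw [tensorCoh, tensorCoh, ← LinearMap.comp_apply, ← LinearMap.comp_apply,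
    LinearMap.lTensor_comp_rTensor, LinearMap.rTensor_comp_lTensor]

variable (hψ : ∀ a w, ψ (LinearMap.lTensor N (LinearMap.mulLeft k a) w) = ρ a (ψ w))

include hψ

lemma tensorPiEquiv_lTensor_δ (i : ℕ) (z : N ⊗[k] (Fin (R.n i) → A)) :
    tensorPiEquiv ψ _ (LinearMap.lTensor N ((R.δ i).restrictScalars k) z) =
      colMap (ρ : A →+* Module.End k W) (R.X i) (tensorPiEquiv ψ _ z) := by
  induction z with
  | zero => simp only [map_zero]
  | add x y hx hy => simp only [map_add, hx, hy]
  | tmul x c =>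
    funext l
    rw [LinearMap.lTensor_tmul, tensorPiEquiv_tmul, colMap_apply]
    simp only [tensorPiEquiv_tmul, LinearMap.restrictScalars_apply, δ_apply, tmul_sum, map_sum]
    exact Finset.sum_congr rfl fun j _ => hψ (R.X i l j) (x ⊗ₜ c j)

lemma colMap_tensorKer (i : ℕ) (ζ : N ⊗[k] LinearMap.ker (R.δ i)) :
    colMap (ρ : A →+* Module.End k W) (R.X i) (R.tensorKer ψ i ζ) = 0 := by
  refine (R.tensorPiEquiv_lTensor_δ ρ ψ hψ i _).symm.trans ?_
  rw [← LinearMap.comp_apply, ← LinearMap.lTensor_comp]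
  have : (R.δ i).restrictScalars k ∘ₗ R.kerInc k i = 0 :=
    LinearMap.ext fun z => z.2
  rw [this, LinearMap.lTensor_zero, LinearMap.zero_apply, map_zero]

lemma exists_tensorKer_eq {i : ℕ} {b : Fin (R.n i) → W}
    (hb : colMap (ρ : A →+* Module.End k W) (R.X i) b = 0) : ∃ ζ, R.tensorKer ψ i ζ = b := by
  have hex : Function.Exact (R.kerInc k i) ((R.δ i).restrictScalars k) := fun z =>
    ⟨fun hz => ⟨⟨z, hz⟩, rfl⟩, fun ⟨z', hz'⟩ => hz' ▸ z'.2⟩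
  have h := Module.Flat.lTensor_exact N hex
  obtain ⟨z, rfl⟩ := (tensorPiEquiv ψ _).surjective b
  rw [← R.tensorPiEquiv_lTensor_δ ρ ψ hψ, LinearEquiv.map_eq_zero_iff] at hb
  obtain ⟨ζ, hζ⟩ := (h z).1 hb
  exact ⟨ζ, congrArg (tensorPiEquiv ψ _) hζ⟩

lemma tensorKer_mem_coeffBdry_iff (i : ℕ) (ζ : N ⊗[k] LinearMap.ker (R.δ i)) :
    R.tensorKer ψ i ζ ∈ R.coeffBdry ρ i ↔ R.tensorCoh k N i ζ = 0 := by
  cases i with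
  | zero =>
    have h1 : R.tensorKer ψ 0 ζ ∈ R.coeffBdry ρ 0 ↔ ζ = 0 := by
      have hinj : Function.Injective (R.tensorKer ψ 0) := by
        refine (tensorPiEquiv ψ _).injective.comp ?_
        exact Module.Flat.lTensor_preserves_injective_linearMap _ (R.kerInc_injective _)
      exact (Submodule.mem_bot k).trans (map_eq_zero_iff _ hinj)
    have h2 : Function.Injective (R.tensorCoh k N 0) := by
      refine Module.Flat.lTensor_preserves_injective_linearMap _ ?_
      intro x y hxy
      have h3 : R.kerMk k 0 (x - y) = 0 := by rw [map_sub, hxy, sub_self]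
      have h4 := (R.kerMk_eq_zero_iff _).1 h3
      exact sub_eq_zero.1 (Subtype.ext h4)
    rw [h1, map_eq_zero_iff _ h2]
  | succ i =>
    let g : (Fin (R.n i) → A) →ₗ[k] LinearMap.ker (R.δ (i + 1)) :=
      ((R.δ i).codRestrict _ fun c => R.δ_δ i c).restrictScalars k
    have hex : Function.Exact g (R.kerMk k (i + 1)) := fun z => by
      rw [kerMk_eq_zero_iff]
      constructor
      · rintro ⟨c, hc⟩
        exact ⟨c, Subtype.ext hc⟩
      · rintro ⟨c, rfl⟩
        exact ⟨c, rfl⟩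
    have h := lTensor_exact N hex (R.kerMk_surjective _)
    have hg : ∀ z, R.tensorKer ψ (i + 1) (LinearMap.lTensor N g z) =
        colMap (ρ : A →+* Module.End k W) (R.X i) (tensorPiEquiv ψ _ z) := fun z => by
      rw [← R.tensorPiEquiv_lTensor_δ ρ ψ hψ, tensorKer, LinearMap.comp_apply,
        ← LinearMap.comp_apply (LinearMap.lTensor N _), ← LinearMap.lTensor_comp]
      rfl
    have hinj : Function.Injective (R.tensorKer ψ (i + 1)) := by
      refine (tensorPiEquiv ψ _).injective.comp ?_
      exact Module.Flat.lTensor_preserves_injective_linearMap _ (R.kerInc_injective _)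
    refine Iff.trans ?_ (h ζ).symm
    constructor
    · rintro ⟨c, hc⟩
      obtain ⟨z, rfl⟩ := (tensorPiEquiv ψ _).surjective c
      exact ⟨z, hinj ((hg z).trans hc)⟩
    · rintro ⟨z, rfl⟩
      exact ⟨_, (hg z).symm⟩

lemma ExactAt.mem_coeffBdry {i : ℕ} (hR : R.ExactAt i) {b : Fin (R.n i) → W}
    (hb : colMap (ρ : A →+* Module.End k W) (R.X i) b = 0) : b ∈ R.coeffBdry ρ i := by
  obtain ⟨ζ, rfl⟩ := R.exists_tensorKer_eq ρ ψ hψ hb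
  rw [R.tensorKer_mem_coeffBdry_iff ρ ψ hψ]
  induction ζ with
  | zero => rw [map_zero]
  | add x y hx hy =>
    rw [map_add, hx (R.colMap_tensorKer ρ ψ hψ i x), hy (R.colMap_tensorKer ρ ψ hψ i y), add_zero]
  | tmul x z =>
    have h : R.kerMk k i z = 0 := (R.kerMk_eq_zero_iff z).2 (hR z.1 z.2)
    rw [tensorCoh_tmul, h, tmul_zero]

end FreeRes

end TensorCoefficients

/-! ### Actions of tensor products of algebras -/

section TensorRep

open TensorProduct

variable (k : Type*) [Field k] {B C : Type*} [Ring B] [Algebra k B] [Ring C] [Algebra k C]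
  (U V : Type*) [AddCommGroup U] [Module k U] [Module B U] [IsScalarTower k B U]
  [AddCommGroup V] [Module k V] [Module C V] [IsScalarTower k C V]

/-- The action of `B ⊗ C` on the tensor product of a `B`-module and a `C`-module. -/
noncomputable def tensorRep : B ⊗[k] C →ₐ[k] Module.End k (U ⊗[k] V) :=
  (Module.endTensorEndAlgHom (R := k) (S := k) (A := k) (M := U) (N := V)).comp
    (Algebra.TensorProduct.map (Algebra.lsmul k k U) (Algebra.lsmul k k V))

variable {U V}

lemma tensorRep_tmul_tmul (b : B) (c : C) (x : U) (y : V) :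
    tensorRep k U V (b ⊗ₜ c) (x ⊗ₜ y) = (b • x) ⊗ₜ (c • y) := rfl

variable {k}

lemma map_tensorRep {U' V' : Type*} [AddCommGroup U'] [Module k U'] [Module B U']
    [IsScalarTower k B U'] [AddCommGroup V'] [Module k V'] [Module C V'] [IsScalarTower k C V']
    (f : U →ₗ[k] U') (g : V →ₗ[k] V') (hf : ∀ (b : B) x, f (b • x) = b • f x)
    (hg : ∀ (c : C) x, g (c • x) = c • g x) (t : B ⊗[k] C) (w : U ⊗[k] V) :
    TensorProduct.map f g (tensorRep k U V t w) =
      tensorRep k U' V' t (TensorProduct.map f g w) := by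
  induction t with
  | zero => simp only [map_zero, LinearMap.zero_apply]
  | add s t hs ht => simp only [map_add, LinearMap.add_apply, hs, ht]
  | tmul b c =>
    induction w with
    | zero => simp only [map_zero]
    | add x y hx hy => simp only [map_add, hx, hy]
    | tmul x y => simp only [tensorRep_tmul_tmul, map_tmul, hf, hg]

lemma lTensor_tensorRep {V' : Type*} [AddCommGroup V'] [Module k V'] [Module C V']
    [IsScalarTower k C V'] (g : V →ₗ[k] V') (hg : ∀ (c : C) x, g (c • x) = c • g x)
    (t : B ⊗[k] C) (w : U ⊗[k] V) :
    LinearMap.lTensor U g (tensorRep k U V t w) =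
      tensorRep k U V' t (LinearMap.lTensor U g w) :=
  map_tensorRep LinearMap.id g (fun _ _ => rfl) hg t w

lemma rTensor_tensorRep {U' : Type*} [AddCommGroup U'] [Module k U'] [Module B U']
    [IsScalarTower k B U'] (f : U →ₗ[k] U') (hf : ∀ (b : B) x, f (b • x) = b • f x)
    (t : B ⊗[k] C) (w : U ⊗[k] V) :
    LinearMap.rTensor V f (tensorRep k U V t w) =
      tensorRep k U' V t (LinearMap.rTensor V f w) :=
  map_tensorRep f LinearMap.id hf (fun _ _ => rfl) t w

/-- The map `n ⊗ a ↦ a • inc n` to a representation. -/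
noncomputable def actOn {A N W : Type*} [Ring A] [Algebra k A] [AddCommGroup N] [Module k N]
    [AddCommGroup W] [Module k W] (ρ : A →ₐ[k] Module.End k W) (inc : N →ₗ[k] W) :
    N ⊗[k] A →ₗ[k] W :=
  TensorProduct.lift (LinearMap.flip (LinearMap.lcomp k W inc ∘ₗ ρ.toLinearMap))

lemma actOn_tmul {A N W : Type*} [Ring A] [Algebra k A] [AddCommGroup N] [Module k N]
    [AddCommGroup W] [Module k W] (ρ : A →ₐ[k] Module.End k W) (inc : N →ₗ[k] W) (n : N) (a : A) :
    actOn ρ inc (n ⊗ₜ a) = ρ a (inc n) := rfl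

lemma actOn_lTensor_mulLeft {A N W : Type*} [Ring A] [Algebra k A] [AddCommGroup N] [Module k N]
    [AddCommGroup W] [Module k W] (ρ : A →ₐ[k] Module.End k W) (inc : N →ₗ[k] W) (a : A)
    (w : N ⊗[k] A) :
    actOn ρ inc (LinearMap.lTensor N (LinearMap.mulLeft k a) w) = ρ a (actOn ρ inc w) := by
  induction w with
  | zero => simp only [map_zero]
  | add x y hx hy => simp only [map_add, hx, hy]
  | tmul n x =>
    rw [LinearMap.lTensor_tmul, LinearMap.mulLeft_apply, actOn_tmul, actOn_tmul, map_mul,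
      Module.End.mul_apply]

end TensorRep

/-! ### The diagonal and twisted actions -/

section Diagonal

open TensorProduct MulOpposite

variable (k : Type u) [Field k] {H : Type u} [Ring H] [HopfAlgebra k H]

/-- The comultiplication of the opposite algebra. -/
noncomputable def comulOp : Hᵐᵒᵖ →ₐ[k] Hᵐᵒᵖ ⊗[k] Hᵐᵒᵖ :=
  (Algebra.TensorProduct.opAlgEquiv k k H H).symm.toAlgHom.comp
    (AlgHom.op (Bialgebra.comulAlgHom k H))

lemma comulOp_op {h : H} {ι : Type*} (r : Coalgebra.Repr k h ι) :
    comulOp k (op h) = ∑ i ∈ r.index, op (r.left i) ⊗ₜ[k] op (r.right i) := by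
  have : comulOp k (op h) = (Algebra.TensorProduct.opAlgEquiv k k H H).symm
    (op (Coalgebra.comul (R := k) h)) := rfl
  rw [this, ← r.eq, Finset.op_sum, map_sum]
  rfl

/-- The algebra map `h ↦ S h₁ ⊗ h₂`. -/
noncomputable def comulTwist : H →ₐ[k] Hᵐᵒᵖ ⊗[k] Hᵐᵒᵖᵐᵒᵖ :=
  (Algebra.TensorProduct.map (HopfAlgebra.antipodeAlgHomOp k H)
    (AlgEquiv.opOp k H).toAlgHom).comp (Bialgebra.comulAlgHom k H)

lemma comulTwist_apply {h : H} {ι : Type*} (r : Coalgebra.Repr k h ι) :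
    comulTwist k h =
      ∑ i ∈ r.index, op (HopfAlgebra.antipode k (r.left i)) ⊗ₜ[k] op (op (r.right i)) := by
  have : comulTwist k h = Algebra.TensorProduct.map (HopfAlgebra.antipodeAlgHomOp k H)
    (AlgEquiv.opOp k H).toAlgHom (Coalgebra.comul (R := k) h) := rfl
  rw [this, ← r.eq, map_sum]
  rfl

lemma sum_map_comul_tmul (f : H ⊗[k] H →ₗ[k] H)
    (hf : ∀ h, f (Coalgebra.comul (R := k) h) = algebraMap k H (Coalgebra.counit h))
    {h : H} {ι : Type*} (r : Coalgebra.Repr k h ι) :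
    ∑ i ∈ r.index, LinearMap.rTensor H (f ∘ₗ TensorProduct.mk k H H (r.left i))
      (Coalgebra.comul (R := k) (r.right i)) = 1 ⊗ₜ h := by
  have h1 := congrArg (LinearMap.rTensor H f ∘ₗ (TensorProduct.assoc k H H H).symm.toLinearMap)
    (Coalgebra.sum_tmul_tmul_eq r (fun i => Coalgebra.Repr.arbitrary k (r.left i))
      (fun i => Coalgebra.Repr.arbitrary k (r.right i)))
  simp only [map_sum, LinearMap.comp_apply, LinearEquiv.coe_coe, assoc_symm_tmul,
    LinearMap.rTensor_tmul] at h1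
  have h2 : ∀ i ∈ r.index, LinearMap.rTensor H (f ∘ₗ TensorProduct.mk k H H (r.left i))
      (Coalgebra.comul (R := k) (r.right i)) =
      ∑ j ∈ (Coalgebra.Repr.arbitrary k (r.right i)).index,
        f (r.left i ⊗ₜ (Coalgebra.Repr.arbitrary k (r.right i)).left j) ⊗ₜ
          (Coalgebra.Repr.arbitrary k (r.right i)).right j := fun i _ => by
    conv_lhs => rw [← (Coalgebra.Repr.arbitrary k (r.right i)).eq, map_sum]
    rfl
  rw [Finset.sum_congr rfl h2, ← h1]
  simp only [← sum_tmul, ← map_sum, Coalgebra.Repr.eq, hf, Algebra.algebraMap_eq_smul_one,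
    smul_tmul]
  rw [← tmul_sum, Coalgebra.sum_counit_smul]

lemma sum_antipode_tmul_one_mul_comul {h : H} {ι : Type*} (r : Coalgebra.Repr k h ι) :
    ∑ i ∈ r.index, (HopfAlgebra.antipode k (r.left i) ⊗ₜ[k] (1 : H)) *
      Coalgebra.comul (R := k) (r.right i) = 1 ⊗ₜ h := by
  rw [← sum_map_comul_tmul k (LinearMap.mul' k H ∘ₗ (HopfAlgebra.antipode k).rTensor H)
    HopfAlgebra.mul_antipode_rTensor_comul_apply r]
  refine Finset.sum_congr rfl fun i _ => ?_
  generalize Coalgebra.comul (R := k) (r.right i) = t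
  induction t with
  | zero => simp only [map_zero, mul_zero]
  | add x y hx hy => simp only [map_add, mul_add, hx, hy]
  | tmul a b => simp

lemma sum_tmul_one_mul_antipode {h : H} {ι : Type*} (r : Coalgebra.Repr k h ι) :
    ∑ i ∈ r.index, (r.left i ⊗ₜ[k] (1 : H)) *
      LinearMap.rTensor H (HopfAlgebra.antipode k) (Coalgebra.comul (R := k) (r.right i)) =
        1 ⊗ₜ h := by
  rw [← sum_map_comul_tmul k (LinearMap.mul' k H ∘ₗ (HopfAlgebra.antipode k).lTensor H)
    HopfAlgebra.mul_antipode_lTensor_comul_apply r]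
  refine Finset.sum_congr rfl fun i _ => ?_
  generalize Coalgebra.comul (R := k) (r.right i) = t
  induction t with
  | zero => simp only [map_zero, mul_zero]
  | add x y hx hy => simp only [map_add, mul_add, hx, hy]
  | tmul a b => simp

variable {k} (U V : Type*) [AddCommGroup U] [Module k U] [Module Hᵐᵒᵖ U] [IsScalarTower k Hᵐᵒᵖ U]
  [AddCommGroup V] [Module k V]

/-- The diagonal action on the tensor product of two right modules. -/
noncomputable def diagAct [Module Hᵐᵒᵖ V] [IsScalarTower k Hᵐᵒᵖ V] :
    Hᵐᵒᵖ →ₐ[k] Module.End k (U ⊗[k] V) :=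
  (tensorRep k U V).comp (comulOp k)

lemma diagAct_tmul [Module Hᵐᵒᵖ V] [IsScalarTower k Hᵐᵒᵖ V] {h : H} {ι : Type*} (r : Coalgebra.Repr k h ι)
    (x : U) (y : V) : diagAct (k := k) U V (op h) (x ⊗ₜ y) =
      ∑ i ∈ r.index, (op (r.left i) • x) ⊗ₜ (op (r.right i) • y) := by
  rw [diagAct, AlgHom.comp_apply, comulOp_op k r, map_sum, LinearMap.sum_apply]
  rfl

/-- The action `h ↦ S h₁ ⊗ h₂` on the tensor product of a right module and a left module. -/
noncomputable def twistAct [Module Hᵐᵒᵖᵐᵒᵖ V] [IsScalarTower k Hᵐᵒᵖᵐᵒᵖ V] :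
    H →ₐ[k] Module.End k (U ⊗[k] V) :=
  (tensorRep k U V).comp (comulTwist k)

lemma twistAct_tmul [Module Hᵐᵒᵖᵐᵒᵖ V] [IsScalarTower k Hᵐᵒᵖᵐᵒᵖ V] {h : H} {ι : Type*}
    (r : Coalgebra.Repr k h ι) (x : U) (y : V) : twistAct (k := k) U V h (x ⊗ₜ y) =
      ∑ i ∈ r.index, (op (HopfAlgebra.antipode k (r.left i)) • x) ⊗ₜ (op (op (r.right i)) • y) := by
  rw [twistAct, AlgHom.comp_apply, comulTwist_apply k r, map_sum, LinearMap.sum_apply]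
  rfl

/-- The orbit map `x ↦ n x` of an element of a right module. -/
noncomputable def orbitMap {U : Type*} [AddCommGroup U] [Module k U] [Module Hᵐᵒᵖ U]
    [IsScalarTower k Hᵐᵒᵖ U] (n : U) : H →ₗ[k] U :=
  (Algebra.lsmul k k U).toLinearMap.flip n ∘ₗ (opLinearEquiv k).toLinearMap

variable {U}

lemma orbitMap_apply (n : U) (h : H) : orbitMap (k := k) n h = op h • n := rfl

lemma rTensor_orbitMap_smul (n : U) (s : H) (t : H ⊗[k] H) :
    LinearMap.rTensor H (orbitMap (k := k) (op s • n)) t =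
      LinearMap.rTensor H (orbitMap n) ((s ⊗ₜ 1) * t) := by
  induction t with
  | zero => simp only [map_zero, mul_zero]
  | add x y hx hy => simp only [map_add, hx, hy, mul_add]
  | tmul a b =>
    rw [Algebra.TensorProduct.tmul_mul_tmul, LinearMap.rTensor_tmul, LinearMap.rTensor_tmul,
      orbitMap_apply, orbitMap_apply, one_mul, op_mul, mul_smul]

variable (k H U)

/-- The map `n ⊗ x ↦ n x₁ ⊗ x₂`. -/
noncomputable def untwistHom : U ⊗[k] Hᵐᵒᵖ →ₗ[k] U ⊗[k] H :=
  actOn (diagAct U H) ((TensorProduct.mk k U H).flip 1)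

/-- The map `n ⊗ x ↦ n (S x₁) ⊗ x₂`. -/
noncomputable def twistHom : U ⊗[k] H →ₗ[k] U ⊗[k] Hᵐᵒᵖ :=
  actOn (twistAct U Hᵐᵒᵖ) ((TensorProduct.mk k U Hᵐᵒᵖ).flip 1)

variable {k H U}

lemma untwistHom_tmul (n : U) (h : H) :
    untwistHom k H U (n ⊗ₜ op h) =
      LinearMap.rTensor H (orbitMap n) (Coalgebra.comul (R := k) h) := by
  have : untwistHom k H U (n ⊗ₜ op h) = diagAct U H (op h) (n ⊗ₜ 1) := rfl
  rw [this, diagAct_tmul U H (Coalgebra.Repr.arbitrary k h)]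
  conv_rhs => rw [← (Coalgebra.Repr.arbitrary k h).eq]
  simp only [map_sum, LinearMap.rTensor_tmul, orbitMap_apply, op_smul_eq_mul, one_mul]

lemma twistHom_tmul {h : H} {ι : Type*} (r : Coalgebra.Repr k h ι) (n : U) :
    twistHom k H U (n ⊗ₜ h) =
      ∑ i ∈ r.index, (op (HopfAlgebra.antipode k (r.left i)) • n) ⊗ₜ op (r.right i) := by
  have : twistHom k H U (n ⊗ₜ h) = twistAct U Hᵐᵒᵖ h (n ⊗ₜ 1) := rfl
  rw [this, twistAct_tmul U Hᵐᵒᵖ r]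
  simp only [op_smul_eq_mul, one_mul]

lemma untwistHom_twistHom (w : U ⊗[k] H) : untwistHom k H U (twistHom k H U w) = w := by
  induction w with
  | zero => simp only [map_zero]
  | add x y hx hy => simp only [map_add, hx, hy]
  | tmul n h =>
    rw [twistHom_tmul (Coalgebra.Repr.arbitrary k h), map_sum]
    simp only [untwistHom_tmul, rTensor_orbitMap_smul]
    rw [← map_sum, sum_antipode_tmul_one_mul_comul, LinearMap.rTensor_tmul, orbitMap_apply, op_one,
      one_smul]

lemma twistHom_untwistHom (w : U ⊗[k] Hᵐᵒᵖ) : twistHom k H U (untwistHom k H U w) = w := by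
  induction w with
  | zero => simp only [map_zero]
  | add x y hx hy => simp only [map_add, hx, hy]
  | tmul n h =>
    obtain ⟨h, rfl⟩ := op_surjective h
    have key : ∀ t : H ⊗[k] H, twistHom k H U (LinearMap.rTensor H (orbitMap n) t) =
        TensorProduct.map (orbitMap n) (opLinearEquiv k).toLinearMap
          (TensorProduct.lift ((LinearMap.mul k (H ⊗[k] H)).compl₁₂
            ((TensorProduct.mk k H H).flip 1)
            ((HopfAlgebra.antipode k).rTensor H ∘ₗ Coalgebra.comul)) t) := fun t => by
      induction t with
      | zero => simp only [map_zero]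
      | add x y hx hy => simp only [map_add, hx, hy]
      | tmul a b =>
        rw [LinearMap.rTensor_tmul, twistHom_tmul (Coalgebra.Repr.arbitrary k b)]
        simp only [lift.tmul, LinearMap.compl₁₂_apply, LinearMap.comp_apply, LinearMap.flip_apply,
          mk_apply, LinearMap.mul_apply']
        conv_rhs => rw [← (Coalgebra.Repr.arbitrary k b).eq]
        simp only [map_sum, Finset.mul_sum, LinearMap.rTensor_tmul,
          Algebra.TensorProduct.tmul_mul_tmul, map_tmul, orbitMap_apply, op_mul, mul_smul, one_mul]
        rfl
    rw [untwistHom_tmul, key]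
    conv_lhs => rw [← (Coalgebra.Repr.arbitrary k h).eq]
    have h2 := sum_tmul_one_mul_antipode k (Coalgebra.Repr.arbitrary k h)
    rw [map_sum]
    refine (congrArg _ h2).trans ?_
    rw [map_tmul, orbitMap_apply, op_one, one_smul]
    rfl

/-- The isomorphism `n ⊗ x ↦ n x₁ ⊗ x₂`. -/
noncomputable def untwist (k : Type u) [Field k] (H : Type u) [Ring H] [HopfAlgebra k H]
    (U : Type*) [AddCommGroup U] [Module k U] [Module Hᵐᵒᵖ U] [IsScalarTower k Hᵐᵒᵖ U] :
    U ⊗[k] Hᵐᵒᵖ ≃ₗ[k] U ⊗[k] H :=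
  LinearEquiv.ofLinearMap (untwistHom k H U) (twistHom k H U)
    (LinearMap.ext untwistHom_twistHom) (LinearMap.ext twistHom_untwistHom)

lemma untwist_lTensor_mulLeft (a : Hᵐᵒᵖ) (w : U ⊗[k] Hᵐᵒᵖ) :
    untwist k H U (LinearMap.lTensor U (LinearMap.mulLeft k a) w) =
      diagAct U H a (untwist k H U w) :=
  actOn_lTensor_mulLeft _ _ a w

lemma untwist_twistAct (h : H) (w : U ⊗[k] Hᵐᵒᵖ) :
    untwist k H U (twistAct U Hᵐᵒᵖ h w) =
      LinearMap.lTensor U (LinearMap.mulLeft k h) (untwist k H U w) := by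
  obtain ⟨w, rfl⟩ := (untwist k H U).symm.surjective w
  rw [LinearEquiv.apply_symm_apply, ← LinearEquiv.eq_symm_apply]
  exact (actOn_lTensor_mulLeft (twistAct U Hᵐᵒᵖ) _ h w).symm

end Diagonal

/-! ### The double complex of two resolutions -/

section TensorDoubleComplex

variable {k : Type*} [Field k] {A : Type u} {B : Type u'} [Ring A] [Ring B] [Algebra k A]
  [Algebra k B] {W : Type*} [AddCommGroup W] [Module k W] {T : Type*} [AddCommGroup T] [Module A T]
  {M : Type*} [AddCommGroup M] [Module B M] (F : FreeRes A T) (R : FreeRes B M)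
  (ρ : A →ₐ[k] Module.End k W) (σ : B →ₐ[k] Module.End k W)

/-- The differential in the direction of the first resolution. -/
noncomputable def fstDiff (p q : ℕ) : (Fin (F.n p) → Fin (R.n q) → W) →+
    (Fin (F.n (p + 1)) → Fin (R.n q) → W) where
  toFun a l j := colMap (ρ : A →+* Module.End k W) (F.X p) (fun i => a i j) l
  map_zero' := funext fun l => funext fun _ => congrFun (map_zero (colMap _ (F.X p))) l
  map_add' a b := funext fun l => funext fun j =>
    congrFun (map_add (colMap (ρ : A →+* Module.End k W) (F.X p)) (fun i => a i j)
      fun i => b i j) l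

/-- The differential in the direction of the second resolution. -/
noncomputable def sndDiff (p q : ℕ) : (Fin (F.n p) → Fin (R.n q) → W) →+
    (Fin (F.n p) → Fin (R.n (q + 1)) → W) where
  toFun a i := colMap (σ : B →+* Module.End k W) (R.X q) (a i)
  map_zero' := funext fun _ => map_zero (colMap _ (R.X q))
  map_add' a b := funext fun i => map_add (colMap (σ : B →+* Module.End k W) (R.X q)) (a i) (b i)

omit [Algebra k B] in
lemma fstDiff_apply (p q : ℕ) (a : Fin (F.n p) → Fin (R.n q) → W) (l j) :
    fstDiff F R ρ p q a l j = ∑ i, ρ (F.X p l i) (a i j) :=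
  colMap_apply _ _ _ _

omit [Algebra k A] in
lemma sndDiff_apply (p q : ℕ) (a : Fin (F.n p) → Fin (R.n q) → W) (i l) :
    sndDiff F R σ p q a i l = ∑ j, σ (R.X q l j) (a i j) :=
  colMap_apply _ _ _ _

lemma isDoubleComplex (h : ∀ a b w, ρ a (σ b w) = σ b (ρ a w)) :
    IsDoubleComplex (fstDiff F R ρ) (sndDiff F R σ) where
  comm p q a := by
    funext l j
    simp only [fstDiff_apply, sndDiff_apply, map_sum, h]
    exact Finset.sum_comm
  dp_dp p q a := by
    funext l j
    have := colMap_colMap (ρ : A →+* Module.End k W) (F.X (p + 1)) (F.X p) fun i => a i j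
    rw [F.X_mul_X, colMap_zero] at this
    exact congrFun this l
  dq_dq p q a := by
    funext i
    have := colMap_colMap (σ : B →+* Module.End k W) (R.X (q + 1)) (R.X q) (a i)
    rwa [R.X_mul_X, colMap_zero] at this

omit [Algebra k B] in
lemma mem_pBdry_fstDiff_iff (p q : ℕ) (a : Fin (F.n p) → Fin (R.n q) → W) :
    a ∈ pBdry (fstDiff F R ρ) p q ↔ ∀ j, (fun i => a i j) ∈ F.coeffBdry ρ p := by
  cases p with
  | zero =>
    refine AddSubgroup.mem_bot.trans ⟨?_, fun h => ?_⟩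
    · rintro rfl j
      exact (Submodule.mem_bot k).2 rfl
    · funext i j
      exact congrFun ((Submodule.mem_bot k).1 (h j)) i
  | succ p =>
    constructor
    · rintro ⟨c, rfl⟩ j
      exact ⟨fun i => c i j, rfl⟩
    · intro h
      choose c hc using h
      exact ⟨fun i j => c j i, funext fun l => funext fun j => congrFun (hc j) l⟩

omit [Algebra k A] in
lemma mem_qBdry_sndDiff_iff (p q : ℕ) (a : Fin (F.n p) → Fin (R.n q) → W) :
    a ∈ qBdry (sndDiff F R σ) p q ↔ ∀ i, a i ∈ R.coeffBdry σ q := by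
  cases q with
  | zero =>
    refine AddSubgroup.mem_bot.trans ⟨?_, fun h => ?_⟩
    · rintro rfl j
      exact (Submodule.mem_bot k).2 rfl
    · funext i
      exact (Submodule.mem_bot k).1 (h i)
  | succ q =>
    constructor
    · rintro ⟨c, rfl⟩ j
      exact ⟨c j, rfl⟩
    · intro h
      choose c hc using h
      exact ⟨c, funext hc⟩

end TensorDoubleComplex

/-! ### Linked homomorphisms and invariants -/

section Linked

open TensorProduct MulOpposite

variable {k : Type u} [Field k] {H : Type u} [Ring H] [HopfAlgebra k H]

/-- The left action on the second factor. -/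
noncomputable def leftRep (k H : Type*) [Field k] [Ring H] [Algebra k H] (N : Type*)
    [AddCommGroup N] [Module k N] : H →ₐ[k] Module.End k (N ⊗[k] H) :=
  (Module.End.lTensorAlgHom k H N).comp (Algebra.lmul k H)

lemma leftRep_apply (N : Type*) [AddCommGroup N] [Module k N] (h : H) (w : N ⊗[k] H) :
    leftRep k H N h w = LinearMap.lTensor N (LinearMap.mulLeft k h) w := rfl

lemma leftRep_diagAct (N : Type*) [AddCommGroup N] [Module k N] [Module Hᵐᵒᵖ N]
    [IsScalarTower k Hᵐᵒᵖ N] (h : H) (g : Hᵐᵒᵖ) (w : N ⊗[k] H) :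
    leftRep k H N h (diagAct N H g w) = diagAct N H g (leftRep k H N h w) :=
  lTensor_tensorRep (LinearMap.mulLeft k h) (fun c x => (mul_assoc h x c.unop).symm) _ w


lemma untwist_rTensor {N N' : Type*} [AddCommGroup N] [Module k N] [Module Hᵐᵒᵖ N]
    [IsScalarTower k Hᵐᵒᵖ N] [AddCommGroup N'] [Module k N'] [Module Hᵐᵒᵖ N']
    [IsScalarTower k Hᵐᵒᵖ N'] (g : N →ₗ[k] N') (hg : ∀ (h : Hᵐᵒᵖ) x, g (h • x) = h • g x)
    (w : N ⊗[k] Hᵐᵒᵖ) :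
    untwist k H N' (LinearMap.rTensor Hᵐᵒᵖ g w) = LinearMap.rTensor H g (untwist k H N w) := by
  induction w with
  | zero => simp only [map_zero]
  | add x y hx hy => simp only [map_add, hx, hy]
  | tmul n h => exact (rTensor_tensorRep g hg (comulOp k h) (n ⊗ₜ (1 : H))).symm

/-- The augmentations of the basis vectors in a resolution of the trivial module. -/
noncomputable def FreeRes.augCoeff (F : FreeRes H (TrivialCounitModule k H)) (i : Fin (F.n 0)) : k :=
  F.ε (Pi.single i 1)

variable {N : Type*} [AddCommGroup N] [Module k N] [Module Hᵐᵒᵖ N] [IsScalarTower k Hᵐᵒᵖ N]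
  {M : Type*} [AddCommGroup M] [Module Hᵐᵒᵖ M]
  (F : FreeRes H (TrivialCounitModule k H)) (R : FreeRes Hᵐᵒᵖ M) {d : ℕ}

/-- An invariant `τ` is linked to a homomorphism `f` if both are the ends of a staircase in the
double complex of the two resolutions. -/
def Linked (f : M → N ⊗[k] F.coh d) (τ : N ⊗[k] R.coh d) : Prop :=
  ∃ (a : ∀ p q, Fin (F.n p) → Fin (R.n q) → N ⊗[k] H)
    (ζ : Fin (R.n 0) → N ⊗[k] LinearMap.ker (F.δ d))
    (η : Fin (F.n 0) → N ⊗[k] LinearMap.ker (R.δ d)),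
    IsStaircase (fstDiff F R (leftRep k H N)) (sndDiff F R (diagAct N H)) d a ∧
    (∀ i j, a d 0 i j = F.tensorKer (LinearEquiv.refl k (N ⊗[k] H)) d (ζ j) i) ∧
    (∀ i, a 0 d i = R.tensorKer (untwist k H N) d (η i)) ∧
    (∀ j, F.tensorCoh k N d (ζ j) = f (R.ε (Pi.single j 1))) ∧
    ∀ i, R.tensorCoh k N d (η i) = F.augCoeff i • τ

variable {F R}

lemma isDoubleComplex_linked :
    IsDoubleComplex (fstDiff F R (leftRep k H N)) (sndDiff F R (diagAct N H)) :=
  isDoubleComplex F R _ _ (leftRep_diagAct N)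

lemma Linked.sub {f f' : M → N ⊗[k] F.coh d} {τ τ' : N ⊗[k] R.coh d} (h : Linked F R f τ)
    (h' : Linked F R f' τ') : Linked F R (f - f') (τ - τ') := by
  obtain ⟨a, ζ, η, h1, h2, h3, h4, h5⟩ := h
  obtain ⟨a', ζ', η', h1', h2', h3', h4', h5'⟩ := h'
  refine ⟨fun p q => a p q - a' p q, ζ - ζ', η - η', fun p q h => ?_, fun i j => ?_, fun i => ?_,
    fun j => ?_, fun i => ?_⟩
  · rw [map_sub, map_sub, h1 p q h, h1' p q h]
  · exact (congrArg₂ (· - ·) (h2 i j) (h2' i j)).trans 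
      (congrFun (map_sub (F.tensorKer (LinearEquiv.refl k (N ⊗[k] H)) d) (ζ j) (ζ' j)).symm i)
  · exact (congrArg₂ (· - ·) (h3 i) (h3' i)).trans (map_sub _ (η i) (η' i)).symm
  · rw [Pi.sub_apply, map_sub, h4, h4', Pi.sub_apply]
  · rw [Pi.sub_apply, map_sub, h5, h5', smul_sub]

lemma Linked.map {N' : Type*} [AddCommGroup N'] [Module k N'] [Module Hᵐᵒᵖ N']
    [IsScalarTower k Hᵐᵒᵖ N'] {f : M → N ⊗[k] F.coh d} {τ : N ⊗[k] R.coh d} (h : Linked F R f τ)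
    (g : N →ₗ[k] N') (hg : ∀ (h : Hᵐᵒᵖ) x, g (h • x) = h • g x) :
    Linked F R (fun m => LinearMap.rTensor (F.coh d) g (f m)) (LinearMap.rTensor (R.coh d) g τ) := by
  obtain ⟨a, ζ, η, h1, h2, h3, h4, h5⟩ := h
  have hl : ∀ (h : H) (w : N ⊗[k] H), LinearMap.rTensor H g (leftRep k H N h w) =
      leftRep k H N' h (LinearMap.rTensor H g w) := fun h w => by
    rw [leftRep_apply, leftRep_apply, ← LinearMap.comp_apply, ← LinearMap.comp_apply,
      LinearMap.rTensor_comp_lTensor, LinearMap.lTensor_comp_rTensor]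
  have hr : ∀ (h : Hᵐᵒᵖ) (w : N ⊗[k] H), LinearMap.rTensor H g (diagAct N H h w) =
      diagAct N' H h (LinearMap.rTensor H g w) := fun h w => rTensor_tensorRep g hg _ w
  refine ⟨fun p q i j => LinearMap.rTensor H g (a p q i j),
    fun j => LinearMap.rTensor _ g (ζ j), fun i => LinearMap.rTensor _ g (η i),
    fun p q h => ?_, fun i j => ?_, fun i => ?_, fun j => ?_, fun i => ?_⟩
  · funext i j
    have := congrArg (LinearMap.rTensor H g) (congrFun (congrFun (h1 p q h) i) j)
    simp only [fstDiff_apply, sndDiff_apply, map_sum, hl, hr] at this ⊢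
    exact this
  · exact (congrArg _ (h2 i j)).trans (F.tensorKer_rTensor (LinearEquiv.refl k (N ⊗[k] H))
      (LinearEquiv.refl k (N' ⊗[k] H)) g _ (fun _ => rfl) d (ζ j) i).symm
  · funext j
    exact (congrArg _ (congrFun (h3 i) j)).trans (R.tensorKer_rTensor (untwist k H N)
      (untwist k H N') g _ (untwist_rTensor g hg) d (η i) j).symm
  · exact (F.tensorCoh_rTensor g d (ζ j)).trans (congrArg _ (h4 j))
  · exact (R.tensorCoh_rTensor g d (η i)).trans ((congrArg _ (h5 i)).trans (map_smul _ _ _))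

lemma coeffBdry_sndDiff_of_exactAt (hR : ∀ q < d, R.ExactAt q) (p q : ℕ) (hq : q < d)
    (a : Fin (F.n p) → Fin (R.n q) → N ⊗[k] H) (ha : sndDiff F R (diagAct N H) p q a = 0) :
    a ∈ qBdry (sndDiff F R (diagAct N H)) p q :=
  (mem_qBdry_sndDiff_iff F R _ p q a).2 fun i =>
    FreeRes.ExactAt.mem_coeffBdry R _ _ untwist_lTensor_mulLeft (hR q hq) (congrFun ha i)

omit [Module Hᵐᵒᵖ N] [IsScalarTower k Hᵐᵒᵖ N] in
lemma coeffBdry_fstDiff_of_exactAt (hF : ∀ p < d, F.ExactAt p) (p q : ℕ) (hp : p < d)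
    (a : Fin (F.n p) → Fin (R.n q) → N ⊗[k] H) (ha : fstDiff F R (leftRep k H N) p q a = 0) :
    a ∈ pBdry (fstDiff F R (leftRep k H N)) p q :=
  (mem_pBdry_fstDiff_iff F R _ p q a).2 fun j =>
    FreeRes.ExactAt.mem_coeffBdry F _ (LinearEquiv.refl k (N ⊗[k] H)) (fun _ _ => rfl) (hF p hp)
      (funext fun l => congrFun (congrFun ha l) j)

/-- A homomorphism linked to zero vanishes. -/
lemma Linked.eq_zero (hR : ∀ q < d, R.ExactAt q) {f : M → N ⊗[k] F.coh d}
    (hf : ∀ (x y : M), f (x + y) = f x + f y)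
    (hf' : ∀ (h : Hᵐᵒᵖ) x, f (h • x) = diagAct N (F.coh d) h (f x))
    (h : Linked F R f 0) : f = 0 := by
  obtain ⟨a, ζ, η, h1, h2, h3, h4, h5⟩ := h
  have h0 : a 0 d ∈ qBdry (sndDiff F R (diagAct N H)) 0 d := by
    refine (mem_qBdry_sndDiff_iff F R _ 0 d _).2 fun i => ?_
    rw [h3]
    exact (R.tensorKer_mem_coeffBdry_iff _ _ untwist_lTensor_mulLeft d _).2
      ((h5 i).trans (smul_zero _))
  have h6 := isDoubleComplex_linked.mem_pBdry_of_staircase (coeffBdry_sndDiff_of_exactAt hR) h1 h0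
  have h7 : ∀ j, f (R.ε (Pi.single j 1)) = 0 := fun j => by
    rw [← h4, ← F.tensorKer_mem_coeffBdry_iff (leftRep k H N) (LinearEquiv.refl k (N ⊗[k] H))
      (fun _ _ => rfl)]
    have := (mem_pBdry_fstDiff_iff F R _ d 0 _).1 h6 j
    simp only [h2] at this
    exact this
  let f' : M →+ N ⊗[k] F.coh d := AddMonoidHom.mk' f hf
  funext m
  obtain ⟨x, rfl⟩ := R.surj m
  have h8 : f' (R.ε x) = 0 := by
    rw [← Finset.univ_sum_single x, map_sum, map_sum]
    refine Finset.sum_eq_zero fun j _ => ?_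
    have h : Pi.single j (x j) = x j • (Pi.single j 1 : Fin (R.n 0) → Hᵐᵒᵖ) := by
      rw [← Pi.single_smul, smul_eq_mul, mul_one]
    rw [h, map_smul]
    refine (hf' _ _).trans ?_
    rw [h7, map_zero]
  exact h8

lemma tensorCoh_diagAct (h : Hᵐᵒᵖ) (ζ : N ⊗[k] LinearMap.ker (F.δ d)) :
    F.tensorCoh k N d (diagAct N _ h ζ) = diagAct N (F.coh d) h (F.tensorCoh k N d ζ) :=
  lTensor_tensorRep (F.kerMk k d) (fun c x => map_smul (F.bdryZ d).mkQ c x) _ ζ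

lemma tensorKer_diagAct (h : Hᵐᵒᵖ) (ζ : N ⊗[k] LinearMap.ker (F.δ d)) (i : Fin (F.n d)) :
    F.tensorKer (LinearEquiv.refl k (N ⊗[k] H)) d (diagAct N _ h ζ) i =
      diagAct N H h (F.tensorKer (LinearEquiv.refl k (N ⊗[k] H)) d ζ i) := by
  have key : ∀ ζ, F.tensorKer (LinearEquiv.refl k (N ⊗[k] H)) d ζ i =
      LinearMap.lTensor N (LinearMap.proj i ∘ₗ F.kerInc k d) ζ := fun ζ => by
    induction ζ with
    | zero => simp only [map_zero, Pi.zero_apply]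
    | add x y hx hy => simp only [map_add, Pi.add_apply, hx, hy]
    | tmul n z => rfl
  rw [key, key]
  exact lTensor_tensorRep _ (fun c x => rfl) _ ζ

lemma tensorCoh_twistAct (h : H) (ζ : N ⊗[k] LinearMap.ker (R.δ d)) :
    R.tensorCoh k N d (twistAct N _ h ζ) = twistAct N (R.coh d) h (R.tensorCoh k N d ζ) :=
  lTensor_tensorRep (R.kerMk k d) (fun c x => map_smul (R.bdryZ d).mkQ c x) _ ζ

lemma tensorKer_twistAct (h : H) (ζ : N ⊗[k] LinearMap.ker (R.δ d)) (j : Fin (R.n d)) :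
    R.tensorKer (untwist k H N) d (twistAct N _ h ζ) j =
      leftRep k H N h (R.tensorKer (untwist k H N) d ζ j) := by
  have key : ∀ ζ, R.tensorKer (untwist k H N) d ζ j =
      untwist k H N (LinearMap.lTensor N (LinearMap.proj j ∘ₗ R.kerInc k d) ζ) := fun ζ => by
    induction ζ with
    | zero => simp only [map_zero, Pi.zero_apply]
    | add x y hx hy => simp only [map_add, Pi.add_apply, hx, hy]
    | tmul n z => rfl
  rw [key, key, leftRep_apply, ← untwist_twistAct]
  exact congrArg _ (lTensor_tensorRep _ (fun c x => rfl) _ ζ)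

/-- Every homomorphism is linked to an invariant. -/
theorem exists_linked (hF : ∀ p < d, F.ExactAt p) (f : M →+ N ⊗[k] F.coh d)
    (hf : ∀ (h : Hᵐᵒᵖ) x, f (h • x) = diagAct N (F.coh d) h (f x)) :
    ∃ τ : N ⊗[k] R.coh d, Linked F R f τ ∧
      ∀ h : H, twistAct N (R.coh d) h τ = Coalgebra.counit (R := k) h • τ := by
  choose ζ hζ using fun j => F.tensorCoh_surjective (k := k) (N := N) d (f (R.ε (Pi.single j 1)))
  let s : Fin (F.n d) → Fin (R.n 0) → N ⊗[k] H := fun i j =>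
    F.tensorKer (LinearEquiv.refl k (N ⊗[k] H)) d (ζ j) i
  have hs : fstDiff F R (leftRep k H N) d 0 s = 0 := by
    funext l j
    exact congrFun (F.colMap_tensorKer (leftRep k H N) (LinearEquiv.refl k (N ⊗[k] H))
      (fun _ _ => rfl) d (ζ j)) l
  have hs' : sndDiff F R (diagAct N H) d 0 s ∈ pBdry (fstDiff F R (leftRep k H N)) d 1 := by
    refine (mem_pBdry_fstDiff_iff F R _ d 1 _).2 fun l => ?_
    have h1 : (fun i => sndDiff F R (diagAct N H) d 0 s i l) =
        F.tensorKer (LinearEquiv.refl k (N ⊗[k] H)) d (∑ j, diagAct N _ (R.X 0 l j) (ζ j)) := by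
      funext i
      rw [sndDiff_apply, map_sum, Finset.sum_apply]
      exact Finset.sum_congr rfl fun j _ => (tensorKer_diagAct _ (ζ j) i).symm
    have h2 : F.tensorCoh k N d (∑ j, diagAct N _ (R.X 0 l j) (ζ j)) = 0 := by
      rw [map_sum]
      have h3 : ∀ j, F.tensorCoh k N d (diagAct N _ (R.X 0 l j) (ζ j)) =
          f (R.ε (Pi.single j (R.X 0 l j))) := fun j => by
        have h : Pi.single j (R.X 0 l j) =
            R.X 0 l j • (Pi.single j 1 : Fin (R.n 0) → Hᵐᵒᵖ) := by
          rw [← Pi.single_smul, smul_eq_mul, mul_one]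
        rw [tensorCoh_diagAct, hζ, h, map_smul, hf]
      simp only [h3]
      rw [← map_sum, ← map_sum, Finset.univ_sum_single (R.X 0 l)]
      have h4 := R.exact₀.apply_apply_eq_zero (Pi.single l 1)
      rw [Matrix.vecMulLinear_apply, Matrix.single_one_vecMul] at h4
      exact (congrArg f h4).trans (map_zero f)
    rw [h1]
    exact (F.tensorKer_mem_coeffBdry_iff (leftRep k H N) (LinearEquiv.refl k (N ⊗[k] H))
      (fun _ _ => rfl) d _).2 h2
  obtain ⟨a, h1, h2, h3, h4⟩ :=
    isDoubleComplex_linked.exists_staircase (coeffBdry_fstDiff_of_exactAt hF) s hs hs'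
  choose η hη using fun i => R.exists_tensorKer_eq (diagAct N H) (untwist k H N)
    untwist_lTensor_mulLeft (congrFun h3 i)
  let t : Fin (F.n 0) → N ⊗[k] R.coh d := fun i => R.tensorCoh k N d (η i)
  let T : (Fin (F.n 0) → H) →+ N ⊗[k] R.coh d := AddMonoidHom.mk'
    (fun x => ∑ i, twistAct N (R.coh d) (x i) (t i)) fun x y => by
      simp only [Pi.add_apply, map_add, LinearMap.add_apply, Finset.sum_add_distrib]
  have hT : ∀ x, T x = ∑ i, twistAct N (R.coh d) (x i) (t i) := fun x => rfl
  have hTs : ∀ (h : H) x, T (h • x) = twistAct N (R.coh d) h (T x) := fun h x => by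
    rw [hT, hT, map_sum]
    simp only [Pi.smul_apply, smul_eq_mul, map_mul, Module.End.mul_apply]
  have hT0 : ∀ l, T (F.X 0 l) = 0 := fun l => by
    have h5 := (mem_qBdry_sndDiff_iff F R _ 1 d _).1 h4 l
    have h6 : fstDiff F R (leftRep k H N) 0 d (a 0 d) l =
        R.tensorKer (untwist k H N) d (∑ i, twistAct N _ (F.X 0 l i) (η i)) := by
      funext j
      rw [fstDiff_apply, map_sum, Finset.sum_apply]
      exact Finset.sum_congr rfl fun i _ => by rw [tensorKer_twistAct, hη]
    rw [h6, R.tensorKer_mem_coeffBdry_iff _ _ untwist_lTensor_mulLeft, map_sum] at h5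
    rw [hT, ← h5]
    exact Finset.sum_congr rfl fun i _ => (tensorCoh_twistAct _ _).symm
  have hker : ∀ x, F.ε x = 0 → T x = 0 := fun x hx => by
    obtain ⟨c, rfl⟩ := (F.exact₀ x).1 hx
    have : (F.X 0).vecMulLinear c = ∑ l, c l • F.X 0 l := by
      funext j
      simp [Matrix.vecMul, dotProduct]
    rw [this, map_sum]
    exact Finset.sum_eq_zero fun l _ => by rw [hTs, hT0, map_zero]
  obtain ⟨e, he⟩ := F.surj (1 : k)
  have key : ∀ (x : Fin (F.n 0) → H) (c : k), F.ε x = c → T x = c • T e := fun x c hx => by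
    have h5 : T (x - algebraMap k H c • e) = 0 := by
      refine hker _ ?_
      have h6 : Coalgebra.counit (R := k) (algebraMap k H c) * 1 = c := by
        rw [mul_one, Bialgebra.counit_algebraMap]
      have h7 : F.ε (algebraMap k H c • e) = F.ε x :=
        ((F.ε.map_smul _ e).trans (congrArg _ he)).trans (h6.trans hx.symm)
      rw [map_sub, h7, sub_self]
    rw [map_sub, hTs, sub_eq_zero, AlgHom.commutes] at h5
    exact h5
  refine ⟨T e, ⟨a, ζ, η, h1, fun i j => ?_, fun i => (hη i).symm, hζ, fun i => ?_⟩, fun h => ?_⟩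
  · rw [h2]
  · rw [← key (Pi.single i 1) (F.augCoeff i) rfl, hT, Finset.sum_eq_single i, Pi.single_eq_same,
      map_one, Module.End.one_apply]
    · intro b _ hb
      rw [Pi.single_eq_of_ne hb, map_zero, LinearMap.zero_apply]
    · intro h
      exact absurd (Finset.mem_univ i) h
  · rw [← hTs]
    refine key _ _ ?_
    rw [map_smul, he]
    exact mul_one (Coalgebra.counit (R := k) h)

end Linked

/-! ### Modules attached to representations -/

section RepMod

open TensorProduct

/-- The vector space `W` with the action of `A` through `ρ`. -/
def RepMod {k A W : Type*} [Field k] [Ring A] [Algebra k A] [AddCommGroup W] [Module k W]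
    (_ : A →ₐ[k] Module.End k W) : Type _ := W

variable {k A W : Type*} [Field k] [Ring A] [Algebra k A] [AddCommGroup W] [Module k W]
  (ρ : A →ₐ[k] Module.End k W)

instance : AddCommGroup (RepMod ρ) := inferInstanceAs (AddCommGroup W)

instance : Module k (RepMod ρ) := inferInstanceAs (Module k W)

noncomputable instance : Module A (RepMod ρ) := Module.compHom W (ρ : A →+* Module.End k W)

lemma RepMod.smul_def (a : A) (x : RepMod ρ) : a • x = ρ a x := rfl

instance : IsScalarTower k A (RepMod ρ) where
  smul_assoc c a x := by
    rw [RepMod.smul_def, RepMod.smul_def, map_smul]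
    rfl

lemma IsLocallyFinite.submodule {M : Type*} [AddCommGroup M] [Module k M] [Module A M]
    [IsScalarTower k A M] (h : IsLocallyFinite k A M) (N : Submodule A M) :
    IsLocallyFinite k A N := by
  intro V hV x
  obtain ⟨G, h1, h2, h3⟩ := h V hV x
  refine ⟨G.comap (N.restrictScalars k).subtype, ?_, h2, fun a ha g hg => h3 a ha _ hg⟩
  let i : N →ₗ[k] M := N.subtype.restrictScalars k
  have hi : Function.Injective i := Subtype.val_injective
  have h4 : (G.comap i).map i ≤ G := Submodule.map_comap_le i G
  have : FiniteDimensional k ((G.comap i).map i) := Submodule.finiteDimensional_of_le h4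
  exact Module.Finite.equiv (Submodule.equivMapOfInjective i hi (G.comap i)).symm

end RepMod

section Diagonal

open TensorProduct MulOpposite

variable {k : Type u} [Field k] {H : Type u} [Ring H] [HopfAlgebra k H]
  {U V : Type*} [AddCommGroup U] [Module k U] [Module Hᵐᵒᵖ U] [IsScalarTower k Hᵐᵒᵖ U]
  [AddCommGroup V] [Module k V]

variable (k U V) in
/-- The tensor product of two right modules with the diagonal action. -/
def DiagMod : Type _ := U ⊗[k] V

instance : AddCommGroup (DiagMod k U V) := inferInstanceAs (AddCommGroup (U ⊗[k] V))

instance : Module k (DiagMod k U V) := inferInstanceAs (Module k (U ⊗[k] V))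

noncomputable instance [Module Hᵐᵒᵖ V] [IsScalarTower k Hᵐᵒᵖ V] : Module Hᵐᵒᵖ (DiagMod k U V) :=
  Module.compHom (U ⊗[k] V) (diagAct (k := k) (H := H) U V : Hᵐᵒᵖ →+* Module.End k (U ⊗[k] V))

instance [Module Hᵐᵒᵖ V] [IsScalarTower k Hᵐᵒᵖ V] : IsScalarTower k Hᵐᵒᵖ (DiagMod k U V) where
  smul_assoc c h x := by
    refine (congrFun (congrArg DFunLike.coe (map_smul (diagAct (k := k) U V) c h)) x).trans rfl

omit [Module Hᵐᵒᵖ U] [IsScalarTower k Hᵐᵒᵖ U] in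
lemma exists_finite_le_map₂ (W : Submodule k (U ⊗[k] V)) [FiniteDimensional k W] :
    ∃ (P : Submodule k U) (Q : Submodule k V), FiniteDimensional k P ∧ FiniteDimensional k Q ∧
      W ≤ Submodule.map₂ (TensorProduct.mk k U V) P Q := by
  obtain ⟨s, hs⟩ := Module.Finite.iff_fg.1 ‹FiniteDimensional k W›
  obtain ⟨P, Q, hP, hQ, h⟩ :=
    TensorProduct.exists_finite_submodule_of_setFinite (s : Set (U ⊗[k] V)) s.finite_toSet
  rw [range_mapIncl] at h
  exact ⟨P, Q, hP, hQ, hs ▸ Submodule.span_le.2 h⟩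

/-- Diagonal tensor products of locally finite modules are locally finite. -/
lemma IsLocallyFinite.diagAct [Module Hᵐᵒᵖ V] [IsScalarTower k Hᵐᵒᵖ V]
    (hU : IsLocallyFinite k Hᵐᵒᵖ U) (hV : IsLocallyFinite k Hᵐᵒᵖ V) :
    IsLocallyFinite k Hᵐᵒᵖ (DiagMod k U V) := by
  intro W hW (x : U ⊗[k] V)
  obtain ⟨P, Q, hP, hQ, hPQ⟩ := exists_finite_le_map₂ (W.map (comulOp k (H := H)).toLinearMap)
  obtain ⟨U₀, V₀, hU₀, hV₀, hx⟩ := exists_finite_le_map₂ (Submodule.span k {x})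
  obtain ⟨U₁, h1, h2, h3⟩ := hU.exists_stable P U₀
  obtain ⟨V₁, h1', h2', h3'⟩ := hV.exists_stable Q V₀
  let G : Submodule k (U ⊗[k] V) := Submodule.map₂ (TensorProduct.mk k U V) U₁ V₁
  have hG : ∀ t ∈ Submodule.map₂ (TensorProduct.mk k Hᵐᵒᵖ Hᵐᵒᵖ) P Q, ∀ g ∈ G,
      tensorRep k U V t g ∈ G := fun t ht g hg => by
    suffices h : Submodule.map₂ (TensorProduct.mk k Hᵐᵒᵖ Hᵐᵒᵖ) P Q ≤
        (Submodule.comap (tensorRep k U V).toLinearMap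
          (Submodule.compatibleMaps G G)) from h ht hg
    refine Submodule.map₂_le.2 fun p hp q hq => ?_
    refine Submodule.map₂_le.2 fun u hu v hv => ?_
    exact Submodule.apply_mem_map₂ _ (h3 p hp u hu) (h3' q hq v hv)
  have hGf : FiniteDimensional k G := Module.Finite.iff_fg.2
    (.map₂ _ (Module.Finite.iff_fg.1 h1) (Module.Finite.iff_fg.1 h1'))
  let G' : Submodule k (DiagMod k U V) := G
  have hGf' : FiniteDimensional k G' := hGf
  have hxG : x ∈ G := Submodule.map₂_le_map₂ h2 h2' (hx (Submodule.mem_span_singleton_self x))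
  exact ⟨G', hGf', hxG, fun a ha g hg => hG _ (hPQ (Submodule.mem_map_of_mem ha)) g hg⟩

end Diagonal

/-! ### The dualizing module is one-dimensional -/

section OneDimensional

open TensorProduct MulOpposite

variable {k : Type u} [Field k] {H : Type u} [Ring H] [HopfAlgebra k H]

variable (k H) in
/-- The trivial right action. -/
noncomputable def counitAct : Hᵐᵒᵖ →ₐ[k] Module.End k k :=
  (Algebra.lsmul k k k).comp
    ((Bialgebra.counitAlgHom k H).fromOpposite fun _ _ => mul_comm _ _)

variable {N : Type*} [AddCommGroup N] [Module k N] [Module Hᵐᵒᵖ N] [IsScalarTower k Hᵐᵒᵖ N]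
  {E : Type*} [AddCommGroup E] [Module k E] [Module Hᵐᵒᵖ E] [IsScalarTower k Hᵐᵒᵖ E]
  {Y : Type*} [AddCommGroup Y] [Module k Y] [Module Hᵐᵒᵖᵐᵒᵖ Y] [IsScalarTower k Hᵐᵒᵖᵐᵒᵖ Y]

omit [Module Hᵐᵒᵖ N] [IsScalarTower k Hᵐᵒᵖ N] in
lemma sum_counit_smul_map {h : H} {ι : Type*} (r : Coalgebra.Repr k h ι) (φ : H →ₗ[k] N) :
    ∑ i ∈ r.index, Coalgebra.counit (R := k) (r.left i) • φ (r.right i) = φ h := by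
  conv_rhs => rw [← Coalgebra.sum_counit_smul r, map_sum]
  simp only [map_smul]

omit [Module Hᵐᵒᵖ N] [IsScalarTower k Hᵐᵒᵖ N] in
lemma sum_counit_right_smul_map {h : H} {ι : Type*} (r : Coalgebra.Repr k h ι) (φ : H →ₗ[k] N) :
    ∑ i ∈ r.index, Coalgebra.counit (R := k) (r.right i) • φ (r.left i) = φ h := by
  have := congrArg (TensorProduct.rid k N) (Coalgebra.sum_map_tmul_counit_eq φ h (repr := r))
  rwa [map_sum, rid_tmul, one_smul] at this

omit [Module Hᵐᵒᵖ N] [IsScalarTower k Hᵐᵒᵖ N] [Module Hᵐᵒᵖᵐᵒᵖ Y] [IsScalarTower k Hᵐᵒᵖᵐᵒᵖ Y] in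
lemma eq_zero_of_tmul_eq_zero {n : N} {y : Y} (hy : y ≠ 0) (h : n ⊗ₜ[k] y = 0) : n = 0 := by
  rw [ne_eq, ← Module.forall_dual_apply_eq_zero_iff k y] at hy
  push Not at hy
  obtain ⟨φ, hφ⟩ := hy
  have := congrArg (TensorProduct.rid k N) (congrArg (LinearMap.lTensor N φ) h)
  rw [LinearMap.lTensor_tmul, rid_tmul, map_zero, map_zero] at this
  exact (smul_eq_zero.1 this).resolve_left hφ

omit [Module Hᵐᵒᵖ N] [IsScalarTower k Hᵐᵒᵖ N] [Module Hᵐᵒᵖᵐᵒᵖ Y] [IsScalarTower k Hᵐᵒᵖᵐᵒᵖ Y] in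
lemma exists_eq_tmul_of_span {v : Y} (hv : ∀ y : Y, ∃ c : k, y = c • v) (τ : N ⊗[k] Y) :
    ∃ n, τ = n ⊗ₜ v := by
  induction τ with
  | zero => exact ⟨0, (zero_tmul _ _).symm⟩
  | add a b ha hb =>
    obtain ⟨x, rfl⟩ := ha
    obtain ⟨x', rfl⟩ := hb
    exact ⟨x + x', (add_tmul _ _ _).symm⟩
  | tmul n y =>
    obtain ⟨c, rfl⟩ := hv y
    exact ⟨c • n, (smul_tmul _ _ _).symm⟩

omit [Module Hᵐᵒᵖᵐᵒᵖ Y] [IsScalarTower k Hᵐᵒᵖᵐᵒᵖ Y] in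
lemma forall_exists_eq_smul (h : ∃ v : Y, ∀ y : Y, ∃ c : k, y = c • v) {w : Y} (hw : w ≠ 0)
    (y : Y) : ∃ c : k, y = c • w := by
  obtain ⟨v, hv⟩ := h
  obtain ⟨c, rfl⟩ := hv y
  obtain ⟨c', rfl⟩ := hv w
  have : c' ≠ 0 := by
    rintro rfl
    exact hw (zero_smul _ _)
  exact ⟨c * c'⁻¹, by rw [smul_smul, inv_mul_cancel_right₀ this]⟩

lemma diagAct_invariant_tmul {n : N} (hn : ∀ h : H, op h • n = Coalgebra.counit (R := k) h • n)
    (h : Hᵐᵒᵖ) (e : E) : diagAct (k := k) N E h (n ⊗ₜ e) = n ⊗ₜ (h • e) := by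
  obtain ⟨h, rfl⟩ := op_surjective h
  rw [diagAct_tmul N E (Coalgebra.Repr.arbitrary k h)]
  simp only [hn, smul_tmul]
  rw [← tmul_sum]
  exact congrArg _ (sum_counit_smul_map (Coalgebra.Repr.arbitrary k h) (orbitMap e))

lemma twistAct_tmul_invariant {y : Y}
    (hy : ∀ h : H, op (op h) • y = Coalgebra.counit (R := k) h • y) (h : H) (n : N) :
    twistAct (k := k) N Y h (n ⊗ₜ y) = (op (HopfAlgebra.antipode k h) • n) ⊗ₜ y := by
  rw [twistAct_tmul N Y (Coalgebra.Repr.arbitrary k h)]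
  simp only [hy, tmul_smul, smul_tmul']
  rw [← sum_tmul]
  exact congrArg (· ⊗ₜ y) (sum_counit_right_smul_map (Coalgebra.Repr.arbitrary k h)
    (orbitMap n ∘ₗ HopfAlgebra.antipode k))

lemma smul_eq_counit_smul_of_twistAct
    (hS : Function.Bijective (HopfAlgebra.antipode k : H →ₗ[k] H)) {y : Y} (hy₀ : y ≠ 0)
    (hy : ∀ h : H, op (op h) • y = Coalgebra.counit (R := k) h • y) {x : N}
    (hx : ∀ h : H, twistAct N Y h (x ⊗ₜ y) = Coalgebra.counit (R := k) h • x ⊗ₜ[k] y) (h : H) :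
    op h • x = Coalgebra.counit (R := k) h • x := by
  obtain ⟨h, rfl⟩ := hS.2 h
  have h3 := hx h
  rw [twistAct_tmul_invariant hy, smul_tmul', ← sub_eq_zero, ← sub_tmul] at h3
  rw [HopfAlgebra.counit_antipode]
  exact sub_eq_zero.1 (eq_zero_of_tmul_eq_zero hy₀ h3)

omit [Module Hᵐᵒᵖᵐᵒᵖ Y] [IsScalarTower k Hᵐᵒᵖᵐᵒᵖ Y] in
/-- A homomorphism is determined by the invariant linked to it. -/
lemma Linked.unique {M : Type*} [AddCommGroup M] [Module Hᵐᵒᵖ M] {d : ℕ}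
    {F : FreeRes H (TrivialCounitModule k H)} {R : FreeRes Hᵐᵒᵖ M} (hR : ∀ q < d, R.ExactAt q)
    {f f' : M →+ N ⊗[k] F.coh d} (hf : ∀ (h : Hᵐᵒᵖ) x, f (h • x) = diagAct N _ h (f x))
    (hf' : ∀ (h : Hᵐᵒᵖ) x, f' (h • x) = diagAct N _ h (f' x)) {τ : N ⊗[k] R.coh d}
    (h : Linked F R f τ) (h' : Linked F R f' τ) : f = f' := by
  have h1 := h.sub h'
  rw [sub_self] at h1
  refine AddMonoidHom.ext fun x => sub_eq_zero.1 (congrFun (h1.eq_zero hR ?_ ?_) x)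
  · exact map_add (f - f')
  · intro h x
    rw [Pi.sub_apply, Pi.sub_apply, hf, hf', map_sub]

/-- A homomorphism linked to `x ⊗ y` for a nonzero `y` is `e ↦ x ⊗ e`, if `e ↦ 1 ⊗ e` is linked
to `1 ⊗ y`. -/
lemma Linked.eq_tmul {d : ℕ}
    {F : FreeRes H (TrivialCounitModule k H)} {R : FreeRes Hᵐᵒᵖ (F.coh d)}
    (hR : ∀ q < d, R.ExactAt q)
    {f : F.coh d →+ N ⊗[k] F.coh d} (hf : ∀ (h : Hᵐᵒᵖ) x, f (h • x) = diagAct N _ h (f x))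
    {K : Type*} [AddCommGroup K] [Module k K] [Module Hᵐᵒᵖ K] [IsScalarTower k Hᵐᵒᵖ K] {one : K}
    (hK : ∀ c : K, ∃ c' : k, c = c' • one) (hgen : ∀ x : N, ∃ g : K →ₗ[k] N, g one = x)
    (hone : ∀ h : H, op h • one = Coalgebra.counit (R := k) h • one) {y₁ : R.coh d}
    (h0 : Linked F R (fun e => one ⊗ₜ e) (one ⊗ₜ[k] y₁)) {x : N} (h1 : Linked F R f (x ⊗ₜ y₁))
    (hx : ∀ h : H, op h • x = Coalgebra.counit (R := k) h • x)
    (e : F.coh d) : f e = x ⊗ₜ e := by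
  obtain ⟨g, hg1⟩ := hgen x
  have hg : ∀ (h : Hᵐᵒᵖ) (c : K), g (h • c) = h • g c := fun h c => by
    obtain ⟨h, rfl⟩ := op_surjective h
    obtain ⟨c, rfl⟩ := hK c
    rw [smul_comm, hone, map_smul, map_smul, map_smul, hg1, smul_comm (op h) c x, hx]
  have h4 : Linked F R (TensorProduct.mk k N (F.coh d) x).toAddMonoidHom (x ⊗ₜ y₁) := by
    convert h0.map g hg using 1
    · funext e
      exact congrArg (· ⊗ₜ e) hg1.symm
    · exact congrArg (· ⊗ₜ y₁) hg1.symm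
  exact DFunLike.congr_fun (h1.unique hR hf (fun h e => (diagAct_invariant_tmul hx h e).symm) h4) e

/-- Every homomorphism into `N ⊗ E` is `e ↦ x ⊗ e` for some `x`. -/
theorem exists_eq_tmul (hS : Function.Bijective (HopfAlgebra.antipode k : H →ₗ[k] H)) {d : ℕ}
    {F : FreeRes H (TrivialCounitModule k H)} (hF : ∀ p < d, F.ExactAt p)
    (hE : Nontrivial (F.coh d))
    {R : FreeRes Hᵐᵒᵖ (F.coh d)} (hR : ∀ q < d, R.ExactAt q)
    (hY : ∀ (h : H) (y : R.coh d), op (op h) • y = Coalgebra.counit (R := k) h • y)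
    (hY' : ∃ v : R.coh d, ∀ y : R.coh d, ∃ c : k, y = c • v)
    (f : F.coh d →+ N ⊗[k] F.coh d) (hf : ∀ (h : Hᵐᵒᵖ) x, f (h • x) = diagAct N _ h (f x)) :
    ∃ x : N, ∀ e, f e = x ⊗ₜ e := by
  let K := RepMod (counitAct k H)
  let one : K := (1 : k)
  have hK : ∀ c : K, ∃ c' : k, c = c' • one := fun c => ⟨c, (mul_one (M := k) c).symm⟩
  have hone : ∀ h : H, op h • one = Coalgebra.counit (R := k) h • one := fun h => rfl
  have hone' : one ≠ 0 := one_ne_zero (α := k)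
  let f₀ : F.coh d →+ K ⊗[k] F.coh d := (TensorProduct.mk k K (F.coh d) one).toAddMonoidHom
  have hf₀ : ∀ (h : Hᵐᵒᵖ) x, f₀ (h • x) = diagAct K (F.coh d) h (f₀ x) :=
    fun h e => (diagAct_invariant_tmul hone h e).symm
  have hf₀' : ∀ e, f₀ e = one ⊗ₜ e := fun e => rfl
  have hgen : ∀ x : N, ∃ g : K →ₗ[k] N, g one = x := fun x =>
    ⟨LinearMap.toSpanSingleton k N x, one_smul k x⟩
  clear_value f₀ one
  obtain ⟨τ₀, h0, -⟩ := exists_linked (R := R) hF f₀ hf₀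
  obtain ⟨τ, h1, h2⟩ := exists_linked (R := R) hF f hf
  have hτ₀ : τ₀ ≠ 0 := by
    rintro rfl
    have h3 := h0.eq_zero hR (map_add f₀) hf₀
    obtain ⟨e, he⟩ := exists_ne (0 : F.coh d)
    have h4 : one ⊗ₜ[k] e = 0 := (hf₀' e).symm.trans (congrFun h3 e)
    exact hone' (eq_zero_of_tmul_eq_zero he h4)
  obtain ⟨y₁, rfl⟩ : ∃ y₁, τ₀ = one ⊗ₜ y₁ := by
    obtain ⟨y₁, hy₁⟩ := exists_eq_tmul_of_span hK (TensorProduct.comm k _ _ τ₀)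
    exact ⟨y₁, (TensorProduct.comm k K (R.coh d)).injective (hy₁.trans (comm_tmul _ _ _ _ _).symm)⟩
  have hy₁ : y₁ ≠ 0 := by
    rintro rfl
    exact hτ₀ (tmul_zero _ _)
  obtain ⟨x, rfl⟩ := exists_eq_tmul_of_span (forall_exists_eq_smul hY' hy₁) τ
  exact ⟨x, Linked.eq_tmul hR hf hK hgen hone (funext hf₀' ▸ h0) h1
    (smul_eq_counit_smul_of_twistAct hS hy₁ (fun h => hY h y₁) h2)⟩

end OneDimensional

section InvariantTensor

open TensorProduct MulOpposite

variable {k : Type u} [Field k] {H : Type u} [Ring H] [HopfAlgebra k H]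
  {E : Type u} [AddCommGroup E] [Module k E] [Module Hᵐᵒᵖ E] [IsScalarTower k Hᵐᵒᵖ E]
  {Y : Type u} [AddCommGroup Y] [Module k Y] [Module Hᵐᵒᵖᵐᵒᵖ Y] [IsScalarTower k Hᵐᵒᵖᵐᵒᵖ Y]

lemma tensorRep_antipode_antipode_of_twistAct {τ : E ⊗[k] Y}
    (hτ : ∀ h : H, twistAct E Y h τ = Coalgebra.counit (R := k) h • τ) (h : H) :
    tensorRep k E Y
        (op (HopfAlgebra.antipode k (HopfAlgebra.antipode k h)) ⊗ₜ (1 : Hᵐᵒᵖᵐᵒᵖ)) τ =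
      tensorRep k E Y ((1 : Hᵐᵒᵖ) ⊗ₜ op (op h)) τ := by
  let r := Coalgebra.Repr.arbitrary k h
  let Ψ := Algebra.TensorProduct.map (HopfAlgebra.antipodeAlgHomOp k H)
    (AlgEquiv.opOp k H).toAlgHom
  let φ : H →ₗ[k] E ⊗[k] Y := (tensorRep k E Y).toLinearMap.flip τ ∘ₗ Ψ.toLinearMap ∘ₗ
    (TensorProduct.mk k H H).flip 1 ∘ₗ HopfAlgebra.antipode k
  have h1 := congrArg (fun t => tensorRep k E Y (Ψ t) τ) (sum_antipode_tmul_one_mul_comul k r)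
  have h2 : ∀ i, tensorRep k E Y (Ψ ((HopfAlgebra.antipode k (r.left i) ⊗ₜ[k] (1 : H)) *
      Coalgebra.comul (R := k) (r.right i))) τ =
      Coalgebra.counit (R := k) (r.right i) • φ (r.left i) := fun i => by
    rw [map_mul, map_mul, Module.End.mul_apply]
    exact (congrArg _ (hτ (r.right i))).trans (map_smul _ _ _)
  simp only [map_sum, LinearMap.sum_apply, h2] at h1
  rw [sum_counit_right_smul_map r φ] at h1
  have h3 : Ψ ((1 : H) ⊗ₜ h) = (1 : Hᵐᵒᵖ) ⊗ₜ op (op h) :=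
    congrArg (· ⊗ₜ[k] op (op h)) (map_one (HopfAlgebra.antipodeAlgHomOp k H))
  rw [h3] at h1
  exact h1

variable (Y) in
/-- A left module as a right module through the inverse of the antipode. -/
noncomputable def antipodeInvAct
    (hS : Function.Bijective (HopfAlgebra.antipode k : H →ₗ[k] H)) :
    Hᵐᵒᵖ →ₐ[k] Module.End k Y :=
  (Algebra.lsmul k k Y).comp
    ((AlgEquiv.opOp k H).toAlgHom.comp (antipodeEquiv k H hS).symm.toAlgHom)

lemma antipode_antipodeEquiv_symm
    (hS : Function.Bijective (HopfAlgebra.antipode k : H →ₗ[k] H)) (h : H) :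
    HopfAlgebra.antipode k ((antipodeEquiv k H hS).symm (op h)) = h :=
  congrArg unop ((antipodeEquiv k H hS).apply_symm_apply (op h))

lemma sum_antipodeInv_mul_antipodeInv
    (hS : Function.Bijective (HopfAlgebra.antipode k : H →ₗ[k] H)) {h : H} {ι : Type*}
    (r : Coalgebra.Repr k h ι) :
    ∑ i ∈ r.index, (antipodeEquiv k H hS).symm (op (r.left i)) *
      (antipodeEquiv k H hS).symm (op ((antipodeEquiv k H hS).symm (op (r.right i)))) =
      algebraMap k H (Coalgebra.counit h) := by
  apply hS.1
  apply hS.1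
  simp only [map_sum, HopfAlgebra.antipode_mul_antidistrib, antipode_antipodeEquiv_symm]
  rw [HopfAlgebra.sum_antipode_mul_eq_algebraMap_counit r]
  simp [Algebra.algebraMap_eq_smul_one]

lemma diagAct_comm_of_twistAct (hS : Function.Bijective (HopfAlgebra.antipode k : H →ₗ[k] H))
    {τ : E ⊗[k] Y} (hτ : ∀ h : H, twistAct E Y h τ = Coalgebra.counit (R := k) h • τ)
    (τ' : RepMod (antipodeInvAct Y hS) ⊗[k] E) (hτ' : τ' = TensorProduct.comm k E Y τ) (h : H) :
    diagAct (RepMod (antipodeInvAct Y hS)) E (op h) τ' =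
      Coalgebra.counit (R := k) h • τ' := by
  let r := Coalgebra.Repr.arbitrary k h
  let T : H → H := fun h => (antipodeEquiv k H hS).symm (op h)
  let c : E ⊗[k] Y ≃ₗ[k] RepMod (antipodeInvAct Y hS) ⊗[k] E := TensorProduct.comm k E Y
  have h1 : ∀ t : E ⊗[k] Y, diagAct (RepMod (antipodeInvAct Y hS)) E (op h) (c t) = c
      (∑ i ∈ r.index, tensorRep k E Y (op (r.right i) ⊗ₜ op (op (T (r.left i)))) t) := fun t => by
    induction t with
    | zero => simp only [map_zero, Finset.sum_const_zero]
    | add a b ha hb =>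
      simp only [map_add, Finset.sum_add_distrib] at ha hb ⊢
      rw [ha, hb]
    | tmul x y =>
      refine (diagAct_tmul (RepMod (antipodeInvAct Y hS)) E r y x).trans ?_
      rw [map_sum]
      rfl
  subst hτ'
  refine (h1 τ).trans ?_
  refine (congrArg _ ?_).trans (map_smul c (Coalgebra.counit (R := k) h) τ)
  have h2 : ∀ i, tensorRep k E Y (op (r.right i) ⊗ₜ op (op (T (r.left i)))) τ =
      tensorRep k E Y ((1 : Hᵐᵒᵖ) ⊗ₜ op (op (T (r.left i) * T (T (r.right i))))) τ := fun i => by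
    have h3 := tensorRep_antipode_antipode_of_twistAct hτ (T (T (r.right i)))
    rw [antipode_antipodeEquiv_symm, antipode_antipodeEquiv_symm] at h3
    have h4 : ∀ (a b : Hᵐᵒᵖ ⊗[k] Hᵐᵒᵖᵐᵒᵖ), tensorRep k E Y (a * b) τ =
      tensorRep k E Y a (tensorRep k E Y b τ) := fun a b => by
        rw [map_mul, Module.End.mul_apply]
    have h5 := congrArg (tensorRep k E Y ((1 : Hᵐᵒᵖ) ⊗ₜ op (op (T (r.left i))))) h3
    rw [← h4, ← h4, Algebra.TensorProduct.tmul_mul_tmul, Algebra.TensorProduct.tmul_mul_tmul,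
      one_mul, mul_one, one_mul, ← op_mul, ← op_mul] at h5
    exact h5
  rw [Finset.sum_congr rfl fun i _ => h2 i, ← LinearMap.sum_apply, ← map_sum, ← tmul_sum,
    ← Finset.op_sum, ← Finset.op_sum, sum_antipodeInv_mul_antipodeInv hS r,
    Algebra.algebraMap_eq_smul_one, op_smul, op_smul, tmul_smul, map_smul]
  have : tensorRep k E Y ((1 : Hᵐᵒᵖ) ⊗ₜ[k] (1 : Hᵐᵒᵖᵐᵒᵖ)) = 1 := map_one (tensorRep k E Y)
  rw [op_one, op_one, this]
  rfl

/-- Coassociativity of the diagonal action. -/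
lemma diagAct_assoc_symm {U V W : Type*} [AddCommGroup U] [Module k U] [Module Hᵐᵒᵖ U]
    [IsScalarTower k Hᵐᵒᵖ U] [AddCommGroup V] [Module k V] [Module Hᵐᵒᵖ V]
    [IsScalarTower k Hᵐᵒᵖ V] [AddCommGroup W] [Module k W] [Module Hᵐᵒᵖ W]
    [IsScalarTower k Hᵐᵒᵖ W] {h : H} {ι : Type*} (r : Coalgebra.Repr k h ι) (u : U)
    (t : V ⊗[k] W) :
    diagAct (k := k) (DiagMod k U V) W (op h) ((TensorProduct.assoc k U V W).symm (u ⊗ₜ t)) =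
      (TensorProduct.assoc k U V W).symm
        (∑ i ∈ r.index, (op (r.left i) • u) ⊗ₜ diagAct V W (op (r.right i)) t) := by
  induction t with
  | zero =>
    simp only [map_zero, tmul_zero, Finset.sum_const_zero]
    exact map_zero (diagAct (k := k) (DiagMod k U V) W (op h))
  | add a b ha hb =>
    simp only [map_add, tmul_add, Finset.sum_add_distrib] at ha hb ⊢
    rw [← ha, ← hb]
    exact map_add (diagAct (k := k) (DiagMod k U V) W (op h)) _ _
  | tmul v w =>
    have h1 := congrArg ((TensorProduct.assoc k U V W).symm.toLinearMap ∘ₗ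
      TensorProduct.map (orbitMap u) (TensorProduct.map (orbitMap v) (orbitMap w)))
      (Coalgebra.sum_tmul_tmul_eq r (fun i => Coalgebra.Repr.arbitrary k (r.left i))
      (fun i => Coalgebra.Repr.arbitrary k (r.right i)))
    have h2 := diagAct_tmul (DiagMod k U V) W r (u ⊗ₜ[k] v : U ⊗[k] V) w
    refine h2.trans ?_
    simp only [diagAct_tmul V W (Coalgebra.Repr.arbitrary k (r.right _)), tmul_sum, map_sum]
    simp only [map_sum, LinearMap.comp_apply, map_tmul] at h1
    refine Eq.trans ?_ h1
    refine Finset.sum_congr rfl fun i _ => ?_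
    have h3 := diagAct_tmul U V (Coalgebra.Repr.arbitrary k (r.left i)) u v
    refine (congrArg (fun z : U ⊗[k] V => z ⊗ₜ[k] (op (r.right i) • w)) h3).trans ?_
    rw [sum_tmul]
    rfl

omit [Module Hᵐᵒᵖ E] [IsScalarTower k Hᵐᵒᵖ E] [Module Hᵐᵒᵖᵐᵒᵖ Y] [IsScalarTower k Hᵐᵒᵖᵐᵒᵖ Y] in
lemma exists_lTensor_ne_zero {τ : E ⊗[k] Y} (hτ : τ ≠ 0) :
    ∃ φ : Y →ₗ[k] k, LinearMap.lTensor E φ τ ≠ 0 := by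
  by_contra! h
  let b := Module.Free.chooseBasis k Y
  apply hτ
  apply (TensorProduct.equivFinsuppOfBasisRight (M := E) b).injective
  rw [map_zero]
  ext i
  rw [Finsupp.zero_apply, TensorProduct.equivFinsuppOfBasisRight_apply, h, map_zero]

omit [Module Hᵐᵒᵖ E] [IsScalarTower k Hᵐᵒᵖ E] [Module Hᵐᵒᵖᵐᵒᵖ Y] [IsScalarTower k Hᵐᵒᵖᵐᵒᵖ Y] in
lemma finrank_eq_one_of_tmul_eq_tmul {τ : E ⊗[k] Y} (hτ : τ ≠ 0) (x : E ⊗[k] Y)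
    (hx : ∀ e : E, (TensorProduct.assoc k E Y E).symm (e ⊗ₜ TensorProduct.comm k E Y τ) =
      x ⊗ₜ e) :
    Module.finrank k E = 1 := by
  obtain ⟨φ, hφ⟩ := exists_lTensor_ne_zero hτ
  let n : E := TensorProduct.rid k E (LinearMap.lTensor E φ τ)
  have hn : n ≠ 0 := fun h => hφ ((TensorProduct.rid k E).injective (h.trans (map_zero _).symm))
  let x' : E := TensorProduct.rid k E (LinearMap.lTensor E φ x)
  have key : ∀ (e : E) (t : E ⊗[k] Y),
      TensorProduct.map ((TensorProduct.rid k E).toLinearMap ∘ₗ LinearMap.lTensor E φ)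
        LinearMap.id ((TensorProduct.assoc k E Y E).symm (e ⊗ₜ TensorProduct.comm k E Y t)) =
        e ⊗ₜ[k] TensorProduct.rid k E (LinearMap.lTensor E φ t) := fun e t => by
    induction t with
    | zero => simp only [map_zero, tmul_zero]
    | add a b ha hb => simp only [map_add, tmul_add, ha, hb]
    | tmul a y => simp [smul_tmul']
  have h1 : ∀ e : E, e ⊗ₜ[k] n = x' ⊗ₜ e := fun e => by
    rw [← key e τ, hx]
    rfl
  rw [ne_eq, ← Module.forall_dual_apply_eq_zero_iff k n] at hn
  push Not at hn
  obtain ⟨μ, hμ⟩ := hn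
  have h2 : ∀ e : E, μ n • e = μ e • x' := fun e => by
    have := congrArg (TensorProduct.rid k E ∘ LinearMap.lTensor E μ) (h1 e)
    simpa using this
  have hn : n ≠ 0 := fun h => hμ (h ▸ map_zero μ)
  refine (finrank_eq_one_iff_of_nonzero' n hn).2 fun e => ?_
  have hx' : x' = n := smul_right_injective E hμ (h2 n).symm
  refine ⟨(μ n)⁻¹ * μ e, ?_⟩
  have h3 := h2 e
  rw [hx'] at h3
  rw [mul_smul, ← h3, inv_smul_smul₀ hμ]

lemma finrank_eq_one_of_twistAct (hS : Function.Bijective (HopfAlgebra.antipode k : H →ₗ[k] H))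
    (hE : ∀ (N : Type u) [AddCommGroup N] [Module k N] [Module Hᵐᵒᵖ N] [IsScalarTower k Hᵐᵒᵖ N]
      (f : E →+ N ⊗[k] E), (∀ (h : Hᵐᵒᵖ) x, f (h • x) = diagAct N E h (f x)) →
      ∃ x : N, ∀ e, f e = x ⊗ₜ e)
    {τ : E ⊗[k] Y} (hτ₀ : τ ≠ 0)
    (hτ : ∀ h : H, twistAct E Y h τ = Coalgebra.counit (R := k) h • τ) :
    Module.finrank k E = 1 := by
  let Y' := RepMod (antipodeInvAct Y hS)
  let τ' : Y' ⊗[k] E := TensorProduct.comm k E Y τ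
  let N := DiagMod k E Y'
  let f : E →+ N ⊗[k] E :=
    ((TensorProduct.assoc k E Y' E).symm.toLinearMap ∘ₗ
      (TensorProduct.mk k E (Y' ⊗[k] E)).flip τ').toAddMonoidHom
  have hf₀ : ∀ e, f e = (TensorProduct.assoc k E Y' E).symm (e ⊗ₜ τ') := fun e => rfl
  have hf : ∀ (h : Hᵐᵒᵖ) x, f (h • x) = diagAct N E h (f x) := fun h e => by
    obtain ⟨h, rfl⟩ := op_surjective h
    let r := Coalgebra.Repr.arbitrary k h
    refine (hf₀ _).trans ((congrArg _ ?_).trans (diagAct_assoc_symm r e τ').symm)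
    refine (congrArg (· ⊗ₜ τ') (sum_counit_right_smul_map r (orbitMap e)).symm).trans ?_
    rw [sum_tmul]
    refine Finset.sum_congr rfl fun i _ => ?_
    refine Eq.trans ?_ (congrArg ((op (r.left i) • e) ⊗ₜ[k] ·)
      (diagAct_comm_of_twistAct hS hτ τ' rfl (r.right i)).symm)
    exact smul_tmul _ _ _
  obtain ⟨x, hx⟩ := hE N f hf
  exact finrank_eq_one_of_tmul_eq_tmul hτ₀ x fun e => hx e

end InvariantTensor

section Conclusion

open TensorProduct MulOpposite

lemma op_algebraMap_smul_ext (k : Type u') {A : Type u} [Field k] [Ring A] [Algebra k A]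
    {M : Type v} [AddCommGroup M] [Module A M] {i : ℕ} (c : k) (e : ExtGroup A M A i) :
    op (algebraMap k A c) • e = c • e := by
  have h : rmulLinear A (algebraMap k A c) = scalarLinear k A A c := by
    ext x
    exact (Algebra.commutes c x.down).symm
  exact congrArg (fun f => e.comp (Abelian.Ext.mk₀ (ModuleCat.ofHom f)) (add_zero i)) h

lemma FreeRes.finrank_coh {k : Type u'} {A : Type u} [Field k] [Ring A] [Algebra k A]
    {M : Type v} [AddCommGroup M] [Module A M] (F : FreeRes A M) (i : ℕ) :
    Module.finrank k (F.coh i) = Module.finrank k (ExtGroup A M A i) := by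
  obtain ⟨e⟩ := F.nonempty_coh_equiv_extGroup i
  refine LinearEquiv.finrank_eq { e with map_smul' := fun c x => ?_ }
  have h : op (algebraMap k A c) • x = c • x := algebraMap_smul Aᵐᵒᵖ c x
  exact (congrArg e h.symm).trans ((map_smul e _ x).trans (op_algebraMap_smul_ext k c (e x)))

variable {k : Type u} [Field k] {H : Type u} [Ring H] [HopfAlgebra k H]

namespace IsGKCohenMacaulay

variable (hCM : IsGKCohenMacaulay k H) {d : ℕ}
  (hd : moduleGrade H (TrivialCounitModule k H) = d) [IsNoetherianRing H] [IsNoetherianRing Hᵐᵒᵖ]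
  (hS : Function.Bijective (HopfAlgebra.antipode k : H →ₗ[k] H)) (haus : AuslanderCondition H)

include hCM hd hS haus

/-- There is a nonzero invariant in the tensor product of the dualizing module and some left
module. -/
lemma exists_twistAct_invariant (F : FreeRes H (TrivialCounitModule k H)) :
    ∃ (M : Type u) (_ : AddCommGroup M) (_ : Module Hᵐᵒᵖ M) (R : FreeRes Hᵐᵒᵖ M)
      (τ : F.coh d ⊗[k] R.coh d), τ ≠ 0 ∧
      ∀ h : H, twistAct (F.coh d) (R.coh d) h τ = Coalgebra.counit (R := k) h • τ := by
  have hE := nontrivial_coh hd F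
  have hlf := hCM.isLocallyFinite_coh hd hS haus F
  let D := DiagMod k (F.coh d) (F.coh d)
  have hD : IsLocallyFinite k Hᵐᵒᵖ D := hlf.diagAct hlf
  obtain ⟨e, he⟩ := exists_ne (0 : F.coh d)
  let w : D := (e ⊗ₜ[k] e : F.coh d ⊗[k] F.coh d)
  have hw : w ≠ 0 := fun h => he (eq_zero_of_tmul_eq_zero he h)
  let M : Submodule Hᵐᵒᵖ D := Submodule.span Hᵐᵒᵖ {w}
  have hM : Nontrivial M :=
    ⟨⟨⟨w, Submodule.mem_span_singleton_self w⟩, 0, fun h => hw (congrArg Subtype.val h)⟩⟩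
  have hMlf : IsLocallyFinite k Hᵐᵒᵖ M := hD.submodule M
  obtain ⟨R⟩ := FreeRes.exists_of_finite (A := Hᵐᵒᵖ) (M := M)
  let f : M →+ F.coh d ⊗[k] F.coh d := M.subtype.toAddMonoidHom
  have hf : ∀ (h : Hᵐᵒᵖ) x, f (h • x) = diagAct (F.coh d) (F.coh d) h (f x) := fun h x => rfl
  obtain ⟨τ, h1, h2⟩ := exists_linked (R := R) (fun p hp => exactAt_trivial hd F hp) f hf
  refine ⟨M, _, _, R, τ, ?_, h2⟩
  rintro rfl
  have h3 := h1.eq_zero (fun q hq => hCM.exactAt_of_isLocallyFinite hd hS hMlf R hq)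
    (map_add f) hf
  exact hw (congrFun h3 ⟨w, Submodule.mem_span_singleton_self w⟩)

lemma finrank_coh (F : FreeRes H (TrivialCounitModule k H)) :
    Module.finrank k (F.coh d) = 1 := by
  have hE := nontrivial_coh hd F
  have hlf := hCM.isLocallyFinite_coh hd hS haus F
  have := F.finite_coh d
  obtain ⟨R⟩ := FreeRes.exists_of_finite (A := Hᵐᵒᵖ) (M := F.coh d)
  obtain ⟨hY, hY'⟩ := hCM.coh_coh_trivial hd hS haus F R
  obtain ⟨M, _, _, R', τ, hτ₀, hτ⟩ := hCM.exists_twistAct_invariant hd hS haus F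
  exact finrank_eq_one_of_twistAct hS
    (fun N _ _ _ _ f hf => exists_eq_tmul hS (fun p hp => exactAt_trivial hd F hp) hE
      (fun q hq => hCM.exactAt_of_isLocallyFinite hd hS hlf R hq) hY hY' f hf) hτ₀ hτ

end IsGKCohenMacaulay

end Conclusion

open ENNReal in
theorem AS_Gorenstein_of_AuslanderGorenstein_CohenMacaulay_hopf
    (k : Type u) [Field k] (H : Type u) [Ring H] [HopfAlgebra k H]
    (hS : Function.Bijective (HopfAlgebra.antipode k : H →ₗ[k] H))
    (hnoeth : IsNoetherianRing H) (hnoeth' : IsNoetherianRing Hᵐᵒᵖ)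
    -- `H` is Auslander-Gorenstein:
    (hinj : selfInjectiveDimension H ≠ ⊤) (hinj' : selfInjectiveDimension Hᵐᵒᵖ ≠ ⊤)
    (haus : AuslanderCondition H) (haus' : AuslanderCondition Hᵐᵒᵖ)
    -- `H` is Cohen-Macaulay with respect to Gelfand-Kirillov dimension:
    (hCM : ∀ (M : Type u) [AddCommGroup M] [Module H M] [Module k M]
      [IsScalarTower k H M], Nontrivial M → IsNoetherian H M →
        (moduleGrade H M : ℝ≥0∞) + gkDimModule k H M = gkDim k H) :
    -- `H` is AS-Gorenstein:
    ∃ d : ℕ, selfInjectiveDimension H = (d : ℕ∞) ∧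
      selfInjectiveDimension Hᵐᵒᵖ = (d : ℕ∞) ∧
      (∀ i : ℕ, i ≠ d → Subsingleton (ExtGroup H (TrivialCounitModule k H) H i)) ∧
      Module.finrank k (ExtGroup H (TrivialCounitModule k H) H d) = 1 := by
  obtain ⟨d, hd⟩ := ENat.ne_top_iff_exists.1
    (IsGKCohenMacaulay.moduleGrade_trivial_ne_top (k := k) hinj')
  replace hCM : IsGKCohenMacaulay k H := hCM
  obtain ⟨F⟩ := FreeRes.exists_of_finite (A := H) (M := TrivialCounitModule k H)
  refine ⟨d, hCM.selfInjectiveDimension_eq hd.symm hS haus,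
    hCM.selfInjectiveDimension_op_eq hd.symm hS haus, fun i hi => ?_, ?_⟩
  · obtain hi | hi := hi.lt_or_gt
    · exact (FreeRes.coe_le_moduleGrade_iff d).1 hd.le i hi
    · exact hCM.subsingleton_ext hd.symm hS haus _ i hi
  · rw [← F.finrank_coh, hCM.finrank_coh hd.symm hS haus]
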